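/- Let X₀ be a smooth, embedded, closed plane curve, star-shaped and centrosymmetric with respect to the origin O. Then Gage's area-preserving flow with initial curve X₀ has a smooth solution X(·,t) defined for all t ∈ [0, +∞); i.e., the flow exists globally and the evolving curve is smooth on every finite time interval. -/

import Mathlib

open Real Set MeasureTheory Filter

noncomputable section

/-- Euclidean norm of a plane vector. -/
def vnorm (v : ℝ × ℝ) : ℝ := Real.sqrt (v.1 ^ 2 + v.2 ^ 2)

/-- Determinant of the 2×2 matrix whose rows are the plane vectors `a`, `b`. -/
def vdet (a b : ℝ × ℝ) : ℝ := a.1 * b.2 - a.2 * b.1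

/-- Unit tangent vector of a plane curve. -/
def unitTangent (X : ℝ → ℝ × ℝ) (φ : ℝ) : ℝ × ℝ :=
  (vnorm (deriv X φ))⁻¹ • deriv X φ

/-- Inward unit normal: the rotation of the unit tangent by +π/2. -/
def innerNormal (X : ℝ → ℝ × ℝ) (φ : ℝ) : ℝ × ℝ :=
  (-(unitTangent X φ).2, (unitTangent X φ).1)

/-- Curvature of a plane curve. -/
def curv (X : ℝ → ℝ × ℝ) (φ : ℝ) : ℝ :=
  vdet (deriv X φ) (deriv (deriv X) φ) / vnorm (deriv X φ) ^ 3

/-- Length of a closed plane curve parametrized on `[0, 2π]`. -/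
def clen (X : ℝ → ℝ × ℝ) : ℝ := ∫ φ in (0:ℝ)..(2 * π), vnorm (deriv X φ)

/-- Enclosed area of a closed plane curve. -/
def carea (X : ℝ → ℝ × ℝ) : ℝ :=
  (1 / 2) * ∫ φ in (0:ℝ)..(2 * π), vdet (X φ) (deriv X φ)

/-- A smooth closed plane curve: a smooth `2π`-periodic map `ℝ → ℝ²` with
nonvanishing derivative. -/
structure IsSmoothClosedCurve (X : ℝ → ℝ × ℝ) : Prop where
  smooth : ContDiff ℝ (⊤ : ℕ∞) X
  periodic : Function.Periodic X (2 * π)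
  regular : ∀ φ, deriv X φ ≠ 0

/-- An embedded closed curve: injective over one period. -/
def IsEmbeddedCurve (X : ℝ → ℝ × ℝ) : Prop := Set.InjOn X (Set.Ico 0 (2 * π))

/-- Star-shapedness with respect to a point `O`: `det(X − O, T) > 0` everywhere. -/
def StarShapedWrt (X : ℝ → ℝ × ℝ) (O : ℝ × ℝ) : Prop :=
  ∀ φ, 0 < vdet (X φ - O) (unitTangent X φ)

/-- Centrosymmetry with respect to a point `O`: the image of the curve is invariant
under the point reflection `Z ↦ 2O − Z`. -/
def CentroSymmetricWrt (X : ℝ → ℝ × ℝ) (O : ℝ × ℝ) : Prop :=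
  (fun Z => (2 : ℝ) • O - Z) '' Set.range X = Set.range X

/-- `X` is a smooth solution of Gage's area-preserving flow on the time set `I`
with initial curve `X₀`: `∂X/∂t = α T + (κ − 2π/L) N`. -/
structure IsGAPFSolutionOn (X : ℝ → ℝ → ℝ × ℝ) (X₀ : ℝ → ℝ × ℝ) (I : Set ℝ) : Prop where
  init : ∀ φ, X 0 φ = X₀ φ
  curve : ∀ t ∈ I, IsSmoothClosedCurve (X t)
  smooth : ContDiffOn ℝ (⊤ : ℕ∞) (fun p : ℝ × ℝ => X p.1 p.2) (I ×ˢ Set.univ)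
  flow : ∃ α : ℝ → ℝ → ℝ,
    ∀ t ∈ I, ∀ φ,
      HasDerivWithinAt (fun τ => X τ φ)
        (α t φ • unitTangent (X t) φ +
          (curv (X t) φ - 2 * π / clen (X t)) • innerNormal (X t) φ) I t

set_option linter.all false

namespace GAPF
open scoped ContDiff Topology

/-- A Banach space with a strongly continuous group of contractions (translations). -/
class TrSp (B : Type*) [NormedAddCommGroup B] [NormedSpace ℝ B] where
  tr : ℝ → B →L[ℝ] B
  tr_zero : ∀ f, tr 0 f = f
  tr_add : ∀ a b f, tr (a + b) f = tr a (tr b f)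
  tr_norm : ∀ h f, ‖tr h f‖ ≤ ‖f‖
  tr_cont : ∀ f, Continuous fun h => tr h f

open TrSp

class TrMul (B : Type*) [NormedCommRing B] [NormedAlgebra ℝ B] [TrSp B] : Prop where
  tr_mul : ∀ h (f g : B), tr h (f * g) = tr h f * tr h g
  tr_one : ∀ h, tr h (1 : B) = 1

class TrPer (B : Type*) [NormedAddCommGroup B] [NormedSpace ℝ B] [TrSp B] : Prop where
  tr_per : ∀ f : B, tr (2 * π) f = f

open TrMul TrPer

section basic
variable {B : Type*} [NormedAddCommGroup B] [NormedSpace ℝ B] [TrSp B]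
variable {C : Type*} [NormedAddCommGroup C] [NormedSpace ℝ C] [TrSp C]

theorem tr_joint : Continuous fun p : ℝ × B => tr p.1 p.2 := by
  rw [continuous_iff_continuousAt]
  rintro ⟨h, f⟩
  have h1 : Tendsto (fun p : ℝ × B => ‖p.2 - f‖ + ‖tr p.1 f - tr h f‖) (𝓝 (h, f)) (𝓝 0) := by
    have : Continuous fun p : ℝ × B => ‖p.2 - f‖ + ‖tr p.1 f - tr h f‖ := by
      have := (tr_cont f).comp (continuous_fst (X := ℝ) (Y := B))
      simp only [Function.comp_def] at this
      fun_prop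
    have h2 := this.tendsto (h, f)
    simpa using h2
  rw [ContinuousAt, tendsto_iff_norm_sub_tendsto_zero]
  refine squeeze_zero (fun _ => norm_nonneg _) (fun p => ?_) h1
  have : tr p.1 p.2 - tr h f = tr p.1 (p.2 - f) + (tr p.1 f - tr h f) := by
    rw [map_sub]; abel
  rw [this]
  exact (norm_add_le _ _).trans (add_le_add (tr_norm _ _) le_rfl)

theorem tr_comm (a b : ℝ) (f : B) : tr a (tr b f) = tr b (tr a f) := by
  rw [← tr_add, ← tr_add, add_comm]

theorem tr_neg_tr (a : ℝ) (f : B) : tr (-a) (tr a f) = f := by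
  rw [← tr_add, neg_add_cancel, tr_zero]

def Sm (f : B) : Prop := ContDiff ℝ ∞ (fun h => tr h f)

def D (f : B) : B := deriv (fun h => tr h f) 0

theorem Sm.hasDerivAt {f : B} (hf : Sm f) (h : ℝ) :
    HasDerivAt (fun h => tr h f) (tr h (D f)) h := by
  have h0 : HasDerivAt (fun h => tr h f) (D f) 0 :=
    (hf.differentiable (by simp)).differentiableAt.hasDerivAt
  have h1 : HasDerivAt (fun x => tr (x - h) f) (D f) h := by
    have := HasDerivAt.comp_sub_const h h (f := fun h => tr h f) (f' := D f) (by simpa using h0)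
    exact this
  have h2 := (tr h : B →L[ℝ] B).hasFDerivAt.comp_hasDerivAt h h1
  refine h2.congr_of_eventuallyEq (Eventually.of_forall fun x => ?_)
  simp only [Function.comp_def]
  rw [← tr_add]; congr 2; ring

theorem Sm.D {f : B} (hf : Sm f) : Sm (D f) := by
  have : (fun h => tr h (GAPF.D f)) = deriv (fun h => tr h f) := by
    ext1 h; exact (hf.hasDerivAt h).deriv.symm
  unfold Sm
  rw [this]
  exact ((contDiff_infty_iff_deriv (𝕜 := ℝ)).1 hf).2

theorem D_eq_of_hasDerivAt {f g : B} (h : HasDerivAt (fun h => tr h f) g 0) : D f = g := h.deriv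

theorem Sm.clm {f : B} (hf : Sm f) (L : B →L[ℝ] C) (hL : ∀ h f, L (tr h f) = tr h (L f)) :
    Sm (L f) := by
  have : (fun h => tr h (L f)) = fun h => L (tr h f) := by ext1 h; rw [hL]
  unfold Sm; rw [this]
  exact L.contDiff.comp hf

theorem Sm.D_clm {f : B} (hf : Sm f) (L : B →L[ℝ] C) (hL : ∀ h f, L (tr h f) = tr h (L f)) :
    GAPF.D (L f) = L (GAPF.D f) := by
  apply D_eq_of_hasDerivAt
  have := L.hasFDerivAt.comp_hasDerivAt 0 (hf.hasDerivAt 0)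
  rw [tr_zero] at this
  refine this.congr_of_eventuallyEq (Eventually.of_forall fun x => ?_)
  simp [hL]

theorem Sm.add {f g : B} (hf : Sm f) (hg : Sm g) : Sm (f + g) := by
  unfold Sm; simp only [map_add]; exact ContDiff.add hf hg

theorem Sm.sub {f g : B} (hf : Sm f) (hg : Sm g) : Sm (f - g) := by
  unfold Sm; simp only [map_sub]; exact ContDiff.sub hf hg

theorem Sm.smul {f : B} (hf : Sm f) (c : ℝ) : Sm (c • f) := by
  unfold Sm; simp only [map_smul]; exact ContDiff.const_smul c hf

theorem Sm.D_add {f g : B} (hf : Sm f) (hg : Sm g) : GAPF.D (f + g) = GAPF.D f + GAPF.D g := by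
  apply D_eq_of_hasDerivAt
  simpa [tr_zero] using (hf.hasDerivAt 0).fun_add (hg.hasDerivAt 0)

theorem Sm.D_sub {f g : B} (hf : Sm f) (hg : Sm g) : GAPF.D (f - g) = GAPF.D f - GAPF.D g := by
  apply D_eq_of_hasDerivAt
  simpa [tr_zero] using (hf.hasDerivAt 0).fun_sub (hg.hasDerivAt 0)

theorem Sm.D_smul {f : B} (hf : Sm f) (c : ℝ) : GAPF.D (c • f) = c • GAPF.D f := by
  apply D_eq_of_hasDerivAt
  simpa [tr_zero] using (hf.hasDerivAt 0).fun_const_smul c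

theorem Sm.tr {f : B} (hf : Sm f) (a : ℝ) : Sm (tr a f) :=
  hf.clm (TrSp.tr a) fun h f => tr_comm a h f

theorem Sm.D_tr {f : B} (hf : Sm f) (a : ℝ) : GAPF.D (TrSp.tr a f) = TrSp.tr a (GAPF.D f) :=
  hf.D_clm (TrSp.tr a) fun h f => tr_comm a h f

theorem Sm.iter {f : B} (hf : Sm f) (j : ℕ) : Sm (GAPF.D^[j] f) := by
  induction j with
  | zero => exact hf
  | succ j ih => rw [Function.iterate_succ_apply']; exact ih.D

theorem Sm.D_iter_clm {f : B} (hf : Sm f) (L : B →L[ℝ] C) (hL : ∀ h f, L (TrSp.tr h f) = TrSp.tr h (L f))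
    (j : ℕ) : GAPF.D^[j] (L f) = L (GAPF.D^[j] f) := by
  induction j with
  | zero => rfl
  | succ j ih => rw [Function.iterate_succ_apply', Function.iterate_succ_apply', ih,
      (hf.iter j).D_clm L hL]

theorem sm_of_inv {f : B} (hf : ∀ h, TrSp.tr h f = f) : Sm f := by
  unfold Sm; simp only [hf]; exact contDiff_const

theorem D_of_inv {f : B} (hf : ∀ h, TrSp.tr h f = f) : D f = 0 := by
  unfold D; simp only [hf]; simp

/-- Weighted integral of translates. -/
def conv (w : C(ℝ, ℝ)) (a b : ℝ) : B →L[ℝ] B :=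
  LinearMap.mkContinuousOfExistsBound
    { toFun := fun f => ∫ y in a..b, w y • TrSp.tr (-y) f
      map_add' := fun f g => by
        simp only [map_add, smul_add]
        have h : ∀ f : B, IntervalIntegrable (fun y => w y • TrSp.tr (-y) f) volume a b := fun f =>
          (w.continuous.smul ((tr_cont f).comp continuous_neg)).intervalIntegrable _ _
        exact intervalIntegral.integral_add (h f) (h g)
      map_smul' := fun c f => by
        simp only [map_smul, RingHom.id_apply]
        rw [← intervalIntegral.integral_smul]
        congr 1; ext y; rw [smul_comm] }
    (by
      obtain ⟨M, hM⟩ := (isCompact_uIcc (a := a) (b := b)).exists_bound_of_continuousOn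
        w.continuous.continuousOn
      refine ⟨M * |b - a|, fun f => ?_⟩
      have := intervalIntegral.norm_integral_le_of_norm_le_const (a := a) (b := b)
        (f := fun y => w y • TrSp.tr (-y) f) (C := M * ‖f‖) (fun y hy => by
          rw [norm_smul]
          exact mul_le_mul (hM y (uIoc_subset_uIcc hy)) (tr_norm _ _) (norm_nonneg _)
            ((norm_nonneg _).trans (hM y (uIoc_subset_uIcc hy))))
      calc _ ≤ M * ‖f‖ * |b - a| := this
        _ = _ := by ring)

theorem conv_apply (w : C(ℝ, ℝ)) (a b : ℝ) (f : B) :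
    conv w a b f = ∫ y in a..b, w y • TrSp.tr (-y) f := rfl

theorem conv_ii (w : C(ℝ, ℝ)) (a b : ℝ) (f : B) :
    IntervalIntegrable (fun y => w y • TrSp.tr (-y) f) volume a b :=
  (w.continuous.smul ((tr_cont f).comp continuous_neg)).intervalIntegrable _ _

variable [CompleteSpace B] [CompleteSpace C]

theorem conv_clm (w : C(ℝ, ℝ)) (a b : ℝ) (f : B) (L : B →L[ℝ] C)
    (hL : ∀ h f, L (TrSp.tr h f) = TrSp.tr h (L f)) : L (conv w a b f) = conv w a b (L f) := by
  rw [conv_apply, conv_apply, ← ContinuousLinearMap.intervalIntegral_comp_comm L (conv_ii _ _ _ _)]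
  simp [hL]

theorem conv_tr (w : C(ℝ, ℝ)) (a b h : ℝ) (f : B) :
    conv w a b (TrSp.tr h f) = TrSp.tr h (conv w a b f) :=
  (conv_clm w a b f (TrSp.tr h) fun h' f => tr_comm h h' f).symm

def avg : B →L[ℝ] B := conv (ContinuousMap.const ℝ (1 / (2 * π))) 0 (2 * π)
def Aop : B →L[ℝ] B := conv ⟨fun y => 1 / 2 - y / (2 * π), by fun_prop⟩ 0 (2 * π)
def Jop : B →L[ℝ] B := conv (ContinuousMap.const ℝ (1 / 2)) 0 π

theorem Sm.hasDerivAt_neg {f : B} (hf : Sm f) (y : ℝ) :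
    HasDerivAt (fun y => TrSp.tr (-y) f) (-(TrSp.tr (-y) (GAPF.D f))) y := by
  have := (hf.hasDerivAt (-y)).scomp y (_root_.hasDerivAt_neg y)
  simpa [Function.comp_def] using this

theorem Sm.Aop_D [TrPer B] {f : B} (hf : Sm f) : Aop (GAPF.D f) = f - avg f := by
  have h1 : ∀ y ∈ uIcc 0 (2 * π), HasDerivAt (fun y => -((1 / 2 - y / (2 * π)) • TrSp.tr (-y) f))
      ((1 / 2 - y / (2 * π)) • TrSp.tr (-y) (GAPF.D f) + (1 / (2 * π)) • TrSp.tr (-y) f) y := by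
    intro y _
    have h2 : HasDerivAt (fun y : ℝ => 1 / 2 - y / (2 * π)) (-(1 / (2 * π))) y :=
      ((hasDerivAt_id y).div_const (2 * π)).const_sub (1 / 2)
    have := (h2.fun_smul (hf.hasDerivAt_neg y)).fun_neg
    convert this using 1
    rw [smul_neg, neg_smul]; abel
  have i1 := conv_ii (B := B) ⟨fun y => 1 / 2 - y / (2 * π), by fun_prop⟩ 0 (2 * π) (GAPF.D f)
  have i2 := conv_ii (B := B) (ContinuousMap.const ℝ (1 / (2 * π))) 0 (2 * π) f
  have h3 := intervalIntegral.integral_eq_sub_of_hasDerivAt h1 (i1.add i2)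
  have h4 := intervalIntegral.integral_add i1 i2
  have h5 := h4.symm.trans h3
  have h6 : TrSp.tr (-(2 * π)) f = f := by
    conv_lhs => rw [← tr_per f]
    exact tr_neg_tr _ _
  rw [h6, neg_zero, tr_zero] at h5
  have h7 : Aop (GAPF.D f) + avg f = f := by
    refine Eq.trans h5 ?_
    have : (2 * π) / (2 * π) = 1 := div_self (by positivity)
    rw [this, ← sub_eq_zero]
    module
  exact eq_sub_of_add_eq h7

theorem Sm.Jop_D {f : B} (hf : Sm f) : Jop (GAPF.D f) = (1 / 2 : ℝ) • (f - TrSp.tr (-π) f) := by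
  have h1 : ∀ y ∈ uIcc 0 π, HasDerivAt (fun y => -((1 / 2 : ℝ) • TrSp.tr (-y) f))
      ((1 / 2 : ℝ) • TrSp.tr (-y) (GAPF.D f)) y := by
    intro y _
    have := ((hf.hasDerivAt_neg y).fun_const_smul (1 / 2 : ℝ)).fun_neg
    convert this using 1
    rw [smul_neg, neg_neg]
  have i1 := conv_ii (B := B) (ContinuousMap.const ℝ (1 / 2)) 0 π (GAPF.D f)
  have h3 := intervalIntegral.integral_eq_sub_of_hasDerivAt h1 i1
  refine Eq.trans h3 ?_
  rw [neg_zero, tr_zero]; module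

theorem tr_neg_per [TrPer B] (f : B) : TrSp.tr (-(2 * π)) f = f := by
  conv_lhs => rw [← tr_per f]
  exact tr_neg_tr _ _

theorem tr_avg [TrPer B] (h : ℝ) (f : B) : TrSp.tr h (avg f) = avg f := by
  have hp : Function.Periodic (fun y => (1 / (2 * π)) • TrSp.tr (-y) f) (2 * π) := by
    intro y
    have : TrSp.tr (-(y + 2 * π)) f = TrSp.tr (-y) f := by
      rw [neg_add, tr_add, tr_neg_per]
    simp only [this]
  have h1 : TrSp.tr h (avg f) = ∫ y in (0:ℝ)..(2 * π), (1 / (2 * π)) • TrSp.tr (-(y - h)) f := by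
    unfold avg
    rw [← conv_tr, conv_apply]
    congr 1; ext y
    rw [← tr_add]; simp; ring_nf
  rw [h1, intervalIntegral.integral_comp_sub_right
    (fun y => (1 / (2 * π)) • TrSp.tr (-y) f)]
  have h2 := hp.intervalIntegral_add_eq (0 - h) 0
  rw [show 2 * π - h = 0 - h + 2 * π by ring, h2, zero_add]
  rfl

theorem sm_avg [TrPer B] (f : B) : Sm (avg f) := sm_of_inv fun h => tr_avg h f

theorem D_avg [TrPer B] (f : B) : D (avg f) = 0 := D_of_inv fun h => tr_avg h f

theorem Sm.avg_D [TrPer B] {f : B} (hf : Sm f) : avg (GAPF.D f) = 0 := by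
  rw [← hf.D_clm avg fun h f => conv_tr _ _ _ _ _, D_avg]

theorem Sm.Aop {f : B} (hf : Sm f) : Sm (Aop f) := hf.clm GAPF.Aop fun h f => conv_tr _ _ _ _ _

theorem Sm.D_Aop [TrPer B] {f : B} (hf : Sm f) : GAPF.D (GAPF.Aop f) = f - avg f := by
  rw [hf.D_clm GAPF.Aop fun h f => conv_tr _ _ _ _ _, hf.Aop_D]

end basic

section ring
variable {B : Type*} [NormedCommRing B] [NormedAlgebra ℝ B] [TrSp B] [TrMul B]

theorem Sm.mul {f g : B} (hf : Sm f) (hg : Sm g) : Sm (f * g) := by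
  unfold Sm; simp only [tr_mul]; exact ContDiff.mul hf hg

theorem Sm.D_mul {f g : B} (hf : Sm f) (hg : Sm g) :
    GAPF.D (f * g) = GAPF.D f * g + f * GAPF.D g := by
  apply D_eq_of_hasDerivAt
  simpa [tr_zero, tr_mul] using (hf.hasDerivAt 0).fun_mul (hg.hasDerivAt 0)

/-- The quadratic part. -/
def fq (k : B) : B := k * k - k

def acoef (k : B) : B := Aop (fq k) - avg (Aop (fq k) * k)

def Nl (k : B) : B := acoef k * k

variable [CompleteSpace B] [TrPer B]

theorem Sm.fq {k : B} (hk : Sm k) : Sm (fq k) := (hk.mul hk).sub hk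

theorem Sm.acoef {k : B} (hk : Sm k) : Sm (acoef k) := hk.fq.Aop.sub (sm_avg _)

theorem Sm.Nl {k : B} (hk : Sm k) : Sm (Nl k) := hk.acoef.mul hk

theorem Sm.D_acoef {k : B} (hk : Sm k) :
    GAPF.D (GAPF.acoef k) = GAPF.fq k - avg (GAPF.fq k) := by
  unfold GAPF.acoef
  rw [hk.fq.Aop.D_sub (sm_avg _), D_avg, sub_zero, hk.fq.D_Aop]

end ring
end GAPF

namespace GAPF
open scoped ContDiff Topology
open TrSp TrMul TrPer

structure Wt where
  w : ℝ → ℝ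
  cont : Continuous w
  int : Integrable w

section
variable {B : Type*} [NormedAddCommGroup B] [NormedSpace ℝ B] [TrSp B]

theorem Wt.meas (w : Wt) (s : ℝ) (f : B) : Continuous fun y => w.w y • tr (s * y) f :=
  w.cont.smul ((tr_cont f).comp (continuous_const.mul continuous_id))

theorem Wt.intg (w : Wt) (s : ℝ) (f : B) : Integrable fun y => w.w y • tr (s * y) f := by
  refine (w.int.norm.mul_const ‖f‖).mono' (w.meas s f).aestronglyMeasurable
    (Eventually.of_forall fun y => ?_)
  rw [norm_smul]
  exact mul_le_mul_of_nonneg_left (tr_norm _ _) (norm_nonneg _)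

def Wt.nrm (w : Wt) : ℝ := ∫ y, ‖w.w y‖

theorem Wt.nrm_nonneg (w : Wt) : 0 ≤ w.nrm := integral_nonneg fun _ => norm_nonneg _

def Wt.op (w : Wt) (s : ℝ) : B →L[ℝ] B :=
  LinearMap.mkContinuous
    { toFun := fun f => ∫ y, w.w y • tr (s * y) f
      map_add' := fun f g => by
        simp only [map_add, smul_add]
        exact integral_add (w.intg s f) (w.intg s g)
      map_smul' := fun c f => by
        simp only [map_smul, RingHom.id_apply]
        rw [← integral_smul]
        congr 1; ext y; rw [smul_comm] }
    w.nrm (fun f => by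
      unfold Wt.nrm
      rw [← integral_mul_const]
      refine norm_integral_le_of_norm_le (w.int.norm.mul_const ‖f‖) (Eventually.of_forall fun y => ?_)
      rw [norm_smul]
      exact mul_le_mul_of_nonneg_left (tr_norm _ _) (norm_nonneg _))

theorem Wt.op_apply (w : Wt) (s : ℝ) (f : B) : w.op s f = ∫ y, w.w y • tr (s * y) f := rfl

theorem Wt.op_norm (w : Wt) (s : ℝ) (f : B) : ‖w.op s f‖ ≤ w.nrm * ‖f‖ :=
  LinearMap.mkContinuous_norm_le _ w.nrm_nonneg _ |> fun h =>
    (ContinuousLinearMap.le_opNorm _ _).trans (mul_le_mul_of_nonneg_right h (norm_nonneg _))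

theorem Wt.op_cont (w : Wt) (f : B) : Continuous fun s => w.op s f := by
  simp only [Wt.op_apply]
  refine continuous_of_dominated (bound := fun y => ‖w.w y‖ * ‖f‖)
    (fun s => (w.meas s f).aestronglyMeasurable) (fun s => Eventually.of_forall fun y => ?_)
    (w.int.norm.mul_const ‖f‖) (Eventually.of_forall fun y => ?_)
  · rw [norm_smul]
    exact mul_le_mul_of_nonneg_left (tr_norm _ _) (norm_nonneg _)
  · exact continuous_const.smul ((tr_cont f).comp (continuous_id.mul continuous_const))

theorem Wt.op_joint (w : Wt) : Continuous fun p : ℝ × B => w.op p.1 p.2 := by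
  rw [continuous_iff_continuousAt]
  rintro ⟨h, f⟩
  have h1 : Tendsto (fun p : ℝ × B => w.nrm * ‖p.2 - f‖ + ‖w.op p.1 f - w.op h f‖)
      (𝓝 (h, f)) (𝓝 0) := by
    have : Continuous fun p : ℝ × B => w.nrm * ‖p.2 - f‖ + ‖w.op p.1 f - w.op h f‖ := by
      have := (w.op_cont f).comp (continuous_fst (X := ℝ) (Y := B))
      simp only [Function.comp_def] at this
      fun_prop
    have h2 := this.tendsto (h, f)
    simpa using h2
  rw [ContinuousAt, tendsto_iff_norm_sub_tendsto_zero]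
  refine squeeze_zero (fun _ => norm_nonneg _) (fun p => ?_) h1
  have : w.op p.1 p.2 - w.op h f = w.op p.1 (p.2 - f) + (w.op p.1 f - w.op h f) := by
    rw [map_sub]; abel
  rw [this]
  exact (norm_add_le _ _).trans (add_le_add (w.op_norm _ _) le_rfl)

variable {C : Type*} [NormedAddCommGroup C] [NormedSpace ℝ C] [TrSp C]
variable [CompleteSpace B] [CompleteSpace C]

theorem Wt.op_clm (w : Wt) (s : ℝ) (f : B) (L : B →L[ℝ] C)
    (hL : ∀ h f, L (TrSp.tr h f) = TrSp.tr h (L f)) : L (w.op s f) = w.op s (L f) := by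
  rw [Wt.op_apply, Wt.op_apply, ← ContinuousLinearMap.integral_comp_comm L (w.intg s f)]
  simp [hL]

theorem Wt.op_tr (w : Wt) (s h : ℝ) (f : B) : w.op s (tr h f) = tr h (w.op s f) :=
  (w.op_clm s f (tr h) fun h' f => tr_comm h h' f).symm

end

def gz : ℝ := (√(2 * π))⁻¹

def gw (y : ℝ) : ℝ := gz * rexp (-(1 / 2) * y ^ 2)

theorem gw_int : Integrable gw :=
  (integrable_exp_neg_mul_sq (by norm_num)).const_mul _

theorem gw_int1 : ∫ y, gw y = 1 := by
  unfold gw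
  rw [integral_const_mul, integral_gaussian, gz]
  rw [show π / (1 / 2) = 2 * π by ring]
  exact inv_mul_cancel₀ (by positivity)

theorem gw_nonneg (y : ℝ) : 0 ≤ gw y := by unfold gw gz; positivity

theorem gw_cont : Continuous gw := by unfold gw; fun_prop

theorem ygw_int : Integrable fun y => y * gw y := by
  have := (integrable_mul_exp_neg_mul_sq (b := 1 / 2) (by norm_num)).const_mul gz
  refine this.congr (Eventually.of_forall fun y => ?_)
  simp only [gw]; ring

theorem gw_deriv (y : ℝ) : HasDerivAt gw (-(y * gw y)) y := by
  have h : HasDerivAt (fun y : ℝ => -(1 / 2) * y ^ 2) (-(1 / 2) * (2 * y)) y := by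
    simpa using (hasDerivAt_pow 2 y).const_mul (-(1 / 2 : ℝ))
  have := h.exp.const_mul gz
  refine this.congr_deriv ?_
  unfold gw
  ring

def wH : Wt := ⟨gw, gw_cont, gw_int⟩
def wW : Wt := ⟨fun y => y * gw y, by have := gw_cont; fun_prop, ygw_int⟩

theorem wH_nrm : wH.nrm = 1 := by
  unfold Wt.nrm wH
  simp only [Real.norm_of_nonneg (gw_nonneg _)]
  exact gw_int1

section
variable {B : Type*} [NormedAddCommGroup B] [NormedSpace ℝ B] [TrSp B]

def S (t : ℝ) : B →L[ℝ] B := wH.op (√(2 * t))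

theorem S_norm (t : ℝ) (f : B) : ‖S t f‖ ≤ ‖f‖ := by
  have := wH.op_norm (√(2 * t)) f
  rwa [wH_nrm, one_mul] at this

theorem S_joint : Continuous fun p : ℝ × B => S p.1 p.2 := by
  have h : Continuous fun p : ℝ × B => ((√(2 * p.1), p.2) : ℝ × B) := by fun_prop
  exact (wH.op_joint (B := B)).comp h

variable [CompleteSpace B]

theorem S_tr (t h : ℝ) (f : B) : S t (tr h f) = tr h (S t f) := wH.op_tr _ _ _

theorem S_zero (f : B) : S 0 f = f := by
  unfold S
  rw [Wt.op_apply]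
  simp only [mul_zero, Real.sqrt_zero, zero_mul, tr_zero]
  rw [integral_smul_const]
  show (∫ y, gw y) • f = f
  rw [gw_int1, one_smul]

theorem Sm.W_eq {f : B} (hf : Sm f) (s : ℝ) : wW.op s f = s • wH.op s (GAPF.D f) := by
  have hd : ∀ y, HasDerivAt (fun y => gw y • TrSp.tr (s * y) f)
      (s • (gw y • TrSp.tr (s * y) (GAPF.D f)) - (y * gw y) • TrSp.tr (s * y) f) y := by
    intro y
    have h1 : HasDerivAt (fun y => TrSp.tr (s * y) f) (s • TrSp.tr (s * y) (GAPF.D f)) y := by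
      have h2 : HasDerivAt (fun y : ℝ => s * y) s y := by
        simpa using (hasDerivAt_id y).const_mul s
      exact (hf.hasDerivAt (s * y)).scomp y h2
    have := (gw_deriv y).fun_smul h1
    convert this using 1
    rw [smul_comm s, neg_smul]; abel
  have i1 : Integrable fun y => s • (gw y • TrSp.tr (s * y) (GAPF.D f)) := (wH.intg s _).smul s
  have i2 : Integrable fun y => (y * gw y) • TrSp.tr (s * y) f := wW.intg s f
  have h3 := integral_eq_zero_of_hasDerivAt_of_integrable hd (i1.sub i2) (wH.intg s f)
  rw [integral_sub i1 i2, integral_smul, sub_eq_zero] at h3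
  exact h3.symm

theorem Sm.H_deriv {f : B} (hf : Sm f) (s : ℝ) :
    HasDerivAt (fun s => wH.op s f) (s • wH.op s (GAPF.D (GAPF.D f))) s := by
  rw [← hf.D.W_eq s]
  have h1 : ∀ s y, HasDerivAt (fun s => gw y • TrSp.tr (s * y) f)
      ((y * gw y) • TrSp.tr (s * y) (GAPF.D f)) s := by
    intro s y
    have h1 : HasDerivAt (fun s => TrSp.tr (s * y) f) (y • TrSp.tr (s * y) (GAPF.D f)) s := by
      have h2 : HasDerivAt (fun s : ℝ => s * y) y s := by
        simpa using (hasDerivAt_id s).mul_const y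
      exact (hf.hasDerivAt (s * y)).scomp s h2
    have := h1.fun_const_smul (gw y)
    convert this using 1
    rw [smul_smul, mul_comm]
  have := hasDerivAt_integral_of_dominated_loc_of_deriv_le (μ := volume) (𝕜 := ℝ) (x₀ := s)
    (s := univ) (F := fun s y => gw y • TrSp.tr (s * y) f)
    (F' := fun s y => (y * gw y) • TrSp.tr (s * y) (GAPF.D f))
    (bound := fun y => ‖y * gw y‖ * ‖GAPF.D f‖) univ_mem
    (Eventually.of_forall fun s => (wH.intg s f).aestronglyMeasurable) (wH.intg s f)
    (wW.intg s (GAPF.D f)).aestronglyMeasurable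
    (Eventually.of_forall fun y s _ => by
      rw [norm_smul]
      exact mul_le_mul_of_nonneg_left (tr_norm _ _) (norm_nonneg _))
    (ygw_int.norm.mul_const _)
    (Eventually.of_forall fun y s _ => h1 s y)
  exact this.2

theorem Sm.S_deriv {f : B} (hf : Sm f) {t : ℝ} (ht : 0 < t) :
    HasDerivAt (fun t => S t f) (S t (GAPF.D (GAPF.D f))) t := by
  have h1 : HasDerivAt (fun t : ℝ => √(2 * t)) ((√(2 * t))⁻¹) t := by
    have h2 : HasDerivAt (fun t : ℝ => 2 * t) 2 t := by
      simpa using (hasDerivAt_id t).const_mul 2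
    have := h2.sqrt (by positivity)
    convert this using 1
    field_simp
  have := (hf.H_deriv (√(2 * t))).scomp t h1
  rw [smul_smul, inv_mul_cancel₀ (by positivity), one_smul] at this
  exact this

theorem Sm.S_sub {f : B} (hf : Sm f) {t : ℝ} (ht : 0 ≤ t) :
    S t f - f = ∫ r in (0:ℝ)..t, S r (GAPF.D (GAPF.D f)) := by
  have hc : ∀ f : B, Continuous fun r => S r f := fun f =>
    S_joint.comp (continuous_id.prodMk continuous_const)
  rw [intervalIntegral.integral_eq_sub_of_hasDerivAt_of_le ht (hc f).continuousOn
    (fun x hx => hf.S_deriv hx.1) ((hc _).intervalIntegrable _ _), S_zero]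

end
end GAPF

namespace GAPF
open scoped ContDiff Topology
open TrSp TrMul TrPer

theorem triangle_swap {B : Type*} [NormedAddCommGroup B] [NormedSpace ℝ B] [CompleteSpace B]
    (G : ℝ → ℝ → B) (hG : Continuous fun p : ℝ × ℝ => G p.1 p.2) {t : ℝ} (ht : 0 ≤ t) :
    ∫ s in (0:ℝ)..t, ∫ q in s..t, G q s = ∫ q in (0:ℝ)..t, ∫ s in (0:ℝ)..q, G q s := by
  set f : ℝ → ℝ → B := fun s q => ({p : ℝ × ℝ | p.1 < p.2}).indicator (fun p => G p.2 p.1) (s, q)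
    with hf
  have hm : MeasurableSet {p : ℝ × ℝ | p.1 < p.2} := measurableSet_lt measurable_fst measurable_snd
  have hc : Continuous fun p : ℝ × ℝ => G p.2 p.1 := hG.comp continuous_swap
  have hi : Integrable (Function.uncurry f)
      ((volume.restrict (Ioc 0 t)).prod (volume.restrict (Ioc 0 t))) := by
    have : Function.uncurry f = ({p : ℝ × ℝ | p.1 < p.2}).indicator (fun p => G p.2 p.1) := by
      ext ⟨s, q⟩; rfl
    rw [this]
    refine Integrable.indicator ?_ hm
    rw [Measure.prod_restrict]
    exact (hc.continuousOn.integrableOn_compact (isCompact_Icc.prod isCompact_Icc)).mono_set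
      (prod_mono Ioc_subset_Icc_self Ioc_subset_Icc_self)
  have hsw := integral_integral_swap hi
  rw [intervalIntegral.integral_of_le ht, intervalIntegral.integral_of_le ht]
  calc _ = ∫ s in Ioc 0 t, ∫ q in Ioc 0 t, f s q := by
        refine setIntegral_congr_fun measurableSet_Ioc fun s hs => ?_
        rw [intervalIntegral.integral_of_le hs.2]
        have : ∀ q, f s q = (Ioi s).indicator (fun q => G q s) q := by
          intro q; simp [hf, indicator]
        simp only [this]
        rw [setIntegral_indicator measurableSet_Ioi]
        congr 2
        ext x; simp only [mem_inter_iff, mem_Ioc, mem_Ioi]; constructor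
        · rintro ⟨a, b⟩; exact ⟨⟨hs.1.trans a, b⟩, a⟩
        · rintro ⟨⟨a, b⟩, c⟩; exact ⟨c, b⟩
    _ = ∫ q in Ioc 0 t, ∫ s in Ioc 0 t, f s q := hsw
    _ = _ := by
        refine setIntegral_congr_fun measurableSet_Ioc fun q hq => ?_
        rw [intervalIntegral.integral_of_le hq.1.le]
        have : ∀ s, f s q = (Iio q).indicator (fun s => G q s) s := by
          intro q; simp [hf, indicator]
        simp only [this]
        rw [setIntegral_indicator measurableSet_Iio, integral_Ioc_eq_integral_Ioo]
        congr 2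
        ext x; simp only [mem_inter_iff, mem_Ioc, mem_Iio, mem_Ioo]; constructor
        · rintro ⟨⟨a, b⟩, c⟩; exact ⟨a, c⟩
        · rintro ⟨a, b⟩; exact ⟨⟨a, b.le.trans hq.2⟩, b⟩

section E
variable {B : Type*} [NormedAddCommGroup B] [NormedSpace ℝ B] [TrSp B] {T : ℝ}

instance instTrE : TrSp C(Icc (0:ℝ) T, B) where
  tr h := (tr h : B →L[ℝ] B).compLeftContinuous ℝ (Icc (0:ℝ) T)
  tr_zero f := by ext x; exact tr_zero (f x)
  tr_add a b f := by ext x; exact tr_add a b (f x)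
  tr_norm h f := by
    rw [ContinuousMap.norm_le _ (norm_nonneg _)]
    intro x
    exact (tr_norm h (f x)).trans (f.norm_coe_le_norm x)
  tr_cont f := by
    apply ContinuousMap.continuous_of_continuous_uncurry
    have : Continuous fun p : ℝ × Icc (0:ℝ) T => tr p.1 (f p.2) :=
      tr_joint.comp (continuous_fst.prodMk (f.continuous.comp continuous_snd))
    exact this

theorem trE_apply (h : ℝ) (f : C(Icc (0:ℝ) T, B)) (x) : tr h f x = tr h (f x) := rfl

instance [TrPer B] : TrPer C(Icc (0:ℝ) T, B) where
  tr_per f := by ext x; rw [trE_apply, tr_per]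

instance {B : Type*} [NormedCommRing B] [NormedAlgebra ℝ B] [TrSp B] [TrMul B] :
    TrMul C(Icc (0:ℝ) T, B) where
  tr_mul h f g := by ext x; simp only [trE_apply, ContinuousMap.mul_apply, tr_mul]
  tr_one h := by ext x; simp only [trE_apply, ContinuousMap.one_apply, tr_one]

/-- evaluation at a time -/
def ev (x : Icc (0:ℝ) T) : C(Icc (0:ℝ) T, B) →L[ℝ] B := ContinuousMap.evalCLM ℝ x

theorem ev_apply (x : Icc (0:ℝ) T) (f : C(Icc (0:ℝ) T, B)) : ev x f = f x := rfl

theorem ev_tr (x : Icc (0:ℝ) T) (h) (f : C(Icc (0:ℝ) T, B)) : ev x (tr h f) = tr h (ev x f) := rfl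

theorem Sm.ev {f : C(Icc (0:ℝ) T, B)} (hf : Sm f) (x) : Sm (f x) := hf.clm (GAPF.ev x) (ev_tr x)

theorem Sm.D_ev {f : C(Icc (0:ℝ) T, B)} (hf : Sm f) (x) : GAPF.D (f x) = GAPF.D f x :=
  hf.D_clm (GAPF.ev x) (ev_tr x)

theorem Sm.D_iter_ev {f : C(Icc (0:ℝ) T, B)} (hf : Sm f) (x) (j : ℕ) :
    GAPF.D^[j] (f x) = (GAPF.D^[j] f) x :=
  hf.D_iter_clm (GAPF.ev x) (ev_tr x) j

variable (hT : 0 ≤ T)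

/-- extension to all times -/
def ext (f : C(Icc (0:ℝ) T, B)) (s : ℝ) : B := f (projIcc 0 T hT s)

theorem ext_cont (f : C(Icc (0:ℝ) T, B)) : Continuous (ext hT f) :=
  f.continuous.comp continuous_projIcc

theorem ext_of_mem (f : C(Icc (0:ℝ) T, B)) {s : ℝ} (hs : s ∈ Icc 0 T) : ext hT f s = f ⟨s, hs⟩ := by
  unfold ext; rw [projIcc_of_mem hT hs]

theorem Sm.ext {f : C(Icc (0:ℝ) T, B)} (hf : Sm f) (s) : Sm (ext hT f s) := hf.ev _

theorem Sm.D_ext {f : C(Icc (0:ℝ) T, B)} (hf : Sm f) (s) :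
   GAPF.D (GAPF.ext hT f s) = GAPF.ext hT (GAPF.D f) s := hf.D_ev _

def S0 : B →L[ℝ] C(Icc (0:ℝ) T, B) :=
  LinearMap.mkContinuous
    { toFun := fun f => ⟨fun t => S (t : ℝ) f,
        S_joint.comp (continuous_subtype_val.prodMk continuous_const)⟩
      map_add' := fun f g => by ext; simp
      map_smul' := fun c f => by ext; simp }
    1 (fun f => by
      rw [ContinuousMap.norm_le _ (by positivity), one_mul]
      intro x; exact S_norm _ _)

theorem S0_apply (f : B) (x : Icc (0:ℝ) T) : S0 f x = S (x:ℝ) f := rfl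

theorem S0_norm (f : B) : ‖(S0 f : C(Icc (0:ℝ) T, B))‖ ≤ ‖f‖ := by
  rw [ContinuousMap.norm_le _ (by positivity)]
  intro x; exact S_norm _ _

def Vfun (f : C(Icc (0:ℝ) T, B)) (t : ℝ) : B :=
  √(2 * t) • ∫ ρ in (0:ℝ)..1, wW.op (√(2 * t) * ρ) (ext hT f (t * (1 - ρ ^ 2)))

theorem Vfun_aux (f : C(Icc (0:ℝ) T, B)) :
    Continuous fun p : ℝ × ℝ => wW.op (√(2 * p.1) * p.2) (ext hT f (p.1 * (1 - p.2 ^ 2))) := by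
  have h : Continuous fun p : ℝ × ℝ =>
      ((√(2 * p.1) * p.2, ext hT f (p.1 * (1 - p.2 ^ 2))) : ℝ × B) := by
    have := ext_cont hT f
    fun_prop
  exact (wW.op_joint (B := B)).comp h

theorem Vfun_ii (f : C(Icc (0:ℝ) T, B)) (t a b : ℝ) : IntervalIntegrable
    (fun ρ => wW.op (√(2 * t) * ρ) (ext hT f (t * (1 - ρ ^ 2)))) volume a b :=
  ((Vfun_aux hT f).comp (continuous_const.prodMk continuous_id)).intervalIntegrable _ _

theorem Vfun_cont (f : C(Icc (0:ℝ) T, B)) : Continuous (Vfun hT f) := by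
  unfold Vfun
  refine Continuous.smul (by fun_prop) ?_
  exact intervalIntegral.continuous_parametric_intervalIntegral_of_continuous'
    (f := fun t ρ => wW.op (√(2 * t) * ρ) (ext hT f (t * (1 - ρ ^ 2)))) (Vfun_aux hT f) 0 1

theorem ext_norm (f : C(Icc (0:ℝ) T, B)) (s) : ‖ext hT f s‖ ≤ ‖f‖ := f.norm_coe_le_norm _

theorem Vfun_norm (f : C(Icc (0:ℝ) T, B)) {t : ℝ} (ht : t ∈ Icc 0 T) :
    ‖Vfun hT f t‖ ≤ √(2 * T) * wW.nrm * ‖f‖ := by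
  unfold Vfun
  rw [norm_smul, Real.norm_of_nonneg (by positivity), mul_assoc]
  have h := intervalIntegral.norm_integral_le_of_norm_le_const (a := 0) (b := 1)
        (f := fun ρ => wW.op (√(2 * t) * ρ) (ext hT f (t * (1 - ρ ^ 2)))) (C := wW.nrm * ‖f‖)
        (fun y hy => (wW.op_norm _ _).trans
          (mul_le_mul_of_nonneg_left (ext_norm hT f _) wW.nrm_nonneg))
  simp only [sub_zero, abs_one, mul_one] at h
  refine mul_le_mul (Real.sqrt_le_sqrt (by linarith [ht.2])) h (norm_nonneg _) (by positivity)

def V : C(Icc (0:ℝ) T, B) →L[ℝ] C(Icc (0:ℝ) T, B) :=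
  LinearMap.mkContinuous
    { toFun := fun f => ⟨fun t => Vfun hT f t, (Vfun_cont hT f).comp continuous_subtype_val⟩
      map_add' := fun f g => by
        ext t
        simp only [Vfun, ContinuousMap.add_apply, ContinuousMap.coe_mk]
        rw [← smul_add, ← intervalIntegral.integral_add (Vfun_ii hT f t 0 1) (Vfun_ii hT g t 0 1)]
        congr 2; ext ρ
        rw [← map_add]; rfl
      map_smul' := fun c f => by
        ext t
        simp only [Vfun, ContinuousMap.smul_apply, ContinuousMap.coe_mk, RingHom.id_apply]
        rw [smul_comm c]
        congr 1
        refine Eq.trans ?_ (intervalIntegral.integral_smul c _)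
        refine intervalIntegral.integral_congr fun ρ _ => ?_
        exact (wW.op (√(2 * (t : ℝ)) * ρ)).map_smul c (ext hT f (t * (1 - ρ ^ 2))) }
    (√(2 * T) * wW.nrm) (fun f => by
      have := wW.nrm_nonneg
      rw [ContinuousMap.norm_le _ (by positivity)]
      intro x; exact Vfun_norm hT f x.2)

theorem V_apply (f : C(Icc (0:ℝ) T, B)) (t) : V hT f t = Vfun hT f t := rfl

theorem V_norm (f : C(Icc (0:ℝ) T, B)) : ‖V hT f‖ ≤ √(2 * T) * wW.nrm * ‖f‖ := by
  have := wW.nrm_nonneg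
  rw [ContinuousMap.norm_le _ (by positivity)]
  intro x; exact Vfun_norm hT f x.2

variable [CompleteSpace B]

theorem S0_tr (h) (f : B) : (S0 (tr h f) : C(Icc (0:ℝ) T, B)) = tr h (S0 f) := by
  ext x; rw [S0_apply, S_tr]; rfl

theorem V_tr (h) (f : C(Icc (0:ℝ) T, B)) : V hT (tr h f) = tr h (V hT f) := by
  ext t
  rw [trE_apply, V_apply, V_apply, Vfun, Vfun, map_smul]
  congr 1
  rw [← ContinuousLinearMap.intervalIntegral_comp_comm (tr h) (Vfun_ii hT f t 0 1)]
  congr 1; ext ρ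
  rw [← Wt.op_tr]; rfl

theorem Sm.V {f : C(Icc (0:ℝ) T, B)} (hf : Sm f) {t : ℝ} (ht : 0 ≤ t) :
    Vfun hT f t = ∫ s in (0:ℝ)..t, S (t - s) (GAPF.ext hT (GAPF.D f) s) := by
  set φ : ℝ → B := fun r => S r (GAPF.ext hT (GAPF.D f) (t - r)) with hφ
  have hφc : Continuous φ := by
    have h : Continuous fun r : ℝ => ((r, GAPF.ext hT (GAPF.D f) (t - r)) : ℝ × B) := by
      have := ext_cont hT (GAPF.D f)
      fun_prop
    exact S_joint.comp h
  have h1 : ∫ s in (0:ℝ)..t, S (t - s) (GAPF.ext hT (GAPF.D f) s) = ∫ r in (0:ℝ)..t, φ r := by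
    have := intervalIntegral.integral_comp_sub_left φ t (a := 0) (b := t)
    simp only [hφ, sub_sub_cancel, sub_self, sub_zero] at this
    exact this
  have h2 : ∫ r in (0:ℝ)..t, φ r = ∫ ρ in (0:ℝ)..1, (2 * t * ρ) • φ (t * ρ ^ 2) := by
    have := intervalIntegral.integral_comp_smul_deriv (a := 0) (b := 1) (f := fun ρ => t * ρ ^ 2)
      (f' := fun ρ => 2 * t * ρ) (g := φ) (fun ρ _ => by
        have := (hasDerivAt_pow 2 ρ).const_mul t
        refine this.congr_deriv ?_
        simp; ring) (by fun_prop) hφc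
    simp only [Function.comp_def] at this
    rw [this]; simp
  rw [h1, h2, Vfun, ← intervalIntegral.integral_smul]
  refine intervalIntegral.integral_congr fun ρ hρ => ?_
  rw [uIcc_of_le zero_le_one] at hρ
  simp only [hφ]
  rw [(hf.ext hT _).W_eq, hf.D_ext, smul_smul, S]
  have h3 : √(2 * (t * ρ ^ 2)) = √(2 * t) * ρ := by
    rw [← mul_assoc, Real.sqrt_mul (by positivity), Real.sqrt_sq hρ.1]
  rw [h3, ← mul_assoc, Real.mul_self_sqrt (by positivity)]
  congr 3
  ring

/-- mild solutions with smooth data are integral solutions -/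
theorem mild_integral {k0 : B} (hk0 : Sm k0) {f : C(Icc (0:ℝ) T, B)} (hf : Sm f)
    {u : C(Icc (0:ℝ) T, B)} (hu : u = S0 k0 + V hT f) {t : ℝ} (ht : t ∈ Icc 0 T) :
    u ⟨t, ht⟩ = k0 + ∫ s in (0:ℝ)..t, (ext hT (D (D u)) s + ext hT (D f) s) := by
  have hS0 : Sm (S0 k0 : C(Icc (0:ℝ) T, B)) := hk0.clm S0 fun h f => S0_tr h f
  have hV : Sm (V hT f) := hf.clm (GAPF.V hT) fun h f => V_tr hT h f
  have hVD : D (D (V hT f)) = V hT (D (D f)) := by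
    rw [hf.D_clm (GAPF.V hT) fun h f => V_tr hT h f, hf.D.D_clm (GAPF.V hT) fun h f => V_tr hT h f]
  have hSD : D (D (S0 k0 : C(Icc (0:ℝ) T, B))) = S0 (D (D k0)) := by
    rw [hk0.D_clm S0 fun h f => S0_tr h f, hk0.D.D_clm S0 fun h f => S0_tr h f]
  have hDu : D (D u) = S0 (D (D k0)) + V hT (D (D f)) := by
    rw [hu, hS0.D_add hV, hS0.D.D_add hV.D, hVD, hSD]
  set F := D f with hF
  have hFs : Sm F := hf.D
  have e1 : ∀ q ∈ Icc 0 t, ext hT (D (D u)) q = S q (D (D k0)) +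
      ∫ s in (0:ℝ)..q, S (q - s) (ext hT (D (D F)) s) := by
    intro q hq
    have hq' : q ∈ Icc 0 T := ⟨hq.1, hq.2.trans ht.2⟩
    rw [ext_of_mem hT _ hq', hDu, ContinuousMap.add_apply, S0_apply, V_apply,
      hf.D.D.V hT hq.1]
  have cS : ∀ g : ℝ → B, Continuous g → Continuous fun p : ℝ × ℝ => S (p.1 - p.2) (g p.2) := by
    intro g hg
    have h : Continuous fun p : ℝ × ℝ => ((p.1 - p.2, g p.2) : ℝ × B) := by fun_prop
    exact S_joint.comp h
  have cS' : ∀ g : B, Continuous fun r => S r g := fun g =>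
    S_joint.comp (continuous_id.prodMk continuous_const)
  have c1 : Continuous fun q => ∫ s in (0:ℝ)..q, S (q - s) (ext hT (D (D F)) s) := 
    intervalIntegral.continuous_parametric_intervalIntegral_of_continuous
      (cS _ (ext_cont hT (D (D F)))) continuous_id
  have c2 : Continuous fun s => S (t - s) (ext hT F s) :=
    (cS _ (ext_cont hT F)).comp (continuous_const.prodMk continuous_id)
  have e2 : ∫ s in (0:ℝ)..t, ext hT (D (D u)) s = (S t k0 - k0) +
      ∫ s in (0:ℝ)..t, (S (t - s) (ext hT F s) - ext hT F s) := by
    rw [intervalIntegral.integral_congr (g := fun q => S q (D (D k0)) +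
      ∫ s in (0:ℝ)..q, S (q - s) (ext hT (D (D F)) s)) (fun q hq => e1 q (by rwa [uIcc_of_le ht.1] at hq)),
      intervalIntegral.integral_add ((cS' _).intervalIntegrable _ _) (c1.intervalIntegrable _ _),
      ← hk0.S_sub ht.1, ← triangle_swap (fun q s => S (q - s) (ext hT (D (D F)) s))
        (cS _ (ext_cont hT (D (D F)))) ht.1]
    congr 1
    refine intervalIntegral.integral_congr fun s hs => ?_
    rw [uIcc_of_le ht.1] at hs
    rw [(hFs.ext hT s).S_sub (sub_nonneg.2 hs.2), hFs.D_ext, hFs.D.D_ext]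
    have := intervalIntegral.integral_comp_sub_right (fun r => S r (ext hT (D (D F)) s)) s
      (a := s) (b := t)
    rw [this, sub_self]
  rw [intervalIntegral.integral_add ((ext_cont hT _).intervalIntegrable _ _)
    ((ext_cont hT _).intervalIntegrable _ _), e2,
    intervalIntegral.integral_sub (c2.intervalIntegrable _ _)
    ((ext_cont hT _).intervalIntegrable _ _), hu, ContinuousMap.add_apply, S0_apply, V_apply,
    hf.V hT ht.1]
  abel

end E
end GAPF

namespace GAPF
open scoped ContDiff Topology
open TrSp TrMul TrPer

section lip
variable {B : Type*} [NormedCommRing B] [NormedAlgebra ℝ B]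

def LipB (F : B → B) : Prop := ∀ R : ℝ, 0 ≤ R → ∃ C, 0 ≤ C ∧
  ∀ k k' : B, ‖k‖ ≤ R → ‖k'‖ ≤ R → ‖F k - F k'‖ ≤ C * ‖k - k'‖

theorem LipB.id : LipB (fun k : B => k) := fun R _ => ⟨1, zero_le_one, fun k k' _ _ => by simp⟩

theorem LipB.sub {F G : B → B} (hF : LipB F) (hG : LipB G) : LipB fun k => F k - G k := by
  intro R hR
  obtain ⟨C, hC, h⟩ := hF R hR
  obtain ⟨C', hC', h'⟩ := hG R hR
  refine ⟨C + C', by positivity, fun k k' hk hk' => ?_⟩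
  have := h k k' hk hk'
  have := h' k k' hk hk'
  have e : F k - G k - (F k' - G k') = (F k - F k') - (G k - G k') := by abel
  rw [e]
  refine (norm_sub_le _ _).trans ?_
  linarith

theorem LipB.clm {F : B → B} (hF : LipB F) (L : B →L[ℝ] B) : LipB fun k => L (F k) := by
  intro R hR
  obtain ⟨C, hC, h⟩ := hF R hR
  refine ⟨‖L‖ * C, by positivity, fun k k' hk hk' => ?_⟩
  rw [← map_sub, mul_assoc]
  exact (L.le_opNorm _).trans (mul_le_mul_of_nonneg_left (h k k' hk hk') (norm_nonneg _))

theorem LipB.bd {F : B → B} (hF : LipB F) (R : ℝ) (hR : 0 ≤ R) :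
    ∃ M, 0 ≤ M ∧ ∀ k : B, ‖k‖ ≤ R → ‖F k‖ ≤ M := by
  obtain ⟨C, hC, h⟩ := hF R hR
  refine ⟨C * R + ‖F 0‖, by positivity, fun k hk => ?_⟩
  have h1 := h k 0 hk (by simpa using hR)
  rw [sub_zero] at h1
  have h2 : C * ‖k‖ ≤ C * R := mul_le_mul_of_nonneg_left hk hC
  calc ‖F k‖ = ‖(F k - F 0) + F 0‖ := by rw [sub_add_cancel]
    _ ≤ _ := (norm_add_le _ _).trans (by linarith)

theorem LipB.mul {F G : B → B} (hF : LipB F) (hG : LipB G) : LipB fun k => F k * G k := by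
  intro R hR
  obtain ⟨C, hC, h⟩ := hF R hR
  obtain ⟨C', hC', h'⟩ := hG R hR
  obtain ⟨M, hM, m⟩ := hF.bd R hR
  obtain ⟨M', hM', m'⟩ := hG.bd R hR
  refine ⟨M * C' + C * M', by positivity, fun k k' hk hk' => ?_⟩
  have e : F k * G k - F k' * G k' = F k * (G k - G k') + (F k - F k') * G k' := by ring
  rw [e]
  calc _ ≤ ‖F k * (G k - G k')‖ + ‖(F k - F k') * G k'‖ := norm_add_le _ _
    _ ≤ ‖F k‖ * ‖G k - G k'‖ + ‖F k - F k'‖ * ‖G k'‖ := add_le_add (norm_mul_le _ _) (norm_mul_le _ _)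
    _ ≤ M * (C' * ‖k - k'‖) + (C * ‖k - k'‖) * M' := by
        gcongr
        · exact m k hk
        · exact h' k k' hk hk'
        · exact h k k' hk hk'
        · exact m' k' hk'
    _ = _ := by ring

variable [TrSp B]

theorem lipB_Nl : LipB (Nl : B → B) := by
  have h1 : LipB fun k : B => Aop (fq k) := LipB.clm (F := fq) ((LipB.id.mul LipB.id).sub LipB.id) (Aop : B →L[ℝ] B)
  exact (h1.sub ((h1.mul LipB.id).clm avg)).mul LipB.id

theorem contDiff_Nl : ContDiff ℝ ∞ (Nl : B → B) := by
  have h0 : ContDiff ℝ ∞ fun k : B => k := contDiff_id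
  have h1 : ContDiff ℝ ∞ fun k : B => Aop (fq k) :=
    (Aop : B →L[ℝ] B).contDiff.comp ((h0.mul h0).sub h0)
  exact (h1.sub ((avg : B →L[ℝ] B).contDiff.comp (h1.mul h0))).mul h0

variable [CompleteSpace B] [TrMul B] 

theorem Nl_tr (h : ℝ) (k : B) : Nl (tr h k) = tr h (Nl k) := by
  have hA : ∀ f : B, Aop (tr h f) = tr h (Aop f) := fun f => conv_tr _ _ _ _ _
  have ha : ∀ f : B, avg (tr h f) = tr h (avg f) := fun f => conv_tr _ _ _ _ _
  have hf : fq (tr h k) = tr h (fq k) := by simp only [fq, map_sub, tr_mul]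
  simp only [Nl, acoef, hf, hA, tr_mul, map_sub, ← ha]

theorem Nl_ev {T : ℝ} (x : Icc (0:ℝ) T) (k : C(Icc (0:ℝ) T, B)) : Nl k x = Nl (k x) := by
  have hA : ∀ f : C(Icc (0:ℝ) T, B), Aop f x = Aop (f x) := fun f => conv_clm _ _ _ f (ev x) (ev_tr x)
  have ha : ∀ f : C(Icc (0:ℝ) T, B), avg f x = avg (f x) := fun f => conv_clm _ _ _ f (ev x) (ev_tr x)
  simp only [Nl, acoef, fq, ContinuousMap.mul_apply, ContinuousMap.sub_apply, hA, ha]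

end lip

section loc
variable {B : Type*} [NormedCommRing B] [NormedAlgebra ℝ B] [TrSp B] [CompleteSpace B] [TrMul B]
  [TrPer B]

theorem local_mild (K : ℝ) (hK : 0 ≤ K) : ∃ T, ∃ hT : 0 < T, ∀ k0 : B, Sm k0 → ‖k0‖ ≤ K →
    ∃ k : C(Icc (0:ℝ) T, B), Sm k ∧ k = S0 k0 + V hT.le (Nl k) ∧ ∀ h, tr h k0 = k0 → tr h k = k := by
  obtain ⟨L, hL, hLip⟩ := lipB_Nl (B := B) (K + 2) (by positivity)
  obtain ⟨M, hM, hBd⟩ := (lipB_Nl (B := B)).bd (K + 2) (by positivity)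
  set cw := wW.nrm with hcw
  have hcw0 : 0 ≤ cw := wW.nrm_nonneg
  obtain ⟨q, hq0, hq1, hq2⟩ : ∃ q : ℝ, 0 < q ∧ q * cw * L ≤ 1 / 2 ∧ q * cw * M ≤ 1 := by
    refine ⟨1 / (2 * (cw * L + cw * M + 1)), by positivity, ?_, ?_⟩
    · rw [mul_assoc, div_mul_eq_mul_div, div_le_div_iff₀ (by positivity) (by positivity)]
      nlinarith [mul_nonneg hcw0 hL, mul_nonneg hcw0 hM]
    · rw [mul_assoc, div_mul_eq_mul_div, div_le_iff₀ (by positivity)]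
      nlinarith [mul_nonneg hcw0 hL, mul_nonneg hcw0 hM]
  set T := q ^ 2 / 2 with hTd
  have hT : 0 < T := by positivity
  have hsq : √(2 * T) = q := by
    rw [hTd, show 2 * (q ^ 2 / 2) = q ^ 2 by ring, Real.sqrt_sq hq0.le]
  refine ⟨T, hT, fun k0 hk0 hk0K => ?_⟩
  let E := C(Icc (0:ℝ) T, B)
  have nE : ∀ k : E, ‖k‖ ≤ K + 2 → ∀ x, ‖k x‖ ≤ K + 2 := fun k hk x => (k.norm_coe_le_norm x).trans hk
  have Elip : ∀ k k' : E, ‖k‖ ≤ K + 2 → ‖k'‖ ≤ K + 2 → ‖Nl k - Nl k'‖ ≤ L * ‖k - k'‖ := by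
    intro k k' hk hk'
    rw [ContinuousMap.norm_le _ (by positivity)]
    intro x
    rw [ContinuousMap.sub_apply, Nl_ev, Nl_ev]
    refine (hLip _ _ (nE k hk x) (nE k' hk' x)).trans (mul_le_mul_of_nonneg_left ?_ hL)
    exact (k - k').norm_coe_le_norm x
  have Ebd : ∀ k : E, ‖k‖ ≤ K + 2 → ‖Nl k‖ ≤ M := by
    intro k hk
    rw [ContinuousMap.norm_le _ (by positivity)]
    intro x
    rw [Nl_ev]; exact hBd _ (nE k hk x)
  have VNlip : ∀ k k' : E, ‖k‖ ≤ K + 2 → ‖k'‖ ≤ K + 2 →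
      ‖V hT.le (Nl k) - V hT.le (Nl k')‖ ≤ 1 / 2 * ‖k - k'‖ := by
    intro k k' hk hk'
    rw [← map_sub]
    refine (V_norm hT.le _).trans ?_
    rw [hsq]
    calc _ ≤ q * cw * (L * ‖k - k'‖) := by
          gcongr; exact Elip k k' hk hk'
      _ = q * cw * L * ‖k - k'‖ := by ring
      _ ≤ _ := by gcongr
  let Φ : E → E := fun k => S0 k0 + V hT.le (Nl k)
  have hΦb : ∀ k : E, ‖k‖ ≤ K + 2 → ‖Φ k‖ ≤ K + 1 := by
    intro k hk
    refine (norm_add_le _ _).trans (add_le_add ((S0_norm k0).trans hk0K) ?_)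
    refine (V_norm hT.le _).trans ?_
    rw [hsq]
    refine le_trans ?_ hq2
    have := Ebd k hk
    gcongr
  -- fixed point
  let s : Set E := Metric.closedBall 0 (K + 1)
  have hs : ∀ k : E, k ∈ s → ‖k‖ ≤ K + 1 := fun k hk => by simpa [s] using hk
  have hmaps : MapsTo Φ s s := by
    intro k hk
    have := hΦb k ((hs k hk).trans (by linarith))
    simpa [s] using this
  have hcontr : ContractingWith (1 / 2) (hmaps.restrict Φ s s) := by
    refine ⟨by rw [← NNReal.coe_lt_coe]; norm_num, ?_⟩
    refine LipschitzWith.of_dist_le_mul fun x y => ?_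
    rw [Subtype.dist_eq, Subtype.dist_eq, dist_eq_norm, dist_eq_norm]
    have := VNlip x y ((hs x x.2).trans (by linarith)) ((hs y y.2).trans (by linarith))
    simpa [Φ] using this
  have hsc : IsComplete s := Metric.isClosed_closedBall.isComplete
  have h0s : (0 : E) ∈ s := by simp [s]; linarith
  obtain ⟨k, hks, hkf, -⟩ := hcontr.exists_fixedPoint' hsc hmaps h0s (edist_ne_top _ _)
  have hkf : Φ k = k := hkf
  have hkK := hs k hks
  have huniq : ∀ k' : E, ‖k'‖ ≤ K + 2 → Φ k' = k' → k' = k := by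
    intro k' hk' hf'
    have h1 := VNlip k' k hk' (by linarith)
    have h2 : V hT.le (Nl k') - V hT.le (Nl k) = k' - k := by
      conv_rhs => rw [← hf', ← hkf]
      simp [Φ]
    rw [h2] at h1
    have h3 := norm_nonneg (k' - k)
    have h4 : ‖k' - k‖ = 0 := by linarith
    exact sub_eq_zero.1 (norm_eq_zero.1 h4)
  have hΦtr : ∀ h, tr h k = S0 (tr h k0) + V hT.le (Nl (tr h k)) := by
    intro h
    conv_lhs => rw [← hkf]
    simp only [Φ]
    rw [map_add, S0_tr, Nl_tr, V_tr]
  have hinv : ∀ h, tr h k0 = k0 → tr h k = k := by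
    intro h hh
    apply huniq
    · exact (tr_norm h k).trans (by linarith)
    · have := hΦtr h
      rw [hh] at this
      exact this.symm
  refine ⟨k, ?_, hkf.symm, hinv⟩
  -- smoothness
  let P : E → E := fun k => V hT.le (Nl k)
  have hP : ContDiff ℝ ∞ P :=
    (V (B := B) hT.le : C(Icc (0:ℝ) T, B) →L[ℝ] C(Icc (0:ℝ) T, B)).contDiff.comp contDiff_Nl
  have hPd : HasFDerivAt P (fderiv ℝ P k) k := (hP.differentiable (by simp)).differentiableAt.hasFDerivAt
  have hPn : ‖fderiv ℝ P k‖ ≤ 1 / 2 := by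
    refine hPd.le_of_lip' (by norm_num) ?_
    have : Metric.ball k 1 ∈ 𝓝 k := Metric.ball_mem_nhds k one_pos
    filter_upwards [this] with x hx
    refine VNlip x k ?_ (by linarith)
    rw [mem_ball_iff_norm] at hx
    calc ‖x‖ = ‖(x - k) + k‖ := by rw [sub_add_cancel]
      _ ≤ _ := (norm_add_le _ _).trans (by linarith)
  let G : E → E := fun x => x - P x
  have hG : ContDiff ℝ ∞ G := contDiff_id.sub hP
  let e : E ≃L[ℝ] E := ContinuousLinearEquiv.unitsEquiv ℝ E
    (Units.oneSub (fderiv ℝ P k) (lt_of_le_of_lt hPn (by norm_num)))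
  have hGd : HasFDerivAt G (e : E →L[ℝ] E) k := by
    have := (hasFDerivAt_id (𝕜 := ℝ) k).sub hPd
    exact this
  have hGs : HasStrictFDerivAt G (e : E →L[ℝ] E) k :=
    hG.contDiffAt.hasStrictFDerivAt' hGd (by simp)
  have hinvs := hG.contDiffAt.to_localInverse hGd (by simp)
  have hleft := hGs.eventually_left_inverse
  have hGtr : ∀ h, G (tr h k) = S0 (tr h k0) := by
    intro h
    simp only [G, P]
    conv_lhs => enter [1]; rw [hΦtr h]
    simp
  have hat0 : ContDiffAt ℝ ∞ (fun h => tr h k) 0 := by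
    have h1 : ContDiffAt ℝ ∞ (fun h : ℝ => hGs.localInverse G e k (S0 (tr h k0))) 0 := by
      refine ContDiffAt.comp (0:ℝ) (g := hGs.localInverse G e k) (f := fun h : ℝ => S0 (tr h k0)) ?_ ?_
      · have : S0 (tr 0 k0) = G k := by rw [← hGtr, tr_zero]
        rw [this]; exact hinvs
      · exact ((S0 : B →L[ℝ] E).contDiff.comp hk0).contDiffAt
    refine h1.congr_of_eventuallyEq ?_
    have hc : Tendsto (fun h => tr h k) (𝓝 0) (𝓝 k) := by
      have := (tr_cont k).tendsto 0
      rwa [tr_zero] at this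
    filter_upwards [hc.eventually hleft] with h hh
    rw [← hGtr, hh]
  have : ∀ h0 : ℝ, ContDiffAt ℝ ∞ (fun h => tr h k) h0 := by
    intro h0
    have e1 : (fun h => tr h k) = fun h => tr h0 ((fun h => tr h k) (h - h0)) := by
      ext1 h; beta_reduce; rw [← tr_add]; congr 2; ring
    rw [e1]
    refine (tr h0 : E →L[ℝ] E).contDiff.contDiffAt.comp h0 ?_
    refine ContDiffAt.comp h0 (g := fun h => tr h k) (f := fun h => h - h0) ?_ (by fun_prop)
    simpa using hat0
  exact contDiff_iff_contDiffAt.2 this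

/-- classical smooth solution on the time set `[0,T]`. -/
structure Sol (T : ℝ) (k : ℝ → B) : Prop where
  sm : ∀ t ∈ Icc 0 T, Sm (k t)
  cont : ∀ j, ContinuousOn (fun t => D^[j] (k t)) (Icc 0 T)
  eq : ∀ t ∈ Icc 0 T, HasDerivWithinAt k (D (D (k t)) + D (Nl (k t))) (Icc 0 T) t

theorem local_sol (K : ℝ) (hK : 0 ≤ K) : ∃ T, 0 < T ∧ ∀ k0 : B, Sm k0 → ‖k0‖ ≤ K →
    ∃ k : ℝ → B, k 0 = k0 ∧ Sol T k ∧ ∀ h, tr h k0 = k0 → ∀ t, tr h (k t) = k t := by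
  obtain ⟨T, hT, H⟩ := local_mild (B := B) K hK
  refine ⟨T, hT, fun k0 hk0 hk0K => ?_⟩
  obtain ⟨k, hk, hkf, hinv⟩ := H k0 hk0 hk0K
  have hmi : ∀ t (ht : t ∈ Icc 0 T), ext hT.le k t = k0 + ∫ s in (0:ℝ)..t,
      (ext hT.le (D (D k)) s + ext hT.le (D (Nl k)) s) := by
    intro t ht
    rw [ext_of_mem hT.le k ht]
    exact mild_integral hT.le hk0 hk.Nl hkf ht
  refine ⟨ext hT.le k, ?_, ⟨fun t _ => hk.ext hT.le t, ?_, ?_⟩, ?_⟩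
  · have := hmi 0 ⟨le_rfl, hT.le⟩
    simpa using this
  · intro j
    have : (fun t => D^[j] (ext hT.le k t)) = ext hT.le (D^[j] k) := by
      ext1 t; exact hk.D_iter_ev _ j
    rw [this]
    exact (ext_cont hT.le _).continuousOn
  · intro t ht
    have hc : Continuous fun s => (ext hT.le (D (D k)) s + ext hT.le (D (Nl k)) s) :=
      (ext_cont _ _).add (ext_cont _ _)
    have h1 := (hc.integral_hasStrictDerivAt 0 t).hasDerivAt.const_add k0
    have h2 := h1.hasDerivWithinAt (s := Icc 0 T)
    have h3 := h2.congr hmi (hmi t ht)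
    refine h3.congr_deriv ?_
    rw [hk.D_ext, hk.D.D_ext]
    congr 1
    rw [← hk.Nl.D_ext]
    congr 1
    exact Nl_ev _ _
  · intro h hh t
    have := hinv h hh
    conv_rhs => rw [← this]
    rfl

end loc
end GAPF

namespace GAPF
open scoped ContDiff Topology
open TrSp TrMul TrPer

instance instTwoPi : Fact (0 < 2 * π) := ⟨Real.two_pi_pos⟩

abbrev Cir := AddCircle (2 * π)
abbrev BR := C(Cir, ℝ)
abbrev BC := C(Cir, ℂ)

section
variable {F : Type*} [NormedAddCommGroup F] [NormedSpace ℝ F]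

instance instTrCir : TrSp C(Cir, F) where
  tr h := LinearMap.mkContinuous
    { toFun := fun f => ⟨fun x => f (x + ((h : ℝ) : Cir)), by fun_prop⟩
      map_add' := fun f g => by ext x; rfl
      map_smul' := fun c f => by ext x; rfl } 1 (fun f => by
        rw [ContinuousMap.norm_le _ (by positivity), one_mul]
        intro x; exact f.norm_coe_le_norm _)
  tr_zero f := by ext x; show f (x + ((0:ℝ) : Cir)) = f x; simp
  tr_add a b f := by
    ext x
    show f (x + ((a + b : ℝ) : Cir)) = f (x + (a : Cir) + (b : Cir))
    rw [AddCircle.coe_add, add_assoc]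
  tr_norm h f := by
    rw [ContinuousMap.norm_le _ (by positivity)]
    intro x; exact f.norm_coe_le_norm _
  tr_cont f := by
    apply ContinuousMap.continuous_of_continuous_uncurry
    have h1 : Continuous fun p : ℝ × Cir => p.2 + ((p.1 : ℝ) : Cir) :=
      continuous_snd.add ((AddCircle.continuous_mk' _).comp continuous_fst)
    exact f.continuous.comp h1

theorem trC_apply (h : ℝ) (f : C(Cir, F)) (x : Cir) : tr h f x = f (x + ((h : ℝ) : Cir)) := rfl

instance : TrPer C(Cir, F) where
  tr_per f := by ext x; rw [trC_apply, AddCircle.coe_period, add_zero]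

theorem trC_real (h : ℝ) (f : C(Cir, F)) (x : ℝ) : tr h f (x : Cir) = f ((x + h : ℝ) : Cir) := rfl

/-- point evaluation -/
def pv (x : ℝ) : C(Cir, F) →L[ℝ] F := ContinuousMap.evalCLM ℝ ((x : ℝ) : Cir)

theorem pv_apply (x : ℝ) (f : C(Cir, F)) : pv x f = f (x : Cir) := rfl

theorem extR {f g : C(Cir, F)} (h : ∀ x : ℝ, f (x : Cir) = g (x : Cir)) : f = g := by
  ext x
  induction x using QuotientAddGroup.induction_on with
  | H z => exact h z

theorem Sm.hasDerivAt_pt {f : C(Cir, F)} (hf : Sm f) (x : ℝ) :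
    HasDerivAt (fun x : ℝ => f (x : Cir)) (GAPF.D f (x : Cir)) x := by
  have h1 := (pv 0 : C(Cir, F) →L[ℝ] F).hasFDerivAt.comp_hasDerivAt x (hf.hasDerivAt x)
  have e : ∀ (g : C(Cir, F)) (x : ℝ), pv 0 (TrSp.tr x g) = g (x : Cir) := by
    intro g x
    rw [pv_apply, trC_real, zero_add]
  simp only [Function.comp_def, e] at h1
  exact h1

theorem pv_per (f : C(Cir, F)) (x : ℝ) : f ((x + 2 * π : ℝ) : Cir) = f (x : Cir) := by
  rw [AddCircle.coe_add, AddCircle.coe_period, add_zero]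

theorem pv_cont (f : C(Cir, F)) : Continuous fun x : ℝ => f (x : Cir) :=
  f.continuous.comp (AddCircle.continuous_mk' _)

/-- lift a periodic continuous function. -/
def lft (φ : ℝ → F) (hp : Function.Periodic φ (2 * π)) (hc : Continuous φ) : C(Cir, F) :=
  ⟨hp.lift, continuous_coinduced_dom.mpr hc⟩

theorem lft_apply (φ : ℝ → F) (hp : Function.Periodic φ (2 * π)) (hc : Continuous φ) (x : ℝ) :
    lft φ hp hc (x : Cir) = φ x := rfl

variable [CompleteSpace F]

theorem lft_deriv (φ φ' : ℝ → F) (hp : Function.Periodic φ (2 * π)) (hc : Continuous φ)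
    (hp' : Function.Periodic φ' (2 * π)) (hc' : Continuous φ') (hd : ∀ x, HasDerivAt φ (φ' x) x) (h : ℝ) :
    HasDerivAt (fun h => tr h (lft φ hp hc)) (tr h (lft φ' hp' hc')) h := by
  have hcont : Continuous fun s => tr s (lft φ' hp' hc') := tr_cont _
  have e : ∀ h, tr h (lft φ hp hc) = lft φ hp hc + ∫ s in (0:ℝ)..h, tr s (lft φ' hp' hc') := by
    intro h
    apply extR
    intro x
    rw [ContinuousMap.add_apply, trC_real, lft_apply, lft_apply, ← pv_apply x (∫ s in _.._, _),
      ← ContinuousLinearMap.intervalIntegral_comp_comm _ (hcont.intervalIntegrable _ _)]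
    simp only [pv_apply, trC_real, lft_apply]
    have h1 := intervalIntegral.integral_eq_sub_of_hasDerivAt (a := x) (b := x + h)
      (fun y _ => hd y) (hc'.intervalIntegrable _ _)
    have h2 := intervalIntegral.integral_comp_add_left φ' x (a := 0) (b := h)
    rw [h2, add_zero, h1]; abel
  have h1 := (hcont.integral_hasStrictDerivAt 0 h).hasDerivAt.const_add (lft φ hp hc)
  exact h1.congr_of_eventuallyEq (Eventually.of_forall e)

theorem per_deriv {φ : ℝ → F} (hp : Function.Periodic φ (2 * π)) : Function.Periodic (deriv φ) (2 * π) := by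
  intro x
  have : φ = fun y => φ (y + 2 * π) := by ext1 y; rw [hp y]
  conv_rhs => rw [this]
  rw [deriv_comp_add_const]

theorem lft_sm (φ : ℝ → F) (hp : Function.Periodic φ (2 * π)) (hc : ContDiff ℝ ∞ φ) :
    Sm (lft φ hp hc.continuous) := by
  have : ∀ n : ℕ, ∀ (φ : ℝ → F) (hp : Function.Periodic φ (2 * π)) (hc : ContDiff ℝ ∞ φ),
      ContDiff ℝ n (fun h => tr h (lft φ hp hc.continuous)) := by
    intro n
    induction n with
    | zero => intro φ hp hc; exact contDiff_zero.2 (tr_cont _)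
    | succ n ih =>
      intro φ hp hc
      have hc' : ContDiff ℝ ∞ (deriv φ) := ((contDiff_infty_iff_deriv (𝕜 := ℝ)).1 hc).2
      have hd : ∀ x, HasDerivAt φ (deriv φ x) x := fun x =>
        (hc.differentiable (by simp)).differentiableAt.hasDerivAt
      have hD := lft_deriv φ (deriv φ) hp hc.continuous (per_deriv hp) hc'.continuous hd
      rw [Nat.cast_add, Nat.cast_one, contDiff_succ_iff_deriv]
      refine ⟨fun h => (hD h).differentiableAt, by simp, ?_⟩
      have : deriv (fun h => tr h (lft φ hp hc.continuous)) =
          fun h => tr h (lft (deriv φ) (per_deriv hp) hc'.continuous) := by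
        ext1 h; exact (hD h).deriv
      rw [this]
      exact ih _ _ hc'
  exact contDiff_infty.2 fun n => this n φ hp hc

end

instance {R : Type*} [NormedCommRing R] [NormedAlgebra ℝ R] : TrMul C(Cir, R) where
  tr_mul h f g := by ext x; rfl
  tr_one h := by ext x; rfl

/-- `x ↦ I * f x`. -/
def cI : BR →L[ℝ] BC := (Complex.I • Complex.ofRealCLM : ℝ →L[ℝ] ℂ).compLeftContinuous ℝ Cir
def cR : BR →L[ℝ] BC := Complex.ofRealCLM.compLeftContinuous ℝ Cir
def cIm : BC →L[ℝ] BR := Complex.imCLM.compLeftContinuous ℝ Cir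
def cRe : BC →L[ℝ] BR := Complex.reCLM.compLeftContinuous ℝ Cir
def cj : BC →L[ℝ] BC := (Complex.conjCLE : ℂ →L[ℝ] ℂ).compLeftContinuous ℝ Cir

theorem cI_apply (f : BR) (x) : cI f x = Complex.I * (f x : ℂ) := rfl
theorem cR_apply (f : BR) (x) : cR f x = (f x : ℂ) := rfl
theorem cIm_apply (f : BC) (x) : cIm f x = (f x).im := rfl
theorem cRe_apply (f : BC) (x) : cRe f x = (f x).re := rfl
theorem cj_apply (f : BC) (x) : cj f x = (starRingEnd ℂ) (f x) := rfl

theorem cI_tr (h) (f : BR) : cI (tr h f) = tr h (cI f) := rfl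
theorem cR_tr (h) (f : BR) : cR (tr h f) = tr h (cR f) := rfl
theorem cIm_tr (h) (f : BC) : cIm (tr h f) = tr h (cIm f) := rfl
theorem cRe_tr (h) (f : BC) : cRe (tr h f) = tr h (cRe f) := rfl
theorem cj_tr (h) (f : BC) : cj (tr h f) = tr h (cj f) := rfl

def ex (f : BC) : BC := NormedSpace.exp f

theorem pvc (x : Cir) : Continuous (ContinuousMap.evalAlgHom ℂ ℂ x : BC →ₐ[ℂ] ℂ) :=
  (ContinuousMap.evalCLM ℂ x).continuous

theorem ex_apply (f : BC) (x : Cir) : ex f x = Complex.exp (f x) := by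
  letI : NormedAlgebra ℚ BC := NormedAlgebra.restrictScalars ℚ ℝ BC
  rw [Complex.exp_eq_exp_ℂ]
  exact NormedSpace.map_exp (ContinuousMap.evalAlgHom ℂ ℂ x : BC →ₐ[ℂ] ℂ) (pvc x) f

theorem ex_tr (h) (f : BC) : ex (tr h f) = tr h (ex f) := by
  ext x; rw [trC_apply, ex_apply, ex_apply, trC_apply]

theorem ex_contDiff : ContDiff ℝ ∞ ex := by
  have : ∀ x : BC, AnalyticAt ℝ NormedSpace.exp x := fun x => NormedSpace.exp_analytic x
  exact contDiff_iff_contDiffAt.2 fun x => (this x).contDiffAt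

theorem ex_hasFDerivAt (f : BC) : HasFDerivAt ex (ex f • (1 : BC →L[ℝ] BC)) f := hasFDerivAt_exp

theorem Sm.ex {f : BC} (hf : Sm f) : Sm (ex f) := by
  unfold Sm; simp only [← ex_tr]; exact ex_contDiff.comp hf

theorem Sm.D_ex {f : BC} (hf : Sm f) : GAPF.D (GAPF.ex f) = GAPF.ex f * GAPF.D f := by
  apply D_eq_of_hasDerivAt
  simp only [← ex_tr]
  have h1 : HasFDerivAt GAPF.ex (GAPF.ex f • (1 : BC →L[ℝ] BC)) (TrSp.tr 0 f) := by
    rw [tr_zero]; exact ex_hasFDerivAt f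
  have := h1.comp_hasDerivAt 0 (hf.hasDerivAt 0)
  rw [tr_zero] at this
  exact this

/-- the basic function `x ↦ e^{ix}` -/
def e1 : BC := lft (fun x : ℝ => Complex.exp (Complex.I * x)) (fun x => by
    simp only [Complex.ofReal_add, mul_add, Complex.exp_add]
    rw [show Complex.I * ((2 * π : ℝ) : ℂ) = 2 * π * Complex.I by push_cast; ring,
      Complex.exp_two_pi_mul_I, mul_one]) (by fun_prop)

theorem e1_apply (x : ℝ) : e1 (x : Cir) = Complex.exp (Complex.I * x) := rfl

theorem e1_cd : ContDiff ℝ ∞ (fun x : ℝ => Complex.exp (Complex.I * x)) := by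
  have : ContDiff ℝ ∞ (fun x : ℝ => Complex.I * (x : ℂ)) :=
    contDiff_const.mul Complex.ofRealCLM.contDiff
  exact this.cexp

theorem e1_sm : Sm e1 := lft_sm _ _ e1_cd

theorem e1_D : D e1 = e1 * cI 1 := by
  apply extR
  intro x
  have h1 := (e1_sm.hasDerivAt_pt x).deriv
  rw [← h1, ContinuousMap.mul_apply, cI_apply]
  simp only [e1_apply]
  have h2 : HasDerivAt (fun x : ℝ => Complex.I * (x : ℂ)) Complex.I x := by
    simpa using (Complex.ofRealCLM.hasDerivAt (x := x)).const_mul Complex.I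
  rw [h2.cexp.deriv]; simp

theorem e1_anti : tr (-π) e1 = - e1 := by
  apply extR
  intro x
  rw [trC_real, ContinuousMap.neg_apply, e1_apply, e1_apply, Complex.ofReal_add, mul_add, Complex.exp_add]
  rw [show Complex.I * ((-π : ℝ) : ℂ) = -(π * Complex.I) by push_cast; ring, Complex.exp_neg,
    Complex.exp_pi_mul_I]
  norm_num

end GAPF

namespace GAPF
open scoped ContDiff Topology
open TrSp TrMul TrPer

/-- scalar average -/
def av : BR →L[ℝ] ℝ := (pv 0).comp avg

theorem avg_eq (f : BR) : avg f = av f • (1 : BR) := by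
  apply extR
  intro x
  have h := congrArg (fun g : BR => g ((0:ℝ) : Cir)) (tr_avg x f)
  simp only [trC_real, zero_add] at h
  rw [h]; simp [av, pv_apply]

theorem avg_apply (f : BR) (x : Cir) : avg f x = av f := by
  rw [avg_eq]; simp

theorem av_eq (f : BR) : av f = (1 / (2 * π)) * ∫ y in (0:ℝ)..(2 * π), f ((y : ℝ) : Cir) := by
  have h1 : av f = ∫ y in (0:ℝ)..(2 * π), (1 / (2 * π)) * f ((-y : ℝ) : Cir) := by
    show pv 0 (avg f) = _
    unfold avg
    rw [conv_apply, ← ContinuousLinearMap.intervalIntegral_comp_comm _ (conv_ii _ _ _ _)]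
    simp [pv_apply, trC_real, trC_apply]
  rw [h1, intervalIntegral.integral_const_mul]
  congr 1
  have h2 := intervalIntegral.integral_comp_neg (fun y : ℝ => f (y : Cir)) (a := 0) (b := 2 * π)
  rw [h2]
  have hp : Function.Periodic (fun y : ℝ => f (y : Cir)) (2 * π) := pv_per f
  have h3 := hp.intervalIntegral_add_eq (-(2 * π)) 0
  rw [neg_add_cancel, zero_add] at h3
  rw [neg_zero]; exact h3

theorem av_nonneg {f : BR} (h : ∀ x : ℝ, 0 ≤ f (x : Cir)) : 0 ≤ av f := by
  rw [av_eq]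
  refine mul_nonneg (by positivity) (intervalIntegral.integral_nonneg (by positivity) fun x _ => h x)

theorem av_one : av (1 : BR) = 1 := by
  rw [av_eq]; simp; field_simp

theorem avg_avg_mul (f g : BR) : avg (avg f * g) = av f • avg g := by
  rw [avg_eq f, smul_mul_assoc, one_mul, map_smul]

def mu (k : BR) : ℝ := av (fq k)

theorem mu_nonneg {k : BR} (h1 : avg k = 1) : 0 ≤ mu k := by
  have h2 : av k = 1 := by
    have := congrArg (fun g : BR => g 0) h1
    simpa [avg_apply] using this
  have h3 : fq k = (k - 1) * (k - 1) + (k - 1) := by unfold fq; ring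
  unfold mu
  rw [h3, map_add, map_sub, h2, av_one, sub_self, add_zero]
  apply av_nonneg
  intro x; exact mul_self_nonneg _

theorem D_acoef' {k : BR} (hk : Sm k) : D (acoef k) = fq k - mu k • (1 : BR) := by
  rw [hk.D_acoef, avg_eq]; rfl

theorem avg_Nl {k : BR} (h1 : avg k = 1) : avg (Nl k) = 0 := by
  unfold Nl acoef
  rw [sub_mul, map_sub, avg_avg_mul, h1, avg_eq, sub_self]

theorem av_D {f : BR} (hf : Sm f) : av (D f) = 0 := by
  unfold av; rw [ContinuousLinearMap.comp_apply, hf.avg_D]; simp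

/-- the right hand side of the curvature equation -/
def rhs (k : BR) : BR := D (D k) + D (Nl k)

theorem rhs_eq {k : BR} (hk : Sm k) :
    rhs k = D (D k) + acoef k * D k + k * (fq k - mu k • (1 : BR)) := by
  unfold rhs Nl
  rw [hk.acoef.D_mul hk, D_acoef' hk]; ring

theorem Aop_rhs {k : BR} (hk : Sm k) (h1 : avg k = 1) : Aop (rhs k) = D k + Nl k := by
  unfold rhs
  rw [map_add, hk.D.Aop_D, hk.Nl.Aop_D, avg_Nl h1, hk.avg_D]; simp

theorem sm_one : Sm (1 : BR) := sm_of_inv fun h => tr_one h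
theorem D_one : D (1 : BR) = 0 := D_of_inv fun h => tr_one h

theorem Sm.Jop {f : BC} (hf : Sm f) : Sm (Jop f) := hf.clm GAPF.Jop fun h f => conv_tr _ _ _ _ _
theorem Sm.D_Jop {f : BC} (hf : Sm f) : GAPF.D (GAPF.Jop f) = (1 / 2 : ℝ) • (f - TrSp.tr (-π) f) := by
  rw [hf.D_clm GAPF.Jop fun h f => conv_tr _ _ _ _ _, hf.Jop_D]

theorem Sm.cI {f : BR} (hf : Sm f) : Sm (cI f) := hf.clm GAPF.cI cI_tr
theorem Sm.cR {f : BR} (hf : Sm f) : Sm (cR f) := hf.clm GAPF.cR cR_tr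
theorem Sm.cj {f : BC} (hf : Sm f) : Sm (cj f) := hf.clm GAPF.cj cj_tr
theorem Sm.cIm {f : BC} (hf : Sm f) : Sm (cIm f) := hf.clm GAPF.cIm cIm_tr
theorem Sm.cRe {f : BC} (hf : Sm f) : Sm (cRe f) := hf.clm GAPF.cRe cRe_tr
theorem Sm.D_cI {f : BR} (hf : Sm f) : GAPF.D (GAPF.cI f) = GAPF.cI (GAPF.D f) := hf.D_clm GAPF.cI cI_tr
theorem Sm.D_cR {f : BR} (hf : Sm f) : GAPF.D (GAPF.cR f) = GAPF.cR (GAPF.D f) := hf.D_clm GAPF.cR cR_tr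
theorem Sm.D_cj {f : BC} (hf : Sm f) : GAPF.D (GAPF.cj f) = GAPF.cj (GAPF.D f) := hf.D_clm GAPF.cj cj_tr
theorem Sm.D_cIm {f : BC} (hf : Sm f) : GAPF.D (GAPF.cIm f) = GAPF.cIm (GAPF.D f) := hf.D_clm GAPF.cIm cIm_tr
theorem Sm.D_cRe {f : BC} (hf : Sm f) : GAPF.D (GAPF.cRe f) = GAPF.cRe (GAPF.D f) := hf.D_clm GAPF.cRe cRe_tr

variable (c : ℝ)

def wf (k : BR) : BC := cI (Aop k + c • (1 : BR))
def Tf (k : BR) : BC := e1 * ex (wf c k)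
def Zf (k : BR) : BC := Jop (Tf c k)
def Pf (k : BR) : BC := cj (Zf c k) * Tf c k
def pf (k : BR) : BR := cIm (Pf c k)
def hf (k : BR) : BR := cRe (Pf c k)

variable {c} {k : BR} (hk : Sm k) (h1 : avg k = 1) (hπ : tr (-π) k = k)

theorem Sm.wf {k : BR} (hk : Sm k) : Sm (wf c k) := (hk.Aop.add (sm_one.smul c)).cI
theorem Sm.Tf {k : BR} (hk : Sm k) : Sm (Tf c k) := e1_sm.mul hk.wf.ex
theorem Sm.Zf {k : BR} (hk : Sm k) : Sm (Zf c k) := hk.Tf.Jop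
theorem Sm.Pf {k : BR} (hk : Sm k) : Sm (Pf c k) := hk.Zf.cj.mul hk.Tf
theorem Sm.pf {k : BR} (hk : Sm k) : Sm (pf c k) := hk.Pf.cIm
theorem Sm.hf {k : BR} (hk : Sm k) : Sm (hf c k) := hk.Pf.cRe

theorem D_Tf {k : BR} (hk : Sm k) (h1 : avg k = 1) : D (Tf c k) = Tf c k * cI k := by
  have hw : D (wf c k) = cI (k - 1) := by
    unfold wf
    rw [(hk.Aop.add (sm_one.smul c)).D_cI, hk.Aop.D_add (sm_one.smul c), hk.D_Aop, sm_one.D_smul, D_one, h1]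
    simp
  unfold Tf
  rw [e1_sm.D_mul hk.wf.ex, hk.wf.D_ex, e1_D, hw, map_sub]; ring

theorem anti_Tf {k : BR} (hπ : tr (-π) k = k) : tr (-π) (Tf c k) = - Tf c k := by
  have hA : tr (-π) (Aop k) = Aop k := by
    unfold Aop; rw [← conv_tr, hπ]
  unfold Tf wf
  rw [tr_mul, e1_anti, ← ex_tr, ← cI_tr, map_add, hA, map_smul, tr_one]; ring

theorem D_Zf {k : BR} (hk : Sm k) (hπ : tr (-π) k = k) : D (Zf c k) = Tf c k := by
  unfold Zf
  rw [hk.Tf.D_Jop, anti_Tf hπ, sub_neg_eq_add, ← two_smul ℝ, smul_smul]; norm_num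

theorem anti_Zf {k : BR} (hπ : tr (-π) k = k) : tr (-π) (Zf c k) = - Zf c k := by
  unfold Zf Jop
  rw [← conv_tr, anti_Tf hπ, map_neg]

theorem Tf_apply (k : BR) (x : ℝ) : Tf c k (x : Cir) =
    Complex.exp (((x + Aop k (x : Cir) + c : ℝ) : ℂ) * Complex.I) := by
  unfold Tf wf
  rw [ContinuousMap.mul_apply, e1_apply, ex_apply, ← Complex.exp_add, cI_apply]
  congr 1
  simp; ring

theorem Tf_norm (k : BR) (x : ℝ) : ‖Tf c k (x : Cir)‖ = 1 := by
  rw [Tf_apply, Complex.norm_exp_ofReal_mul_I]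

theorem cj_Tf_mul (k : BR) : cj (Tf c k) * Tf c k = 1 := by
  apply extR
  intro x
  rw [ContinuousMap.mul_apply, cj_apply, mul_comm, Complex.mul_conj, Complex.normSq_eq_norm_sq, Tf_norm]
  simp

theorem Zf_norm (k : BR) (x : ℝ) : ‖Zf c k (x : Cir)‖ ≤ π / 2 := by
  have h1 : Zf c k (x : Cir) = ∫ y in (0:ℝ)..π, (1 / 2 : ℝ) • Tf c k ((x - y : ℝ) : Cir) := by
    rw [← pv_apply x]
    unfold Zf Jop
    rw [conv_apply, ← ContinuousLinearMap.intervalIntegral_comp_comm _ (conv_ii _ _ _ _)]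
    simp only [map_smul, pv_apply, trC_real]
    rfl
  rw [h1]
  have := intervalIntegral.norm_integral_le_of_norm_le_const (a := 0) (b := π)
    (f := fun y => (1 / 2 : ℝ) • Tf c k ((x - y : ℝ) : Cir)) (C := 1 / 2) (fun y _ => by
      rw [norm_smul, Tf_norm]; norm_num)
  rw [sub_zero, abs_of_pos pi_pos] at this
  linarith

theorem Pf_re_im (k : BR) (x : Cir) : Pf c k x = (hf c k x : ℂ) + (pf c k x : ℂ) * Complex.I := by
  exact (Complex.re_add_im _).symm

theorem Pf_norm (k : BR) (x : ℝ) : ‖Pf c k (x : Cir)‖ ≤ π / 2 := by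
  unfold Pf
  rw [ContinuousMap.mul_apply, norm_mul, Tf_norm, mul_one, cj_apply, Complex.norm_conj]
  exact Zf_norm k x

theorem pf_le (k : BR) (x : ℝ) : pf c k (x : Cir) ≤ π / 2 :=
  (le_abs_self _).trans ((Complex.abs_im_le_norm _).trans (Pf_norm k x))

theorem D_Pf {k : BR} (hk : Sm k) (h1 : avg k = 1) (hπ : tr (-π) k = k) :
    D (Pf c k) = 1 + Pf c k * cI k := by
  unfold Pf
  rw [hk.Zf.cj.D_mul hk.Tf, hk.Zf.D_cj, D_Zf hk hπ, cj_Tf_mul, D_Tf hk h1]; ring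

theorem D_pf {k : BR} (hk : Sm k) (h1 : avg k = 1) (hπ : tr (-π) k = k) :
    D (pf c k) = k * hf c k := by
  unfold pf
  rw [hk.Pf.D_cIm, D_Pf hk h1 hπ]
  ext x
  simp only [cIm_apply, ContinuousMap.add_apply, ContinuousMap.mul_apply, Pf_re_im, cI_apply]
  simp; ring

theorem D_hf {k : BR} (hk : Sm k) (h1 : avg k = 1) (hπ : tr (-π) k = k) :
    D (hf c k) = 1 - k * pf c k := by
  unfold hf
  rw [hk.Pf.D_cRe, D_Pf hk h1 hπ]
  ext x
  simp only [cRe_apply, ContinuousMap.add_apply, ContinuousMap.mul_apply, Pf_re_im, cI_apply]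
  simp; ring

/-- velocity -/
def Yf (c : ℝ) (k : BR) : BC := cI (k - 1) * Tf c k + cR (acoef k) * Tf c k + mu k • Zf c k

theorem Sm.Yf {k : BR} (hk : Sm k) : Sm (Yf c k) :=
  (((hk.sub sm_one).cI.mul hk.Tf).add (hk.acoef.cR.mul hk.Tf)).add (hk.Zf.smul _)

theorem D_Yf {k : BR} (hk : Sm k) (h1 : avg k = 1) (hπ : tr (-π) k = k) :
    D (Yf c k) = Tf c k * cI (D k + Nl k) := by
  unfold Yf
  rw [(((hk.sub sm_one).cI.mul hk.Tf).add (hk.acoef.cR.mul hk.Tf)).D_add (hk.Zf.smul _),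
    ((hk.sub sm_one).cI.mul hk.Tf).D_add (hk.acoef.cR.mul hk.Tf), hk.Zf.D_smul, D_Zf hk hπ,
    (hk.sub sm_one).cI.D_mul hk.Tf, hk.acoef.cR.D_mul hk.Tf, D_Tf hk h1, (hk.sub sm_one).D_cI,
    hk.D_sub sm_one, D_one, hk.acoef.D_cR, D_acoef' hk]
  ext x
  simp only [ContinuousMap.add_apply, ContinuousMap.mul_apply, cI_apply, cR_apply, fq, Nl,
    ContinuousMap.sub_apply, ContinuousMap.smul_apply, ContinuousMap.one_apply, ContinuousMap.zero_apply]
  simp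
  linear_combination (Tf c k x * (k x : ℂ) * ((k x : ℂ) - 1)) * Complex.I_mul_I

theorem anti_Yf {k : BR} (hπ : tr (-π) k = k) : tr (-π) (Yf c k) = - Yf c k := by
  have hq : tr (-π) (fq k) = fq k := by unfold fq; rw [map_sub, tr_mul, hπ]
  have hA : tr (-π) (acoef k) = acoef k := by
    unfold acoef
    rw [map_sub, tr_avg]; unfold Aop; rw [← conv_tr, hq]
  unfold Yf
  rw [map_add, map_add, tr_mul, tr_mul, map_smul, anti_Zf hπ, anti_Tf hπ, ← cI_tr, ← cR_tr, hA, map_sub, hπ, tr_one]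
  rw [smul_neg]; ring

theorem Jop_Yf {k : BR} (hk : Sm k) (h1 : avg k = 1) (hπ : tr (-π) k = k) :
    Jop (Tf c k * cI (D k + Nl k)) = Yf c k := by
  rw [← D_Yf hk h1 hπ, hk.Yf.Jop_D, anti_Yf hπ, sub_neg_eq_add, ← two_smul ℝ, smul_smul]; norm_num

end GAPF

namespace GAPF
open scoped ContDiff Topology
open TrSp TrMul TrPer

section dt
variable {c : ℝ} {k : ℝ → BR} {I : Set ℝ} {t : ℝ}

theorem Tf_dt (hk : HasDerivWithinAt k (rhs (k t)) I t) (hs : Sm (k t)) (h1 : avg (k t) = 1) :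
    HasDerivWithinAt (fun t => Tf c (k t)) (Tf c (k t) * cI (D (k t) + Nl (k t))) I t := by
  have e1' := (Aop : BR →L[ℝ] BR).hasFDerivAt.comp_hasDerivWithinAt t hk
  have e2 := cI.hasFDerivAt.comp_hasDerivWithinAt t (e1'.add_const (c • (1 : BR)))
  have e3 := (ex_hasFDerivAt (wf c (k t))).comp_hasDerivWithinAt t e2
  have e4 := e3.const_mul e1
  rw [Aop_rhs hs h1] at e4
  refine HasDerivWithinAt.congr_deriv e4 ?_
  unfold Tf
  simp [mul_assoc]

theorem Zf_dt (hk : HasDerivWithinAt k (rhs (k t)) I t) (hs : Sm (k t)) (h1 : avg (k t) = 1)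
    (hπ : tr (-π) (k t) = k t) :
    HasDerivWithinAt (fun t => Zf c (k t)) (Yf c (k t)) I t := by
  have := (Jop : BC →L[ℝ] BC).hasFDerivAt.comp_hasDerivWithinAt t (Tf_dt (c := c) hk hs h1)
  rw [Jop_Yf hs h1 hπ] at this
  exact this

theorem Pf_dt (hk : HasDerivWithinAt k (rhs (k t)) I t) (hs : Sm (k t)) (h1 : avg (k t) = 1)
    (hπ : tr (-π) (k t) = k t) :
    HasDerivWithinAt (fun t => Pf c (k t)) (cj (Yf c (k t)) * Tf c (k t) +
      cj (Zf c (k t)) * (Tf c (k t) * cI (D (k t) + Nl (k t)))) I t := by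
  have h2 := cj.hasFDerivAt.comp_hasDerivWithinAt t (Zf_dt (c := c) hk hs h1 hπ)
  exact h2.fun_mul (Tf_dt hk hs h1)

theorem pf_dt (hk : HasDerivWithinAt k (rhs (k t)) I t) (hs : Sm (k t)) (h1 : avg (k t) = 1)
    (hπ : tr (-π) (k t) = k t) :
    HasDerivWithinAt (fun t => pf c (k t)) (1 - k t + mu (k t) • pf c (k t) +
      (D (k t) + acoef (k t) * k t) * hf c (k t)) I t := by
  have h2 := cIm.hasFDerivAt.comp_hasDerivWithinAt t (Pf_dt (c := c) hk hs h1 hπ)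
  refine HasDerivWithinAt.congr_deriv h2 ?_
  ext x
  have hT : (starRingEnd ℂ) (Tf c (k t) x) * Tf c (k t) x = 1 := congrArg (fun g : BC => g x) (cj_Tf_mul (c := c) (k t))
  have hP := Pf_re_im (c := c) (k t) x
  have hP' : Pf c (k t) x = (starRingEnd ℂ) (Zf c (k t) x) * Tf c (k t) x := rfl
  rw [hP'] at hP
  have e : (cj (Yf c (k t)) * Tf c (k t) +
      cj (Zf c (k t)) * (Tf c (k t) * cI (D (k t) + Nl (k t)))) x =
      -Complex.I * (k t x - 1) + acoef (k t) x + mu (k t) * ((hf c (k t) x : ℂ) + (pf c (k t) x : ℂ) * Complex.I)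
      + ((hf c (k t) x : ℂ) + (pf c (k t) x : ℂ) * Complex.I) * (Complex.I * ((D (k t) x + acoef (k t) x * k t x : ℝ) : ℂ)) := by
    rw [← hP]
    simp only [ContinuousMap.add_apply, ContinuousMap.mul_apply, cI_apply, cR_apply, cj_apply, Nl, Yf,
      ContinuousMap.sub_apply, ContinuousMap.smul_apply, ContinuousMap.one_apply]
    simp
    linear_combination (-Complex.I * (k t x - 1) + acoef (k t) x) * hT
  show cIm _ x = _
  rw [cIm_apply, e]
  simp; ring

theorem av_pf_dt (hk : HasDerivWithinAt k (rhs (k t)) I t) (hs : Sm (k t)) (h1 : avg (k t) = 1)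
    (hπ : tr (-π) (k t) = k t) :
    HasDerivWithinAt (fun t => av (pf c (k t))) (2 * mu (k t) * av (pf c (k t))) I t := by
  have h2 := av.hasFDerivAt.comp_hasDerivWithinAt t (pf_dt (c := c) hk hs h1 hπ)
  refine HasDerivWithinAt.congr_deriv h2 ?_
  have s1 : Sm (k t * hf c (k t)) := hs.mul hs.hf
  have s2 : Sm (acoef (k t) * pf c (k t)) := hs.acoef.mul hs.pf
  have s3 : Sm ((2 : ℝ) • Aop (k t)) := hs.Aop.smul 2
  have e : 1 - k t + mu (k t) • pf c (k t) + (D (k t) + acoef (k t) * k t) * hf c (k t) =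
      (2 * mu (k t)) • pf c (k t) + D (k t * hf c (k t) + acoef (k t) * pf c (k t) - hf c (k t) - (2:ℝ) • Aop (k t)) := by
    rw [((s1.add s2).sub hs.hf).D_sub s3, (s1.add s2).D_sub hs.hf, s1.D_add s2, hs.Aop.D_smul, hs.D_Aop, h1,
      hs.D_mul hs.hf, hs.acoef.D_mul hs.pf, D_acoef' hs, D_hf hs h1 hπ, D_pf hs h1 hπ]
    ext x
    simp [fq]; ring
  rw [e, map_add, av_D (((s1.add s2).sub hs.hf).sub s3)]
  simp

end dt

structure GSol (T : ℝ) (k : ℝ → BR) : Prop extends Sol T k where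
  av1 : ∀ t ∈ Icc 0 T, avg (k t) = 1
  per : ∀ t ∈ Icc 0 T, tr (-π) (k t) = k t

theorem Sol.mono {T S : ℝ} {k : ℝ → BR} (h : Sol T k) (hS : S ≤ T) : Sol S k :=
  ⟨fun t ht => h.sm t (Icc_subset_Icc_right hS ht), fun j => (h.cont j).mono (Icc_subset_Icc_right hS),
    fun t ht => (h.eq t (Icc_subset_Icc_right hS ht)).mono (Icc_subset_Icc_right hS)⟩

theorem GSol.mono {T S : ℝ} {k : ℝ → BR} (h : GSol T k) (hS : S ≤ T) : GSol S k :=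
  ⟨h.toSol.mono hS, fun t ht => h.av1 t (Icc_subset_Icc_right hS ht),
    fun t ht => h.per t (Icc_subset_Icc_right hS ht)⟩

theorem Sol.avg_const {T : ℝ} {k : ℝ → BR} (h : Sol T k) : ∀ t ∈ Icc 0 T, avg (k t) = avg (k 0) := by
  have hd : ∀ t ∈ Icc 0 T, HasDerivWithinAt (fun t => avg (k t)) 0 (Icc 0 T) t := by
    intro t ht
    have := (avg : BR →L[ℝ] BR).hasFDerivAt.comp_hasDerivWithinAt t (h.eq t ht)
    refine HasDerivWithinAt.congr_deriv this ?_
    rw [map_add, (h.sm t ht).D.avg_D, (h.sm t ht).Nl.avg_D, add_zero]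
  intro t ht
  refine constant_of_has_deriv_right_zero (fun t ht => (hd t ht).continuousWithinAt) (fun s hs => ?_) t ht
  exact ((hd s (Ico_subset_Icc_self hs)).mono_of_mem_nhdsWithin
    (Icc_mem_nhdsGE_of_mem hs))

/-- barrier lemma -/
theorem barrier {T : ℝ} {g : ℝ → BR} (hc : ContinuousOn g (Icc 0 T)) (h0 : ∀ x, 0 < g 0 x)
    (H : ∀ t ∈ Ioc 0 T, (∀ s ∈ Icc 0 t, ∀ x, 0 ≤ g s x) → ∀ x : ℝ, g t (x : Cir) = 0 → False) :
    ∀ t ∈ Icc 0 T, ∀ x, 0 < g t x := by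
  by_contra hcon
  push Not at hcon
  obtain ⟨t1, ht1, x1, hx1⟩ := hcon
  have hT : 0 ≤ T := ht1.1.trans ht1.2
  let G : ℝ × Cir → ℝ := fun p => g (max 0 (min T p.1)) p.2
  have hG : Continuous G := by
    have h1 : Continuous fun s : ℝ => g (max 0 (min T s)) :=
      hc.comp_continuous (by fun_prop) fun s => ⟨le_max_left _ _, max_le hT (min_le_left _ _)⟩
    exact (h1.comp continuous_fst).eval continuous_snd
  let S : Set (ℝ × Cir) := (Icc 0 T ×ˢ univ) ∩ {p | G p ≤ 0}
  have hS : IsCompact S := (isCompact_Icc.prod isCompact_univ).inter_right (isClosed_le hG continuous_const)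
  have hGe : ∀ t ∈ Icc 0 T, ∀ x, G (t, x) = g t x := by
    intro t ht x
    show g (max 0 (min T t)) x = _
    rw [min_eq_right ht.2, max_eq_right ht.1]
  have hne : (Prod.fst '' S).Nonempty := ⟨t1, (t1, x1), ⟨⟨ht1, trivial⟩, by
    show G _ ≤ 0
    rw [hGe _ ht1]; exact hx1⟩, rfl⟩
  obtain ⟨t, ⟨⟨t', x⟩, hmem, rfl⟩, hmin⟩ := (hS.image continuous_fst).exists_isLeast hne
  obtain ⟨⟨ht, -⟩, hle⟩ := hmem
  have hle' : g t' x ≤ 0 := by rw [← hGe _ ht]; exact hle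
  simp only at ht hmin
  have htpos : 0 < t' := by
    rcases ht.1.eq_or_lt with h | h
    · subst h; exact absurd hle' (not_le.2 (h0 x))
    · exact h
  have hlt : ∀ s ∈ Ico 0 t', ∀ y, 0 < g s y := by
    intro s hs y
    by_contra hneg
    have hs' : s ∈ Icc 0 T := ⟨hs.1, hs.2.le.trans ht.2⟩
    have := hmin ⟨(s, y), ⟨⟨hs', trivial⟩, by show G _ ≤ 0; rw [hGe _ hs']; exact not_lt.1 hneg⟩, rfl⟩
    exact absurd hs.2 (not_lt.2 this)
  have hall : ∀ s ∈ Icc 0 t', ∀ y, 0 ≤ g s y := by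
    intro s hs y
    rcases hs.2.eq_or_lt with h | h
    · subst h
      have hcl : s ∈ closure (Ico 0 s) := by rw [closure_Ico htpos.ne]; exact ⟨ht.1, le_rfl⟩
      have hcy : Continuous fun s => G (s, y) := hG.comp (by fun_prop)
      rw [← hGe _ ht]
      have hcl2 : IsClosed {s | 0 ≤ G (s, y)} := isClosed_le continuous_const hcy
      refine hcl2.closure_subset_iff.2 ?_ hcl
      intro r hr
      show 0 ≤ G _
      rw [hGe _ ⟨hr.1, hr.2.le.trans ht.2⟩]; exact (hlt r hr y).le
    · exact (hlt s ⟨hs.1, h⟩ y).le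
  obtain ⟨z, rfl⟩ := QuotientAddGroup.mk_surjective x
  exact H t' ⟨htpos, ht.2⟩ hall z (le_antisymm hle' (hall t' ⟨ht.1, le_rfl⟩ _))

theorem touch {T t : ℝ} {g : ℝ → BR} {g' : BR} (ht : t ∈ Ioc 0 T)
    (hg : HasDerivWithinAt g g' (Icc 0 T) t) (hs : Sm (g t))
    (hpos : ∀ s ∈ Icc 0 t, ∀ x, 0 ≤ g s x) {x : ℝ} (hx : g t (x : Cir) = 0) :
    D (g t) (x : Cir) = 0 ∧ 0 ≤ D (D (g t)) (x : Cir) ∧ g' (x : Cir) ≤ 0 := by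
  have hmin : IsLocalMin (fun x : ℝ => g t (x : Cir)) x := by
    exact
    Eventually.of_forall fun y => by simp only [hx]; exact hpos t ⟨ht.1.le, le_rfl⟩ _
  have hd := hs.hasDerivAt_pt
  have hd2 := hs.D.hasDerivAt_pt
  have h1 : D (g t) (x : Cir) = 0 := hmin.hasDerivAt_eq_zero (hd x)
  refine ⟨h1, ?_, ?_⟩
  · by_contra hneg
    push Not at hneg
    have hde : deriv (fun x : ℝ => g t (x : Cir)) = fun x : ℝ => D (g t) (x : Cir) := funext fun x => (hd x).deriv
    -- strict local maximum contradiction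
    have hslope := (hd2 x).tendsto_slope
    have hev : ∀ᶠ y in 𝓝[≠] x, slope (fun x : ℝ => D (g t) (x : Cir)) x y < 0 :=
      hslope.eventually (gt_mem_nhds hneg)
    have hev2 : ∀ᶠ y : ℝ in 𝓝[>] x, D (g t) (y : Cir) < 0 := by
      have : ∀ᶠ y in 𝓝[>] x, slope (fun x : ℝ => D (g t) (x : Cir)) x y < 0 :=
        hev.filter_mono (nhdsWithin_mono _ fun y hy => ne_of_gt hy)
      filter_upwards [this, self_mem_nhdsWithin] with y hy hxy
      rw [slope_def_field, h1, sub_zero, div_neg_iff] at hy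
      rcases hy with h | h
      · exact absurd h.2 (not_lt.2 (sub_nonneg.2 (le_of_lt hxy)))
      · exact h.1
    obtain ⟨b, hb, hbs⟩ := (mem_nhdsGT_iff_exists_Ioo_subset).1 hev2
    have hxb : x < (x + b) / 2 := by have : x < b := hb; linarith
    have hanti : StrictAntiOn (fun x : ℝ => g t (x : Cir)) (Icc x ((x + b) / 2)) := by
      refine strictAntiOn_of_deriv_neg (convex_Icc _ _) (pv_cont _).continuousOn ?_
      intro y hy
      rw [interior_Icc] at hy
      rw [(hd y).deriv]
      exact hbs ⟨hy.1, by have := hy.2; have : x < b := hb; linarith⟩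
    have := hanti ⟨le_rfl, hxb.le⟩ ⟨hxb.le, le_rfl⟩ hxb
    simp only [hx] at this
    exact absurd this (not_lt.2 (hpos t ⟨ht.1.le, le_rfl⟩ _))
  · have hpt := (pv x : BR →L[ℝ] ℝ).hasFDerivAt.comp_hasDerivWithinAt t hg
    have hpt2 : HasDerivWithinAt (fun s => g s (x : Cir)) (g' (x : Cir)) (Iio t) t :=
      (HasDerivWithinAt.mono hpt (s := Ioo 0 t) fun s hs => ⟨hs.1.le, hs.2.le.trans ht.2⟩).mono_of_mem_nhdsWithin
        (Ioo_mem_nhdsLT ht.1)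
    have hsl := (hasDerivWithinAt_iff_tendsto_slope' (by simp)).1 hpt2
    refine le_of_tendsto hsl ?_
    filter_upwards [Ioo_mem_nhdsLT ht.1] with s hs
    rw [slope_def_field, hx, sub_zero]
    exact div_nonpos_of_nonneg_of_nonpos (hpos s ⟨hs.1.le, hs.2.le⟩ _) (by linarith [hs.2])

theorem max_principle {T : ℝ} {g g' : ℝ → BR} (h0 : ∀ x, 0 < g 0 x)
    (hg : ∀ t ∈ Icc 0 T, HasDerivWithinAt g (g' t) (Icc 0 T) t) (hs : ∀ t ∈ Icc 0 T, Sm (g t))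
    (H : ∀ t ∈ Ioc 0 T, ∀ x : ℝ, g t (x : Cir) = 0 → D (g t) (x : Cir) = 0 →
      0 ≤ D (D (g t)) (x : Cir) → 0 < g' t (x : Cir)) :
    ∀ t ∈ Icc 0 T, ∀ x, 0 < g t x := by
  refine barrier (fun t ht => (hg t ht).continuousWithinAt) h0 fun t ht hpos x hx => ?_
  obtain ⟨h1, h2, h3⟩ := touch ht (hg t (Ioc_subset_Icc_self ht)) (hs t (Ioc_subset_Icc_self ht)) hpos hx
  exact absurd (H t ht x hx h1 h2) (not_lt.2 h3)

end GAPF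

namespace GAPF
open scoped ContDiff Topology
open TrSp TrMul TrPer

theorem mono_of {f f' : ℝ → ℝ} (hd : ∀ s, HasDerivAt f (f' s) s) {σ : ℝ}
    (h : ∀ s ∈ Icc 0 σ, 0 ≤ f' s) : ∀ s ∈ Icc 0 σ, f 0 ≤ f s := by
  have hm : MonotoneOn f (Icc 0 σ) := by
    refine monotoneOn_of_deriv_nonneg (convex_Icc _ _) (fun s _ => (hd s).continuousAt.continuousWithinAt)
      (fun s _ => (hd s).differentiableAt.differentiableWithinAt) fun s hs => ?_
    rw [(hd s).deriv]; exact h s (interior_subset hs)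
  intro s hs
  exact hm ⟨le_rfl, hs.1.trans hs.2⟩ hs hs.1

theorem half_lemma {ϑ k x y : ℝ → ℝ} {M ε σ : ℝ} (hM : 0 ≤ M) (hε : 0 ≤ ε) (hσ : σ ≤ π) (hσ0 : 0 ≤ σ)
    (hϑ : ∀ s, HasDerivAt ϑ (k s) s) (hx : ∀ s, HasDerivAt x (cos (ϑ s)) s)
    (hy : ∀ s, HasDerivAt y (sin (ϑ s)) s) (hϑ0 : ϑ 0 = 0) (hx0 : x 0 = 0) (hy0 : y 0 = -ε)
    (hxp : ∀ s ∈ Icc 0 σ, 0 ≤ x s) (hyn : ∀ s ∈ Icc 0 σ, y s ≤ 0) (hϑp : ∀ s ∈ Icc 0 σ, ϑ s ≤ π)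
    (hp : ∀ s ∈ Icc 0 σ, 0 ≤ x s * sin (ϑ s) - y s * cos (ϑ s))
    (hk : ∀ s ∈ Icc 0 σ, 0 ≤ k s + M * (x s * sin (ϑ s) - y s * cos (ϑ s))) :
    ∫ s in (0:ℝ)..σ, (x s * sin (ϑ s) - y s * cos (ϑ s)) ≤ 2 * π * ε * exp (2 * π * M * π) := by
  have cϑ : Continuous ϑ := continuous_iff_continuousAt.2 fun s => (hϑ s).continuousAt
  have cx : Continuous x := continuous_iff_continuousAt.2 fun s => (hx s).continuousAt
  have cy : Continuous y := continuous_iff_continuousAt.2 fun s => (hy s).continuousAt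
  set p : ℝ → ℝ := fun s => x s * sin (ϑ s) - y s * cos (ϑ s) with hpdef
  have cp : Continuous p := by fun_prop
  set S : ℝ → ℝ := fun s => ∫ r in (0:ℝ)..s, p r with hS
  have dS : ∀ s, HasDerivAt S (p s) s := fun s => (cp.integral_hasStrictDerivAt 0 s).hasDerivAt
  have cS : Continuous S := continuous_iff_continuousAt.2 fun s => (dS s).continuousAt
  set W : ℝ → ℝ := fun s => ε + M * ∫ r in (0:ℝ)..s, S r with hW
  have dW : ∀ s, HasDerivAt W (M * S s) s := fun s =>
    (((cS.integral_hasStrictDerivAt 0 s).hasDerivAt).const_mul M).const_add ε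
  have S0 : S 0 = 0 := by simp [hS]
  have W0 : W 0 = ε := by simp [hW]
  have Sn : ∀ s ∈ Icc 0 σ, 0 ≤ S s := fun s hs => S0 ▸ mono_of dS hp s hs
  have hϑl : ∀ s ∈ Icc 0 σ, -(M * S s) ≤ ϑ s := by
    intro s hs
    have := mono_of (f := fun s => ϑ s + M * S s) (fun s => (hϑ s).add ((dS s).const_mul M)) hk s hs
    simp only [hϑ0, S0] at this
    linarith
  have hsin : ∀ s ∈ Icc 0 σ, 0 ≤ M * S s + sin (ϑ s) := by
    intro s hs
    rcases le_or_gt 0 (ϑ s) with h | h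
    · have := sin_nonneg_of_nonneg_of_le_pi h (hϑp s hs)
      have := mul_nonneg hM (Sn s hs)
      linarith
    · have h1 : ϑ s ≤ sin (ϑ s) := by
        have := sin_le (x := -ϑ s) (by linarith)
        rw [sin_neg] at this; linarith
      have := hϑl s hs
      linarith
  have hyW : ∀ s ∈ Icc 0 σ, -y s ≤ W s := by
    intro s hs
    have := mono_of (f := fun s => W s + y s) (fun s => (dW s).add (hy s)) hsin s hs
    simp only [W0, hy0] at this
    linarith
  have hW0 : ∀ s ∈ Icc 0 σ, 0 ≤ W s := fun s hs => by linarith [hyW s hs, hyn s hs]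
  have hSW : ∀ s ∈ Icc 0 σ, S s ≤ 2 * π * W s := by
    intro s hs
    have hd : ∀ s, HasDerivAt (fun s => 2 * (s * W s) + x s * y s - S s)
        (2 * (1 * W s + s * (M * S s)) + (cos (ϑ s) * y s + x s * sin (ϑ s)) - p s) s := fun s =>
      ((((hasDerivAt_id s).mul (dW s)).const_mul 2).add ((hx s).mul (hy s))).sub (dS s)
    have := mono_of hd (σ := σ) (fun r hr => ?_) s hs
    · simp only [S0, hx0] at this
      have h2 := mul_nonpos_of_nonneg_of_nonpos (hxp s hs) (hyn s hs)
      have h3 : s * W s ≤ π * W s := mul_le_mul_of_nonneg_right (hs.2.trans hσ) (hW0 s hs)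
      nlinarith
    · have h1 := mul_nonneg hr.1 (mul_nonneg hM (Sn r hr))
      have h2 : -y r * (1 - cos (ϑ r)) ≥ 0 := mul_nonneg (by linarith [hyn r hr]) (by linarith [cos_le_one (ϑ r)])
      have h3 := hyW r hr
      simp only [hpdef]
      nlinarith
  have hWe : W σ ≤ ε * exp (2 * π * M * σ) := by
    have hd : ∀ s, HasDerivAt (fun s => -(W s * exp (-(2 * π * M * s))))
        (-(M * S s * exp (-(2 * π * M * s)) + W s * (exp (-(2 * π * M * s)) * -(2 * π * M * 1)))) s := fun s =>
      ((dW s).mul (((hasDerivAt_id s).const_mul (2 * π * M)).neg.exp)).neg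
    have := mono_of hd (σ := σ) (fun r hr => ?_) σ ⟨hσ0, le_rfl⟩
    · simp only [W0, mul_zero, neg_zero, exp_zero, mul_one] at this
      rw [exp_neg] at this
      have hpos := exp_pos (2 * π * M * σ)
      have h5 : W σ * (exp (2 * π * M * σ))⁻¹ ≤ ε := by linarith
      rwa [← div_eq_mul_inv, div_le_iff₀ hpos] at h5
    · have h1 := mul_le_mul_of_nonneg_left (hSW r hr) hM
      have h2 := exp_pos (-(2 * π * M * r))
      have : 0 ≤ (M * (2 * π * W r) - M * S r) * exp (-(2 * π * M * r)) := mul_nonneg (by linarith) h2.le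
      nlinarith
  have hfin := hSW σ ⟨hσ0, le_rfl⟩
  have hexp : exp (2 * π * M * σ) ≤ exp (2 * π * M * π) := by
    apply exp_le_exp.2
    exact mul_le_mul_of_nonneg_left hσ (by positivity)
  calc S σ ≤ 2 * π * W σ := hfin
    _ ≤ 2 * π * (ε * exp (2 * π * M * π)) := by
        apply mul_le_mul_of_nonneg_left _ (by positivity)
        exact hWe.trans (mul_le_mul_of_nonneg_left hexp hε)
    _ = _ := by ring

/-- polar angle -/
def PP (Z : ℝ → ℂ) (ϑ : ℝ → ℝ) (s : ℝ) : ℂ := (starRingEnd ℂ) (Z s) * Complex.exp (ϑ s * Complex.I)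
def bet (Z : ℝ → ℂ) (ϑ : ℝ → ℝ) (s : ℝ) : ℝ := ϑ s - Complex.arg (PP Z ϑ s)

section polar
variable {Z : ℝ → ℂ} {ϑ k : ℝ → ℝ}

theorem exp_conj_self (θ : ℝ) : (starRingEnd ℂ) (Complex.exp (θ * Complex.I)) * Complex.exp (θ * Complex.I) = 1 := by
  rw [mul_comm, Complex.mul_conj, Complex.normSq_eq_norm_sq, Complex.norm_exp_ofReal_mul_I]; simp

theorem PP_deriv (hZ : ∀ s, HasDerivAt Z (Complex.exp (ϑ s * Complex.I)) s) (hϑ : ∀ s, HasDerivAt ϑ (k s) s)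
    (s : ℝ) : HasDerivAt (PP Z ϑ) (1 + PP Z ϑ s * (Complex.I * k s)) s := by
  have h1 : HasDerivAt (fun s => (starRingEnd ℂ) (Z s)) ((starRingEnd ℂ) (Complex.exp (ϑ s * Complex.I))) s :=
    (Complex.conjCLE : ℂ →L[ℝ] ℂ).hasFDerivAt.comp_hasDerivAt s (hZ s)
  have h2 : HasDerivAt (fun s => Complex.exp (ϑ s * Complex.I)) (Complex.exp (ϑ s * Complex.I) * (k s * Complex.I)) s :=
    ((hϑ s).ofReal_comp.mul_const Complex.I).cexp
  refine (h1.fun_mul h2).congr_deriv ?_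
  rw [exp_conj_self]; unfold PP; ring

theorem bet_deriv (hZ : ∀ s, HasDerivAt Z (Complex.exp (ϑ s * Complex.I)) s) (hϑ : ∀ s, HasDerivAt ϑ (k s) s)
    (hp : ∀ s, 0 < (PP Z ϑ s).im) (s : ℝ) : HasDerivAt (bet Z ϑ) ((PP Z ϑ s).im / Complex.normSq (PP Z ϑ s)) s := by
  have hne : PP Z ϑ s ≠ 0 := fun h => by have := hp s; rw [h] at this; simp at this
  have h1 := (PP_deriv hZ hϑ s).clog_real (Or.inr (hp s).ne')
  have h2 : HasDerivAt (fun s => (Complex.log (PP Z ϑ s)).im) _ s :=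
    Complex.imCLM.hasFDerivAt.comp_hasDerivAt s h1
  simp only [Complex.log_im] at h2
  refine ((hϑ s).fun_sub h2).congr_deriv ?_
  have : (1 + PP Z ϑ s * (Complex.I * k s)) / PP Z ϑ s = (PP Z ϑ s)⁻¹ + Complex.I * k s := by
    field_simp
  rw [this]
  simp [Complex.inv_im]
  ring

theorem bet_pos (hZ : ∀ s, HasDerivAt Z (Complex.exp (ϑ s * Complex.I)) s) (hϑ : ∀ s, HasDerivAt ϑ (k s) s)
    (hp : ∀ s, 0 < (PP Z ϑ s).im) (s : ℝ) : 0 < (PP Z ϑ s).im / Complex.normSq (PP Z ϑ s) :=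
  div_pos (hp s) (Complex.normSq_pos.2 fun h => by have := hp s; rw [h] at this; simp at this)

theorem bet_mono (hZ : ∀ s, HasDerivAt Z (Complex.exp (ϑ s * Complex.I)) s) (hϑ : ∀ s, HasDerivAt ϑ (k s) s)
    (hp : ∀ s, 0 < (PP Z ϑ s).im) : StrictMono (bet Z ϑ) := strictMono_of_deriv_pos fun s => by
  rw [(bet_deriv hZ hϑ hp s).deriv]; exact bet_pos hZ hϑ hp s

end polar

theorem PP_norm (Z : ℝ → ℂ) (ϑ : ℝ → ℝ) (s : ℝ) : ‖PP Z ϑ s‖ = ‖Z s‖ := by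
  unfold PP; rw [norm_mul, Complex.norm_exp_ofReal_mul_I, mul_one, Complex.norm_conj]

theorem polar_eq (Z : ℝ → ℂ) (ϑ : ℝ → ℝ) (s : ℝ) : Z s = ‖Z s‖ * Complex.exp (bet Z ϑ s * Complex.I) := by
  have h1 := Complex.norm_mul_exp_arg_mul_I (PP Z ϑ s)
  rw [PP_norm] at h1
  have h2 : Complex.exp (bet Z ϑ s * Complex.I) * Complex.exp (Complex.arg (PP Z ϑ s) * Complex.I) =
      Complex.exp (ϑ s * Complex.I) := by
    rw [← Complex.exp_add]; congr 1; unfold bet; push_cast; ring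
  have h3 := congrArg (starRingEnd ℂ) h1
  have h4 : (starRingEnd ℂ) (PP Z ϑ s) = Z s * (starRingEnd ℂ) (Complex.exp (ϑ s * Complex.I)) := by
    unfold PP; rw [map_mul, Complex.conj_conj]
  rw [h4, map_mul, Complex.conj_ofReal] at h3
  have e1 := exp_conj_self (ϑ s)
  have e2 := exp_conj_self (Complex.arg (PP Z ϑ s))
  set a := Complex.exp (ϑ s * Complex.I)
  set b := Complex.exp (bet Z ϑ s * Complex.I)
  set d := Complex.exp (Complex.arg (PP Z ϑ s) * Complex.I)
  calc Z s = (Z s * (starRingEnd ℂ) a) * a := by rw [mul_assoc, e1, mul_one]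
    _ = ‖Z s‖ * (starRingEnd ℂ) d * (b * d) := by rw [← h3, h2]
    _ = ‖Z s‖ * b * ((starRingEnd ℂ) d * d) := by ring
    _ = _ := by rw [e2, mul_one]

theorem core_norm {Z : ℝ → ℂ} {ϑ k : ℝ → ℝ} {M ε : ℝ} (hM : 0 ≤ M) (hε : 0 < ε)
    (hZ : ∀ s, HasDerivAt Z (Complex.exp (ϑ s * Complex.I)) s) (hϑ : ∀ s, HasDerivAt ϑ (k s) s)
    (hp : ∀ s, 0 < (PP Z ϑ s).im) (hZπ : ∀ s, Z (s + π) = -Z s) (hϑπ : ∀ s, ϑ (s + π) = ϑ s + π)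
    (hk : ∀ s, 0 ≤ k s + M * (PP Z ϑ s).im) (hϑ0 : ϑ 0 = 0) (hZ0 : Z 0 = -(ε * Complex.I)) :
    ∫ s in (0:ℝ)..π, (PP Z ϑ s).im ≤ 4 * π * ε * exp (2 * π * M * π) := by
  have cP : Continuous (PP Z ϑ) := continuous_iff_continuousAt.2 fun s => (PP_deriv hZ hϑ s).continuousAt
  have hPπ : ∀ s, PP Z ϑ (s + π) = PP Z ϑ s := by
    intro s
    unfold PP
    rw [hZπ, hϑπ]
    push_cast
    rw [add_mul, Complex.exp_add, Complex.exp_pi_mul_I, map_neg]; ring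
  have hβπ : ∀ s, bet Z ϑ (s + π) = bet Z ϑ s + π := by
    intro s; unfold bet; rw [hPπ, hϑπ]; ring
  have hmono := bet_mono hZ hϑ hp
  have cβ : Continuous (bet Z ϑ) := continuous_iff_continuousAt.2 fun s => (bet_deriv hZ hϑ hp s).continuousAt
  have hβ0 : bet Z ϑ 0 = -(π / 2) := by
    unfold bet PP
    rw [hZ0, hϑ0]
    have : (starRingEnd ℂ) (-((ε:ℂ) * Complex.I)) * Complex.exp (((0:ℝ):ℂ) * Complex.I) = ε * Complex.I := by
      simp
    rw [this, Complex.arg_real_mul _ hε, Complex.arg_I]; ring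
  have hβπ0 : bet Z ϑ π = π / 2 := by
    have := hβπ 0; rw [zero_add, hβ0] at this; rw [this]; ring
  obtain ⟨σ, hσ, hβσ⟩ : ∃ σ ∈ Icc 0 π, bet Z ϑ σ = 0 :=
    intermediate_value_Icc pi_pos.le cβ.continuousOn ⟨by rw [hβ0]; linarith [pi_pos], by rw [hβπ0]; linarith [pi_pos]⟩
  have hre : ∀ s, (Z s).re = ‖Z s‖ * cos (bet Z ϑ s) := by
    intro s
    conv_lhs => rw [polar_eq Z ϑ s]
    rw [Complex.re_ofReal_mul, Complex.exp_ofReal_mul_I_re]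
  have him : ∀ s, (Z s).im = ‖Z s‖ * sin (bet Z ϑ s) := by
    intro s
    conv_lhs => rw [polar_eq Z ϑ s]
    rw [Complex.im_ofReal_mul, Complex.exp_ofReal_mul_I_im]
  have hpe : ∀ s, (PP Z ϑ s).im = (Z s).re * sin (ϑ s) - (Z s).im * cos (ϑ s) := by
    intro s
    unfold PP
    rw [Complex.mul_im, Complex.exp_ofReal_mul_I_re, Complex.exp_ofReal_mul_I_im, Complex.conj_re, Complex.conj_im]; ring
  have harg : ∀ s, 0 ≤ ϑ s - bet Z ϑ s ∧ ϑ s - bet Z ϑ s ≤ π := by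
    intro s
    have : ϑ s - bet Z ϑ s = Complex.arg (PP Z ϑ s) := by unfold bet; ring
    rw [this]
    exact ⟨Complex.arg_nonneg_iff.2 (hp s).le, Complex.arg_le_pi _⟩
  have dre : ∀ s, HasDerivAt (fun s => (Z s).re) (cos (ϑ s)) s := by
    intro s
    have : HasDerivAt (fun s => (Z s).re) _ s := Complex.reCLM.hasFDerivAt.comp_hasDerivAt s (hZ s)
    refine this.congr_deriv ?_
    exact Complex.exp_ofReal_mul_I_re _
  have dim : ∀ s, HasDerivAt (fun s => (Z s).im) (sin (ϑ s)) s := by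
    intro s
    have : HasDerivAt (fun s => (Z s).im) _ s := Complex.imCLM.hasFDerivAt.comp_hasDerivAt s (hZ s)
    refine this.congr_deriv ?_
    exact Complex.exp_ofReal_mul_I_im _
  have A := half_lemma (ϑ := ϑ) (k := k) (x := fun s => (Z s).re) (y := fun s => (Z s).im) (σ := σ) hM hε.le hσ.2 hσ.1
    hϑ dre dim hϑ0 (by simp [hZ0]) (by simp [hZ0]) ?_ ?_ ?_ ?_ ?_
  rotate_left
  · intro s hs
    rw [hre]
    have h1 := hmono.monotone hs.1
    have h2 := hmono.monotone hs.2
    rw [hβ0] at h1; rw [hβσ] at h2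
    exact mul_nonneg (norm_nonneg _) (cos_nonneg_of_mem_Icc ⟨h1, by linarith [pi_pos]⟩)
  · intro s hs
    rw [him]
    have h1 := hmono.monotone hs.1
    have h2 := hmono.monotone hs.2
    rw [hβ0] at h1; rw [hβσ] at h2
    exact mul_nonpos_of_nonneg_of_nonpos (norm_nonneg _) (sin_nonpos_of_nonpos_of_neg_pi_le h2 (by linarith [pi_pos]))
  · intro s hs
    have h2 := hmono.monotone hs.2
    rw [hβσ] at h2
    linarith [(harg s).2]
  · intro s hs; simp only [← hpe]; exact (hp s).le
  · intro s hs; simp only [← hpe]; exact hk s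
  have hβσ' : bet Z ϑ (σ - π) = -π := by
    have := hβπ (σ - π); rw [sub_add_cancel, hβσ] at this; linarith
  have Bk : ∀ s ∈ Icc 0 (π - σ), -π ≤ bet Z ϑ (-s) ∧ bet Z ϑ (-s) ≤ -(π / 2) := by
    intro s hs
    constructor
    · rw [← hβσ']; exact hmono.monotone (by linarith [hs.2])
    · rw [← hβ0]; exact hmono.monotone (by linarith [hs.1])
  have Bb := half_lemma (ϑ := fun s => -ϑ (-s)) (k := fun s => k (-s)) (x := fun s => -(Z (-s)).re)
    (y := fun s => (Z (-s)).im) (σ := π - σ) hM hε.le (by linarith [hσ.1]) (by linarith [hσ.2])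
    (fun s => ?_) (fun s => ?_) (fun s => ?_) (by simp [hϑ0]) (by simp [hZ0]) (by simp [hZ0]) ?_ ?_ ?_ ?_ ?_
  rotate_left
  · have := ((hϑ (-s)).scomp s (hasDerivAt_neg s)).fun_neg
    simpa [Function.comp_def] using this
  · have := ((dre (-s)).scomp s (hasDerivAt_neg s)).fun_neg
    simpa [Function.comp_def] using this
  · have := ((dim (-s)).scomp s (hasDerivAt_neg s))
    simpa [Function.comp_def] using this
  · intro s hs
    obtain ⟨h1, h2⟩ := Bk s hs
    simp only [hre]
    have := cos_nonpos_of_pi_div_two_le_of_le (x := -bet Z ϑ (-s)) (by linarith) (by linarith [pi_pos])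
    rw [cos_neg] at this
    have := mul_nonpos_of_nonneg_of_nonpos (norm_nonneg (Z (-s))) this
    linarith
  · intro s hs
    obtain ⟨h1, h2⟩ := Bk s hs
    simp only [him]
    exact mul_nonpos_of_nonneg_of_nonpos (norm_nonneg _) (sin_nonpos_of_nonpos_of_neg_pi_le (by linarith [pi_pos]) (by linarith [pi_pos]))
  · intro s hs
    obtain ⟨h1, h2⟩ := Bk s hs
    show -ϑ (-s) ≤ π
    linarith [(harg (-s)).1]
  · intro s hs
    have := (hp (-s)).le
    rw [hpe] at this
    simp only [sin_neg, cos_neg]; linarith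
  · intro s hs
    have := hk (-s)
    rw [hpe] at this
    simp only [sin_neg, cos_neg]; linarith
  have hintg : ∀ a b, IntervalIntegrable (fun s => (PP Z ϑ s).im) volume a b := fun a b =>
    (Complex.continuous_im.comp cP).intervalIntegrable _ _
  have e1 : ∫ s in (0:ℝ)..π, (PP Z ϑ s).im = ∫ s in (σ - π)..σ, (PP Z ϑ s).im := by
    have hper : Function.Periodic (fun s => (PP Z ϑ s).im) π := fun s => by simp only [hPπ]
    have := hper.intervalIntegral_add_eq 0 (σ - π)
    rwa [zero_add, sub_add_cancel] at this
  have e2 : ∫ s in (0:ℝ)..(π - σ), ((-(Z (-s)).re) * sin (-ϑ (-s)) - (Z (-s)).im * cos (-ϑ (-s))) =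
      ∫ s in (σ - π)..0, (PP Z ϑ s).im := by
    have h := intervalIntegral.integral_comp_neg (fun s => (PP Z ϑ s).im) (a := 0) (b := π - σ)
    rw [neg_zero, neg_sub] at h
    rw [← h]
    congr 1; ext s
    rw [hpe, sin_neg, cos_neg]; ring
  rw [e2] at Bb
  simp only [← hpe] at A
  rw [e1, ← intervalIntegral.integral_add_adjacent_intervals (hintg (σ - π) 0) (hintg 0 σ)]
  linarith

end GAPF

namespace GAPF
open scoped ContDiff Topology
open TrSp TrMul TrPer

def dlt (M A0 : ℝ) : ℝ := A0 / (4 * π * exp (2 * π * M * π)) * exp (-(M / 2 * (π / 2) ^ 2))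

theorem static {Z : ℝ → ℂ} {ϑ k : ℝ → ℝ} {M A0 : ℝ} (hM : 0 ≤ M)
    (hZ : ∀ s, HasDerivAt Z (Complex.exp (ϑ s * Complex.I)) s) (hϑ : ∀ s, HasDerivAt ϑ (k s) s)
    (hp : ∀ s, 0 < (PP Z ϑ s).im) (hZπ : ∀ s, Z (s + π) = -Z s) (hϑπ : ∀ s, ϑ (s + π) = ϑ s + π)
    (hk : ∀ s, 0 < k s + M * (PP Z ϑ s).im) (hr : ∀ s, ‖Z s‖ ≤ π / 2)
    (hA : A0 ≤ ∫ s in (0:ℝ)..π, (PP Z ϑ s).im) : ∀ s, dlt M A0 ≤ (PP Z ϑ s).im := by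
  have dP := PP_deriv hZ hϑ
  have cP : Continuous (PP Z ϑ) := continuous_iff_continuousAt.2 fun s => (dP s).continuousAt
  have hPπ : ∀ s, PP Z ϑ (s + π) = PP Z ϑ s := by
    intro s
    unfold PP
    rw [hZπ, hϑπ]
    push_cast
    rw [add_mul, Complex.exp_add, Complex.exp_pi_mul_I, map_neg]; ring
  have dre : ∀ s, HasDerivAt (fun s => (PP Z ϑ s).re) (1 - k s * (PP Z ϑ s).im) s := by
    intro s
    have : HasDerivAt (fun s => (PP Z ϑ s).re) _ s := Complex.reCLM.hasFDerivAt.comp_hasDerivAt s (dP s)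
    refine this.congr_deriv ?_
    simp; ring
  have dim : ∀ s, HasDerivAt (fun s => (PP Z ϑ s).im) (k s * (PP Z ϑ s).re) s := by
    intro s
    have : HasDerivAt (fun s => (PP Z ϑ s).im) _ s := Complex.imCLM.hasFDerivAt.comp_hasDerivAt s (dP s)
    refine this.congr_deriv ?_
    simp; ring
  set f : ℝ → ℝ := fun s => (PP Z ϑ s).im * exp (M / 2 * ((PP Z ϑ s).re * (PP Z ϑ s).re + (PP Z ϑ s).im * (PP Z ϑ s).im)) with hf
  have df : ∀ s, HasDerivAt f ((PP Z ϑ s).re * (k s + M * (PP Z ϑ s).im) *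
      exp (M / 2 * ((PP Z ϑ s).re * (PP Z ϑ s).re + (PP Z ϑ s).im * (PP Z ϑ s).im))) s := by
    intro s
    have := (dim s).fun_mul (((((dre s).fun_mul (dre s)).fun_add ((dim s).fun_mul (dim s))).const_mul (M / 2)).exp)
    refine HasDerivAt.congr_deriv this ?_
    ring
  have cf : Continuous f := continuous_iff_continuousAt.2 fun s => (df s).continuousAt
  have fper : Function.Periodic f π := fun s => by simp only [hf, hPπ]
  obtain ⟨x0, -, hx0⟩ := isCompact_Icc.exists_isMinOn (nonempty_Icc.2 pi_pos.le) (cf.continuousOn (s := Icc 0 π))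
  have hmin : ∀ s, f x0 ≤ f s := by
    intro s
    obtain ⟨y, hy, hye⟩ := fper.exists_mem_Ico₀ pi_pos s
    rw [hye]; exact hx0 (Ico_subset_Icc_self hy)
  have hre0 : (PP Z ϑ x0).re = 0 := by
    have h0 := IsLocalMin.hasDerivAt_eq_zero (Eventually.of_forall hmin) (df x0)
    rcases mul_eq_zero.1 h0 with h | h
    · rcases mul_eq_zero.1 h with h | h
      · exact h
      · exact absurd h (hk x0).ne'
    · exact absurd h (exp_pos _).ne'
  set ε := (PP Z ϑ x0).im with hεd
  have hε : 0 < ε := hp x0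
  have hPx : PP Z ϑ x0 = ε * Complex.I := by
    apply Complex.ext
    · simp [hre0]
    · simp [hεd]
  -- normalised curve
  let Z2 : ℝ → ℂ := fun s => Complex.exp (-(ϑ x0 * Complex.I)) * Z (x0 + s)
  let ϑ2 : ℝ → ℝ := fun s => ϑ (x0 + s) - ϑ x0
  have hPP2 : ∀ s, PP Z2 ϑ2 s = PP Z ϑ (x0 + s) := by
    intro s
    unfold PP
    simp only [Z2, ϑ2]
    have e1 := exp_conj_self (-ϑ x0)
    push_cast at e1
    rw [map_mul]
    rw [show ((ϑ (x0 + s) - ϑ x0 : ℝ) : ℂ) * Complex.I = ϑ (x0 + s) * Complex.I + (-(ϑ x0 : ℂ)) * Complex.I by push_cast; ring,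
      Complex.exp_add, ← neg_mul]
    linear_combination ((starRingEnd ℂ) (Z (x0 + s)) * Complex.exp (ϑ (x0 + s) * Complex.I)) * e1
  have key := core_norm (Z := Z2) (ϑ := ϑ2) (k := fun s => k (x0 + s)) hM hε (fun s => ?_) (fun s => ?_)
    (fun s => by rw [hPP2]; exact hp _) (fun s => ?_) (fun s => ?_) (fun s => by rw [hPP2]; exact (hk _).le)
    (by simp [ϑ2]) ?_
  rotate_left
  · have h1 := ((hZ (x0 + s)).scomp s ((hasDerivAt_id s).const_add x0)).const_mul (Complex.exp (-(ϑ x0 * Complex.I)))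
    refine HasDerivAt.congr_deriv h1 ?_
    rw [one_smul, ← Complex.exp_add]; congr 1; simp only [ϑ2]; push_cast; ring
  · have h1 := ((hϑ (x0 + s)).scomp s ((hasDerivAt_id s).const_add x0)).sub_const (ϑ x0)
    simpa [ϑ2, Function.comp_def] using h1
  · simp only [Z2]; rw [← add_assoc, hZπ]; ring
  · simp only [ϑ2]; rw [← add_assoc, hϑπ]; ring
  · have h2 : PP Z2 ϑ2 0 = (starRingEnd ℂ) (Z2 0) := by unfold PP; simp [ϑ2]
    have h1 := congrArg (starRingEnd ℂ) (h2.symm.trans (hPP2 0))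
    rw [Complex.conj_conj, add_zero, hPx, map_mul, Complex.conj_ofReal, Complex.conj_I] at h1
    rw [h1]; ring
  have hintg : ∫ s in (0:ℝ)..π, (PP Z2 ϑ2 s).im = ∫ s in (0:ℝ)..π, (PP Z ϑ s).im := by
    simp only [hPP2]
    have h := intervalIntegral.integral_comp_add_left (fun s => (PP Z ϑ s).im) x0 (a := 0) (b := π)
    rw [h, add_zero]
    have hper : Function.Periodic (fun s => (PP Z ϑ s).im) π := fun s => by simp only [hPπ]
    have := hper.intervalIntegral_add_eq x0 0
    rwa [zero_add] at this
  rw [hintg] at key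
  have hA2 : A0 / (4 * π * exp (2 * π * M * π)) ≤ ε := by
    rw [div_le_iff₀ (by positivity)]
    calc A0 ≤ _ := hA
      _ ≤ _ := key
      _ = _ := by ring
  intro s
  have h1 := hmin s
  have h2 : ε ≤ f x0 := by
    simp only [hf]
    have : 1 ≤ exp (M / 2 * ((PP Z ϑ x0).re * (PP Z ϑ x0).re + (PP Z ϑ x0).im * (PP Z ϑ x0).im)) := by
      apply one_le_exp
      exact mul_nonneg (by linarith) (add_nonneg (mul_self_nonneg _) (mul_self_nonneg _))
    nlinarith
  have h3 : f s ≤ (PP Z ϑ s).im * exp (M / 2 * (π / 2) ^ 2) := by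
    simp only [hf]
    apply mul_le_mul_of_nonneg_left _ (hp s).le
    apply exp_le_exp.2
    apply mul_le_mul_of_nonneg_left _ (by linarith)
    have h4 := PP_norm Z ϑ s
    have h5 := Complex.normSq_eq_norm_sq (PP Z ϑ s)
    rw [Complex.normSq_apply, h4] at h5
    rw [h5]
    exact pow_le_pow_left₀ (norm_nonneg _) (hr s) 2
  unfold dlt
  rw [exp_neg, ← div_eq_mul_inv, div_le_iff₀ (exp_pos _)]
  linarith

section app
variable {c : ℝ} {k : BR} (hk : Sm k) (h1 : avg k = 1) (hπ : tr (-π) k = k)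

/-- the tangent angle -/
def tht (c : ℝ) (k : BR) (x : ℝ) : ℝ := x + Aop k (x : Cir) + c

theorem PP_eq (k : BR) (x : ℝ) : PP (fun x : ℝ => Zf c k (x : Cir)) (tht c k) x = Pf c k (x : Cir) := by
  unfold PP Pf tht
  rw [ContinuousMap.mul_apply, cj_apply, Tf_apply]

theorem Zf_deriv {k : BR} (hk : Sm k) (hπ : tr (-π) k = k) (x : ℝ) :
    HasDerivAt (fun x : ℝ => Zf c k (x : Cir)) (Complex.exp (tht c k x * Complex.I)) x := by
  have := (hk.Zf (c := c)).hasDerivAt_pt x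
  rw [D_Zf hk hπ, Tf_apply] at this
  exact this

theorem tht_deriv {k : BR} (hk : Sm k) (h1 : avg k = 1) (x : ℝ) :
    HasDerivAt (tht c k) (k (x : Cir)) x := by
  have := (((hasDerivAt_id x).fun_add (hk.Aop.hasDerivAt_pt x)).add_const c)
  refine HasDerivAt.congr_deriv this ?_
  rw [hk.D_Aop, h1]; simp

theorem Zf_pi {k : BR} (hπ : tr (-π) k = k) (x : ℝ) : Zf c k ((x + π : ℝ) : Cir) = - Zf c k (x : Cir) := by
  have := congrArg (fun g : BC => g ((x + π : ℝ) : Cir)) (anti_Zf (c := c) hπ)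
  simp only [trC_real, ContinuousMap.neg_apply, add_neg_cancel_right] at this
  rw [this, neg_neg]

theorem tht_pi {k : BR} (hπ : tr (-π) k = k) (x : ℝ) : tht c k (x + π) = tht c k x + π := by
  have hA : tr (-π) (Aop k) = Aop k := by
    unfold Aop; rw [← conv_tr, hπ]
  have := congrArg (fun g : BR => g ((x + π : ℝ) : Cir)) hA
  simp only [trC_real, add_neg_cancel_right] at this
  unfold tht; rw [← this]; ring

theorem static_k {k : BR} (hk : Sm k) (h1 : avg k = 1) (hπ : tr (-π) k = k) {M : ℝ} (hM : 0 ≤ M)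
    (hp : ∀ x, 0 < pf c k x) (hkM : ∀ x, 0 < (k + M • pf c k) x) :
    ∀ x, dlt M (π * av (pf c k)) ≤ pf c k x := by
  have hpe : ∀ x : ℝ, (PP (fun x : ℝ => Zf c k (x : Cir)) (tht c k) x).im = pf c k (x : Cir) := by
    intro x; rw [PP_eq]; rfl
  have key := static (Z := fun x : ℝ => Zf c k (x : Cir)) (ϑ := tht c k) (k := fun x : ℝ => k (x : Cir))
    (A0 := π * av (pf c k)) hM (Zf_deriv hk hπ) (tht_deriv hk h1) (fun s => by rw [hpe]; exact hp _)
    (Zf_pi hπ) (tht_pi hπ) (fun s => by rw [hpe]; exact hkM _) (Zf_norm k) ?_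
  · intro x
    obtain ⟨z, rfl⟩ := QuotientAddGroup.mk_surjective x
    have := key z
    rw [hpe] at this; exact this
  · simp only [hpe]
    rw [av_eq]
    have hper : Function.Periodic (fun y : ℝ => pf c k (y : Cir)) π := by
      intro x
      simp only [← hpe]
      unfold PP
      beta_reduce
      rw [Zf_pi hπ, tht_pi hπ]
      push_cast
      rw [add_mul, Complex.exp_add, Complex.exp_pi_mul_I, map_neg]; simp
    have hintg : ∀ a b, IntervalIntegrable (fun y : ℝ => pf c k (y : Cir)) volume a b := fun a b =>
      (pv_cont _).intervalIntegrable _ _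
    have h2 := intervalIntegral.integral_add_adjacent_intervals (hintg 0 π) (hintg π (2 * π))
    have h3 := hper.intervalIntegral_add_eq π 0
    rw [zero_add, ← two_mul] at h3
    rw [h3] at h2
    rw [← h2]
    apply le_of_eq
    field_simp
    ring

end app

section apriori
variable {c : ℝ} {k : ℝ → BR} {T : ℝ}

theorem GSol.lower (h : GSol T k) {M : ℝ} (hM : 0 < M) (h0 : ∀ x, 0 < (k 0 + M • pf c (k 0)) x)
    (hp : ∀ t ∈ Icc 0 T, ∀ x, 0 < pf c (k t) x) :
    ∀ t ∈ Icc 0 T, ∀ x, 0 < (k t + M • pf c (k t)) x := by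
  refine max_principle h0 (fun t ht => (h.eq t ht).fun_add
    ((pf_dt (h.eq t ht) (h.sm t ht) (h.av1 t ht) (h.per t ht)).fun_const_smul M))
    (fun t ht => (h.sm t ht).add ((h.sm t ht).pf.smul M)) ?_
  intro t ht x hg hg1 hg2
  have ht' := Ioc_subset_Icc_self ht
  have hs := h.sm t ht'
  have h1 := h.av1 t ht'
  have hπ := h.per t ht'
  have hp0 := hp t ht' (x : Cir)
  have hple := pf_le (c := c) (k t) x
  have hmu := mu_nonneg h1
  rw [hs.D_add (hs.pf.smul M), hs.pf.D_smul, D_pf hs h1 hπ] at hg1 hg2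
  rw [hs.D.D_add ((hs.mul hs.hf).smul M), (hs.mul hs.hf).D_smul, hs.D_mul hs.hf, D_hf hs h1 hπ] at hg2
  show 0 < (rhs (k t) + _) (x : Cir)
  rw [rhs_eq hs]
  simp only [fq, ContinuousMap.add_apply, ContinuousMap.smul_apply, ContinuousMap.mul_apply, ContinuousMap.sub_apply,
    ContinuousMap.one_apply, smul_eq_mul, mul_one] at hg hg1 hg2 ⊢
  generalize k t (x : Cir) = K at *
  generalize pf c (k t) (x : Cir) = p at *
  generalize hf c (k t) (x : Cir) = H at *
  generalize D (k t) (x : Cir) = K1 at *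
  generalize D (D (k t)) (x : Cir) = K2 at *
  generalize acoef (k t) (x : Cir) = a at *
  generalize mu (k t) = m at *
  have hK : K = -(M * p) := by linarith
  subst hK
  have hpi : π < 3.15 := pi_lt_d2
  have e : K2 + a * K1 + -(M * p) * (-(M * p) * -(M * p) - -(M * p) - m) +
      M * (1 - -(M * p) + m * p + (K1 + a * -(M * p)) * H) =
      (K2 + M * (K1 * H + -(M * p) * (1 - -(M * p) * p))) + a * (K1 + M * (-(M * p) * H)) +
      (M ^ 2 * p * (2 - p) + 2 * M * m * p + M) := by ring
  rw [e, hg1]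
  have h3 : 0 ≤ M ^ 2 * p * (2 - p) := by
    apply mul_nonneg (by positivity); linarith
  have h4 : 0 ≤ 2 * M * m * p := by positivity
  linarith

theorem GSol.av_mono (h : GSol T k) (hp : ∀ t ∈ Icc 0 T, ∀ x, 0 < pf c (k t) x) :
    ∀ t ∈ Icc 0 T, av (pf c (k 0)) ≤ av (pf c (k t)) := by
  have hd : ∀ t ∈ Icc 0 T, HasDerivWithinAt (fun t => av (pf c (k t))) _ (Icc 0 T) t := fun t ht =>
    av_pf_dt (h.eq t ht) (h.sm t ht) (h.av1 t ht) (h.per t ht)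
  have hm : MonotoneOn (fun t => av (pf c (k t))) (Icc 0 T) := by
    refine monotoneOn_of_hasDerivWithinAt_nonneg (convex_Icc _ _) (fun t ht => (hd t ht).continuousWithinAt)
      (fun t ht => (hd t (interior_subset ht)).mono interior_subset) fun t ht => ?_
    have := mu_nonneg (h.av1 t (interior_subset ht))
    have := av_nonneg (f := pf c (k t)) fun x => (hp t (interior_subset ht) _).le
    positivity
  intro t ht
  exact hm ⟨le_rfl, ht.1.trans ht.2⟩ ht ht.1

theorem GSol.upper (h : GSol T k) {Q b : ℝ} (hb : 0 < b) (hQ : 0 < Q) (hQb : 2 ≤ Q * b ^ 2)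
    (h0 : ∀ x, 0 < (Q • (pf c (k 0) - b • (1 : BR)) - k 0) x)
    (hp : ∀ t ∈ Icc 0 T, ∀ x, 2 * b ≤ pf c (k t) x) :
    ∀ t ∈ Icc 0 T, ∀ x, 0 < (Q • (pf c (k t) - b • (1 : BR)) - k t) x := by
  refine max_principle h0 (fun t ht => (((pf_dt (h.eq t ht) (h.sm t ht) (h.av1 t ht) (h.per t ht)).sub_const
    (b • (1 : BR))).fun_const_smul Q).fun_sub (h.eq t ht))
    (fun t ht => (((h.sm t ht).pf.sub (sm_one.smul b)).smul Q).sub (h.sm t ht)) ?_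
  intro t ht x hg hg1 hg2
  have ht' := Ioc_subset_Icc_self ht
  have hs := h.sm t ht'
  have h1 := h.av1 t ht'
  have hπ := h.per t ht'
  have hp0 := hp t ht' (x : Cir)
  have hmu := mu_nonneg h1
  rw [((hs.pf.sub (sm_one.smul b)).smul Q).D_sub hs, (hs.pf.sub (sm_one.smul b)).D_smul, hs.pf.D_sub (sm_one.smul b),
    sm_one.D_smul, D_one, smul_zero, sub_zero, D_pf hs h1 hπ] at hg1 hg2
  rw [((hs.mul hs.hf).smul Q).D_sub hs.D, (hs.mul hs.hf).D_smul, hs.D_mul hs.hf, D_hf hs h1 hπ] at hg2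
  show 0 < (_ - rhs (k t)) (x : Cir)
  rw [rhs_eq hs]
  simp only [fq, ContinuousMap.add_apply, ContinuousMap.smul_apply, ContinuousMap.mul_apply, ContinuousMap.sub_apply,
    ContinuousMap.one_apply, smul_eq_mul, mul_one] at hg hg1 hg2 ⊢
  generalize k t (x : Cir) = K at *
  generalize pf c (k t) (x : Cir) = p at *
  generalize hf c (k t) (x : Cir) = H at *
  generalize D (k t) (x : Cir) = K1 at *
  generalize D (D (k t)) (x : Cir) = K2 at *
  generalize acoef (k t) (x : Cir) = a at *
  generalize mu (k t) = m at *
  obtain ⟨P, rfl⟩ : ∃ P, p = P + b := ⟨p - b, by ring⟩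
  have hK : K = Q * P := by linarith
  subst hK
  have hP : b ≤ P := by linarith
  have e : Q * (1 - Q * P + m * (P + b) + (K1 + a * (Q * P)) * H) -
      (K2 + a * K1 + Q * P * (Q * P * (Q * P) - Q * P - m)) =
      (Q * (K1 * H + Q * P * (1 - Q * P * (P + b))) - K2) + a * (Q * (Q * P * H) - K1) +
      (Q + Q ^ 2 * P * (Q * P * b - 2 + P) + m * (Q * (P + b) + Q * P)) := by ring
  rw [e, hg1]
  have hP0 : 0 < P := hb.trans_le hP
  have h2 : 2 ≤ Q * P * b := by
    have : Q * b * b ≤ Q * b * P := mul_le_mul_of_nonneg_left hP (by positivity)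
    nlinarith
  have h3 : 0 ≤ Q ^ 2 * P * (Q * P * b - 2 + P) := by
    apply mul_nonneg (by positivity); linarith
  have h4 : 0 ≤ m * (Q * (P + b) + Q * P) := by positivity
  linarith

theorem apriori (c : ℝ) (k0 : BR) (hp0 : ∀ x, 0 < pf c k0 x) :
    ∃ K δ : ℝ, 0 ≤ K ∧ 0 < δ ∧ ∀ (T : ℝ) (k : ℝ → BR), GSol T k → k 0 = k0 → ∀ t ∈ Icc 0 T,
      ‖k t‖ ≤ K ∧ ∀ x, δ ≤ pf c (k t) x := by
  obtain ⟨xm, -, hxm⟩ := isCompact_univ.exists_isMinOn univ_nonempty (pf c k0).continuous.continuousOn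
  set m := pf c k0 xm with hm
  have hm0 : 0 < m := hp0 xm
  have hmle : ∀ x, m ≤ pf c k0 x := fun x => hxm (mem_univ x)
  set M := (‖k0‖ + 1) / m with hMd
  have hM : 0 < M := by positivity
  have hk0le : ∀ x, |k0 x| ≤ ‖k0‖ := fun x => k0.norm_coe_le_norm x
  have hk0M : ∀ x, 0 < (k0 + M • pf c k0) x := by
    intro x
    have h1 := neg_abs_le (k0 x)
    have h2 := hk0le x
    have h3 : M * m ≤ M * pf c k0 x := mul_le_mul_of_nonneg_left (hmle x) hM.le
    have h4 : M * m = ‖k0‖ + 1 := by rw [hMd]; field_simp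
    simp only [ContinuousMap.add_apply, ContinuousMap.smul_apply, smul_eq_mul]
    linarith
  have hav : m ≤ av (pf c k0) := by
    have : 0 ≤ av (pf c k0 - m • (1 : BR)) := av_nonneg fun x => by simpa using hmle _
    rw [map_sub, map_smul, av_one] at this
    simpa using this
  have hdm : ∀ A, π * m ≤ π * A → dlt M (π * m) ≤ dlt M (π * A) := by
    intro A hA
    unfold dlt
    gcongr ?_ / _ * _
  have hd0 : 0 < dlt M (π * m) := by unfold dlt; positivity
  set δ := min (dlt M (π * m)) m / 2 with hδ
  have hmin : 0 < min (dlt M (π * m)) m := lt_min hd0 hm0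
  have hδ0 : 0 < δ := by positivity
  have hδ1 : δ < dlt M (π * m) := by
    have := min_le_left (dlt M (π * m)) m; rw [hδ]; linarith
  have hδ2 : δ < m := by
    have := min_le_right (dlt M (π * m)) m; rw [hδ]; linarith
  set b := δ / 2 with hb
  have hb0 : 0 < b := by positivity
  set Q := max (2 / b ^ 2) ((‖k0‖ + 1) / b) with hQ
  have hQ0 : 0 < Q := lt_max_of_lt_left (by positivity)
  have hQ1 : 2 ≤ Q * b ^ 2 := by rw [← div_le_iff₀ (by positivity)]; exact le_max_left _ _
  have hQ2 : ‖k0‖ + 1 ≤ Q * b := by rw [← div_le_iff₀ hb0]; exact le_max_right _ _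
  refine ⟨max (M * (π / 2)) (Q * (π / 2)), δ, le_max_of_le_left (by positivity), hδ0, ?_⟩
  intro T k h hk0 t ht
  have hpos : ∀ t ∈ Icc 0 T, ∀ x, 0 < (pf c (k t) - δ • (1 : BR)) x := by
    refine barrier (fun t ht => ((pf_dt (h.eq t ht) (h.sm t ht) (h.av1 t ht) (h.per t ht)).sub_const _).continuousWithinAt) ?_ ?_
    · intro x; rw [hk0]; simp; linarith [hmle x]
    · intro t ht hge x hx
      have hmo := h.mono ht.2
      have hp : ∀ s ∈ Icc 0 t, ∀ x, 0 < pf c (k s) x := by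
        intro s hs x
        have := hge s hs x
        simp at this; linarith
      have hlow := hmo.lower hM (by rw [hk0]; exact hk0M) hp
      have htt : t ∈ Icc 0 t := ⟨ht.1.le, le_rfl⟩
      have hst := static_k (c := c) (hmo.sm t htt) (hmo.av1 t htt) (hmo.per t htt) hM.le (hp t htt) (hlow t htt) x
      have hA := hmo.av_mono hp t htt
      rw [hk0] at hA
      have := hdm (av (pf c (k t))) (mul_le_mul_of_nonneg_left (hav.trans hA) pi_pos.le)
      simp at hx
      linarith
  have hδle : ∀ t ∈ Icc 0 T, ∀ x, δ ≤ pf c (k t) x := by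
    intro t ht x
    have := hpos t ht x
    simp at this; linarith
  have hlow := h.lower hM (by rw [hk0]; exact hk0M) (fun t ht x => hδ0.trans_le (hδle t ht x)) t ht
  have hup := h.upper hb0 hQ0 hQ1 (c := c) (fun x => ?_) (fun t ht x => by rw [hb]; linarith [hδle t ht x]) t ht
  swap
  · rw [hk0]
    simp only [ContinuousMap.sub_apply, ContinuousMap.smul_apply, ContinuousMap.one_apply, smul_eq_mul, mul_one]
    have h1 := le_abs_self (k0 x)
    have h2 := hk0le x
    have h3 : Q * b ≤ Q * (pf c k0 x - b) := mul_le_mul_of_nonneg_left (by linarith [hmle x]) hQ0.le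
    linarith
  refine ⟨?_, hδle t ht⟩
  rw [ContinuousMap.norm_le _ (le_max_of_le_left (by positivity))]
  intro x
  obtain ⟨z, rfl⟩ := QuotientAddGroup.mk_surjective x
  have h1 := hlow (z : Cir)
  have h2 := hup (z : Cir)
  have h3 := pf_le (c := c) (k t) z
  simp only [ContinuousMap.sub_apply, ContinuousMap.add_apply, ContinuousMap.smul_apply, ContinuousMap.one_apply, smul_eq_mul, mul_one] at h1 h2
  have h4 : M * pf c (k t) (z : Cir) ≤ M * (π / 2) := mul_le_mul_of_nonneg_left h3 hM.le
  have h5 : Q * (pf c (k t) (z : Cir) - b) ≤ Q * (π / 2) := mul_le_mul_of_nonneg_left (by linarith) hQ0.le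
  have h6 := le_max_left (M * (π / 2)) (Q * (π / 2))
  have h7 := le_max_right (M * (π / 2)) (Q * (π / 2))
  show |k t (z : Cir)| ≤ _
  rw [abs_le]; constructor <;> linarith

end apriori
end GAPF

namespace GAPF
open scoped ContDiff Topology
open TrSp TrMul TrPer

def glue (a : ℝ) (k1 k2 : ℝ → BR) (t : ℝ) : BR := if t ≤ a then k1 t else k2 (t - a)

theorem glue_left {a : ℝ} {k1 k2 : ℝ → BR} {t : ℝ} (ht : t ≤ a) : glue a k1 k2 t = k1 t := by
  simp [glue, ht]

theorem glue_right {a : ℝ} {k1 k2 : ℝ → BR} (h : k2 0 = k1 a) {t : ℝ} (ht : a ≤ t) :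
    glue a k1 k2 t = k2 (t - a) := by
  unfold glue
  split_ifs with h1
  · obtain rfl := le_antisymm h1 ht; rw [sub_self, h]
  · rfl

theorem GSol.glue {a b : ℝ} (ha : 0 ≤ a) (hb : 0 ≤ b) {k1 k2 : ℝ → BR} (h1 : GSol a k1) (h2 : GSol b k2)
    (h : k2 0 = k1 a) : GSol (a + b) (glue a k1 k2) := by
  have hun : Icc 0 (a + b) = Icc 0 a ∪ Icc a (a + b) := (Icc_union_Icc_eq_Icc ha (by linarith)).symm
  have hL : ∀ t ∈ Icc 0 a, GAPF.glue a k1 k2 t = k1 t := fun t ht => glue_left ht.2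
  have hR : ∀ t ∈ Icc a (a + b), GAPF.glue a k1 k2 t = k2 (t - a) := fun t ht => glue_right h ht.1
  have hm : ∀ t ∈ Icc a (a + b), t - a ∈ Icc 0 b := fun t ht => ⟨by linarith [ht.1], by linarith [ht.2]⟩
  have hcase : ∀ P : BR → Prop, (∀ t ∈ Icc 0 a, P (k1 t)) → (∀ t ∈ Icc 0 b, P (k2 t)) →
      ∀ t ∈ Icc 0 (a + b), P (GAPF.glue a k1 k2 t) := by
    intro P hP1 hP2 t ht
    rw [hun] at ht
    rcases ht with ht | ht
    · rw [hL t ht]; exact hP1 t ht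
    · rw [hR t ht]; exact hP2 _ (hm t ht)
  refine ⟨⟨hcase _ h1.sm h2.sm, fun j => ?_, fun t ht => ?_⟩, hcase (fun f => avg f = 1) h1.av1 h2.av1, hcase (fun f => tr (-π) f = f) h1.per h2.per⟩
  · rw [hun]
    refine ContinuousOn.union_of_isClosed ?_ ?_ isClosed_Icc isClosed_Icc
    · exact (h1.cont j).congr fun t ht => by simp only [hL t ht]
    · have : ContinuousOn (fun t => D^[j] (k2 (t - a))) (Icc a (a + b)) :=
        (h2.cont j).comp (f := fun t => t - a) (by fun_prop) hm
      exact this.congr fun t ht => by simp only [hR t ht]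
  · rw [hun]
    refine HasDerivWithinAt.union ?_ ?_
    · by_cases h3 : t ∈ Icc 0 a
      · rw [hL t h3]
        exact (h1.eq t h3).congr hL (hL t h3)
      · exact HasFDerivWithinAt.of_notMem_closure (by rwa [isClosed_Icc.closure_eq])
    · by_cases h3 : t ∈ Icc a (a + b)
      · rw [hR t h3]
        have := (h2.eq _ (hm t h3)).scomp t (((hasDerivAt_id t).sub_const a).hasDerivWithinAt (s := Icc a (a + b))) hm
        rw [one_smul] at this
        exact this.congr hR (hR t h3)
      · exact HasFDerivWithinAt.of_notMem_closure (by rwa [isClosed_Icc.closure_eq])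

theorem GSol.congr {T : ℝ} {k k' : ℝ → BR} (h : GSol T k) (he : ∀ t ∈ Icc 0 T, k' t = k t) : GSol T k' := by
  refine ⟨⟨fun t ht => by rw [he t ht]; exact h.sm t ht, fun j => (h.cont j).congr fun t ht => by simp only [he t ht],
    fun t ht => ?_⟩, fun t ht => by rw [he t ht]; exact h.av1 t ht, fun t ht => by rw [he t ht]; exact h.per t ht⟩
  rw [he t ht]
  exact (h.eq t ht).congr he (he t ht)

theorem global_sol (c : ℝ) (k0 : BR) (hs : Sm k0) (h1 : avg k0 = 1) (hπ : tr (-π) k0 = k0)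
    (hp0 : ∀ x, 0 < pf c k0 x) :
    ∃ k : ℝ → BR, k 0 = k0 ∧ (∀ T, GSol T k) ∧
      ∃ δ > 0, ∀ t, 0 ≤ t → ∀ x, δ ≤ pf c (k t) x := by
  obtain ⟨K, δ, hK, hδ, H⟩ := apriori c k0 hp0
  obtain ⟨T, hT, HL⟩ := local_sol (B := BR) K hK
  have step : ∀ k1 : BR, Sm k1 → ‖k1‖ ≤ K → avg k1 = 1 → tr (-π) k1 = k1 →
      ∃ k : ℝ → BR, k 0 = k1 ∧ GSol T k := by
    intro k1 hs1 hn ha hp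
    obtain ⟨k, hk0, hk, hinv⟩ := HL k1 hs1 hn
    exact ⟨k, hk0, hk, fun t ht => by rw [hk.avg_const t ht, hk0, ha], fun t _ => hinv _ hp t⟩
  have hk0K : ‖k0‖ ≤ K := by
    have := H 0 (fun _ => k0) ⟨⟨fun t _ => hs, fun j => continuousOn_const, fun t ht => ?_⟩, fun t _ => h1, fun t _ => hπ⟩
      rfl 0 (by simp)
    · exact this.1
    · rw [Icc_self]
      exact HasFDerivWithinAt.of_subsingleton Set.subsingleton_singleton
  let Q := fun (n : ℕ) (k : ℝ → BR) => k 0 = k0 ∧ GSol (n * T) k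
  have next : ∀ (n : ℕ) (k : {k // Q n k}), ∃ k' : {k' // Q (n + 1) k'}, ∀ t ≤ n * T, k'.1 t = k.1 t := by
    rintro n ⟨k, hk0, hk⟩
    have hn : (0:ℝ) ≤ n * T := by positivity
    have hmem : (n * T : ℝ) ∈ Icc 0 (n * T : ℝ) := ⟨hn, le_rfl⟩
    obtain ⟨k2, hk2, hS⟩ := step (k (n * T)) (hk.sm _ hmem) (H _ k hk hk0 _ hmem).1 (hk.av1 _ hmem) (hk.per _ hmem)
    refine ⟨⟨glue (n * T) k k2, ?_, ?_⟩, fun t ht => glue_left ht⟩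
    · rw [glue_left hn, hk0]
    · have := GSol.glue hn hT.le hk hS hk2
      push_cast
      rwa [add_mul, one_mul]
  obtain ⟨k1, hk1, hS1⟩ := step k0 hs hk0K h1 hπ
  have hQ0 : Q 0 k1 := ⟨hk1, hS1.mono (by simp [hT.le])⟩
  choose f hf using next
  let q : ∀ n : ℕ, {k // Q n k} := fun n => Nat.rec ⟨k1, hQ0⟩ (fun n k => f n k) n
  have hq : ∀ n : ℕ, ∀ t ≤ n * T, (q (n + 1)).1 t = (q n).1 t := fun n => hf n (q n)
  have hq2 : ∀ n m : ℕ, ∀ t ≤ n * T, (q (n + m)).1 t = (q n).1 t := by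
    intro n m t ht
    induction m with
    | zero => rfl
    | succ m ih =>
      rw [← ih, ← add_assoc]
      refine hq _ t (ht.trans ?_)
      push_cast; nlinarith [(Nat.cast_nonneg m : (0:ℝ) ≤ m)]
  let k : ℝ → BR := fun t => (q ⌈t / T⌉₊).1 t
  have hk : ∀ n : ℕ, ∀ t ∈ Icc 0 (n * T : ℝ), k t = (q n).1 t := by
    intro n t ht
    have h2 : ⌈t / T⌉₊ ≤ n := Nat.ceil_le.2 ((div_le_iff₀ hT).2 ht.2)
    obtain ⟨m, hm⟩ := Nat.exists_eq_add_of_le h2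
    rw [hm]
    refine (hq2 _ _ t ?_).symm
    exact (div_le_iff₀ hT).1 (Nat.le_ceil _)
  have hG : ∀ S, GSol S k := by
    intro S
    have := ((q ⌈S / T⌉₊).2.2.congr (hk _))
    exact this.mono ((div_le_iff₀ hT).1 (Nat.le_ceil _))
  have hk00 : k 0 = k0 := by
    rw [hk 0 0 (by simp)]; exact (q 0).2.1
  exact ⟨k, hk00, hG, δ, hδ, fun t ht x => (H t k (hG t) hk00 t ⟨ht, le_rfl⟩).2 x⟩

end GAPF

namespace GAPF
open scoped ContDiff Topology
open TrSp TrMul TrPer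

section cd
variable {B : Type*} [NormedAddCommGroup B] [NormedSpace ℝ B] [TrSp B] [CompleteSpace B]

theorem Sm.conv_one {f : B} (hf : Sm f) (h : ℝ) :
    TrSp.tr (-h) f - f + conv (ContinuousMap.const ℝ 1) 0 h (GAPF.D f) = 0 := by
  have hc : Continuous fun y => -(TrSp.tr (-y) (GAPF.D f)) := ((tr_cont (GAPF.D f)).comp continuous_neg).neg
  have := intervalIntegral.integral_eq_sub_of_hasDerivAt (a := 0) (b := h)
    (fun y _ => hf.hasDerivAt_neg y) (hc.intervalIntegrable _ _)
  rw [intervalIntegral.integral_neg, neg_zero, tr_zero] at this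
  rw [conv_apply, ← this]; simp

theorem conv_one_inj {u v : B} (h : ∀ h, conv (ContinuousMap.const ℝ 1) 0 h u = conv (ContinuousMap.const ℝ 1) 0 h v) :
    u = v := by
  have key : ∀ u : B, HasDerivAt (fun h => conv (ContinuousMap.const ℝ 1) 0 h u) u 0 := by
    intro u
    have hc : Continuous fun y => (ContinuousMap.const ℝ (1:ℝ)) y • TrSp.tr (-y) u :=
      (ContinuousMap.continuous _).smul ((tr_cont u).comp continuous_neg)
    have := (hc.integral_hasStrictDerivAt 0 0).hasDerivAt
    simpa [conv_apply, tr_zero] using this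
  have h1 := key v
  simp only [← h] at h1
  exact (key u).unique h1

theorem zero_of_deriv {f : ℝ → B} (hd : ∀ t ∈ Ici (0:ℝ), HasDerivWithinAt f 0 (Ici 0) t) (h0 : f 0 = 0) :
    ∀ t ∈ Ici (0:ℝ), f t = 0 := by
  intro t ht
  rw [← h0]
  refine constant_of_has_deriv_right_zero (b := t) (fun s hs => ((hd s hs.1).mono Icc_subset_Ici_self).continuousWithinAt)
    (fun s hs => ?_) t ⟨ht, le_rfl⟩
  exact (hd s hs.1).mono (Ici_subset_Ici.2 hs.1)

theorem comm_D {f g : ℝ → B} (hf : ∀ t ∈ Ici (0:ℝ), Sm (f t)) (hg : ∀ t ∈ Ici (0:ℝ), Sm (g t))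
    (hgc : ContinuousOn (fun t => D (g t)) (Ici 0))
    (hd : ∀ t ∈ Ici (0:ℝ), HasDerivWithinAt f (g t) (Ici 0) t) :
    ∀ t ∈ Ici (0:ℝ), HasDerivWithinAt (fun t => D (f t)) (D (g t)) (Ici 0) t := by
  have hG : Continuous fun s : ℝ => D (g (max s 0)) :=
    hgc.comp_continuous (f := fun s : ℝ => max s 0) (by fun_prop) (fun s => le_max_right s 0)
  set v : ℝ → B := fun t => D (f 0) + ∫ s in (0:ℝ)..t, D (g (max s 0)) with hv
  have hvd : ∀ t ∈ Ici (0:ℝ), HasDerivWithinAt v (D (g t)) (Ici 0) t := by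
    intro t ht
    have := ((hG.integral_hasStrictDerivAt 0 t).hasDerivAt.const_add (D (f 0))).hasDerivWithinAt (s := Ici 0)
    rwa [max_eq_left (show 0 ≤ t from ht)] at this
  have hw : ∀ h : ℝ, ∀ t ∈ Ici (0:ℝ), TrSp.tr (-h) (f t) - f t + conv (ContinuousMap.const ℝ 1) 0 h (v t) = 0 := by
    intro h
    refine zero_of_deriv (fun t ht => ?_) ?_
    · have h1 := (TrSp.tr (-h) : B →L[ℝ] B).hasFDerivAt.comp_hasDerivWithinAt t (hd t ht)
      have h2 := (conv (ContinuousMap.const ℝ 1) 0 h : B →L[ℝ] B).hasFDerivAt.comp_hasDerivWithinAt t (hvd t ht)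
      refine HasDerivWithinAt.congr_deriv ((h1.fun_sub (hd t ht)).fun_add h2) ?_
      exact (hg t ht).conv_one h
    · have : v 0 = D (f 0) := by simp [hv]
      rw [this]
      exact (hf 0 self_mem_Ici).conv_one h
  have he : ∀ t ∈ Ici (0:ℝ), D (f t) = v t := by
    intro t ht
    refine conv_one_inj fun h => ?_
    have := (hf t ht).conv_one h
    rw [← hw h t ht] at this
    exact add_left_cancel this
  intro t ht
  exact (hvd t ht).congr he (he t ht)

theorem joint_deriv {f : ℝ → B} {g : B} {t h : ℝ} (hs : Sm (f t))
    (hd : HasDerivWithinAt f g (Ici 0) t) :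
    HasFDerivWithinAt (fun p : ℝ × ℝ => TrSp.tr p.2 (f p.1))
      ((ContinuousLinearMap.fst ℝ ℝ ℝ).smulRight (TrSp.tr h g) +
        (ContinuousLinearMap.snd ℝ ℝ ℝ).smulRight (TrSp.tr h (D (f t)))) (Ici 0 ×ˢ univ) (t, h) := by
  have e : ∀ p : ℝ × ℝ, TrSp.tr p.2 (f p.1) = TrSp.tr p.2 (f p.1 - f t - (p.1 - t) • g) +
      (p.1 - t) • TrSp.tr p.2 g + TrSp.tr p.2 (f t) := by
    intro p; rw [map_sub, map_sub, map_smul]; abel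
  have h3 : HasFDerivWithinAt (fun p : ℝ × ℝ => TrSp.tr p.2 (f t))
      ((ContinuousLinearMap.snd ℝ ℝ ℝ).smulRight (TrSp.tr h (D (f t)))) (Ici 0 ×ˢ univ) (t, h) := by
    have := (hs.hasDerivAt h).hasFDerivAt.comp (t, h) (ContinuousLinearMap.snd ℝ ℝ ℝ).hasFDerivAt
    refine HasFDerivWithinAt.congr_fderiv this.hasFDerivWithinAt ?_
    ext <;> simp
  have hl : Tendsto (fun p : ℝ × ℝ => p.1) (𝓝[Ici 0 ×ˢ univ] (t, h)) (𝓝[Ici 0] t) := by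
    rw [nhdsWithin_prod_eq]; exact tendsto_fst
  have hO : (fun p : ℝ × ℝ => p.1 - t) =O[𝓝[Ici 0 ×ˢ univ] (t, h)] fun p => p - (t, h) := by
    refine Asymptotics.IsBigO.of_bound 1 (Eventually.of_forall fun p => ?_)
    rw [one_mul]; exact norm_fst_le (p - (t, h))
  have h1 : HasFDerivWithinAt (fun p : ℝ × ℝ => TrSp.tr p.2 (f p.1 - f t - (p.1 - t) • g)) (0 : ℝ × ℝ →L[ℝ] B)
      (Ici 0 ×ˢ univ) (t, h) := by
    rw [hasFDerivWithinAt_iff_isLittleO]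
    simp only [sub_self, zero_smul, map_zero, ContinuousLinearMap.zero_apply, sub_zero]
    rw [hasDerivWithinAt_iff_isLittleO] at hd
    have := (hd.comp_tendsto hl).trans_isBigO hO
    refine Asymptotics.IsBigO.trans_isLittleO ?_ this
    refine Asymptotics.IsBigO.of_bound 1 (Eventually.of_forall fun p => ?_)
    rw [one_mul]; exact tr_norm _ _
  have h2 : HasFDerivWithinAt (fun p : ℝ × ℝ => (p.1 - t) • TrSp.tr p.2 g)
      ((ContinuousLinearMap.fst ℝ ℝ ℝ).smulRight (TrSp.tr h g)) (Ici 0 ×ˢ univ) (t, h) := by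
    rw [hasFDerivWithinAt_iff_isLittleO]
    have e2 : ∀ p : ℝ × ℝ, (p.1 - t) • TrSp.tr p.2 g - ((t, h).1 - t) • TrSp.tr (t, h).2 g -
        ((ContinuousLinearMap.fst ℝ ℝ ℝ).smulRight (TrSp.tr h g)) (p - (t, h)) =
        (p.1 - t) • (TrSp.tr p.2 g - TrSp.tr h g) := by
      intro p; simp [smul_sub]
    simp only [e2]
    have h0 : Tendsto (fun p : ℝ × ℝ => TrSp.tr p.2 g - TrSp.tr h g) (𝓝[Ici 0 ×ˢ univ] (t, h)) (𝓝 0) := by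
      have : Continuous fun p : ℝ × ℝ => TrSp.tr p.2 g - TrSp.tr h g :=
        ((tr_cont g).comp continuous_snd).sub continuous_const
      have := this.tendsto (t, h)
      simp only [sub_self] at this
      exact this.mono_left nhdsWithin_le_nhds
    have h4 := hO.norm_right.smul_isLittleO ((Asymptotics.isLittleO_one_iff ℝ).2 h0)
    refine Asymptotics.IsLittleO.of_norm_right ?_
    simpa using h4
  have := (h1.add h2).add h3
  rw [zero_add] at this
  exact this.congr (fun p _ => e p) (e _)

def RS (n : ℕ) (f : ℝ → B) : Prop := (∀ t ∈ Ici (0:ℝ), Sm (f t)) ∧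
  ∀ j, ContDiffOn ℝ n (fun p : ℝ × ℝ => TrSp.tr p.2 (D^[j] (f p.1))) (Ici 0 ×ˢ univ)

theorem RS.D {n : ℕ} {f : ℝ → B} (hf : RS n f) : RS n fun t => D (f t) :=
  ⟨fun t ht => (hf.1 t ht).D, fun j => hf.2 (j + 1)⟩

theorem RS.congr {n : ℕ} {f g : ℝ → B} (hf : RS n f) (h : ∀ t ∈ Ici (0:ℝ), g t = f t) : RS n g :=
  ⟨fun t ht => by rw [h t ht]; exact hf.1 t ht, fun j => (hf.2 j).congr fun p hp => by rw [h _ hp.1]⟩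

theorem RS.mkS {n : ℕ} {f : ℝ → B} (hf : ∀ t ∈ Ici (0:ℝ), Sm (f t))
    (h0 : ContDiffOn ℝ n (fun p : ℝ × ℝ => TrSp.tr p.2 (f p.1)) (Ici 0 ×ˢ univ))
    (h1 : RS n fun t => GAPF.D (f t)) : RS n f := by
  refine ⟨hf, fun j => ?_⟩
  cases j with
  | zero => exact h0
  | succ j => exact h1.2 j

theorem RS.add {n : ℕ} {f g : ℝ → B} (hf : RS n f) (hg : RS n g) : RS n fun t => f t + g t := by
  refine ⟨fun t ht => (hf.1 t ht).add (hg.1 t ht), fun j => ?_⟩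
  induction j generalizing f g with
  | zero => 
    simp only [Function.iterate_zero, id, map_add]
    exact (hf.2 0).add (hg.2 0)
  | succ j ih =>
    refine (ih hf.D hg.D).congr fun p hp => ?_
    rw [Function.iterate_succ_apply, (hf.1 _ hp.1).D_add (hg.1 _ hp.1)]

theorem RS.sub {n : ℕ} {f g : ℝ → B} (hf : RS n f) (hg : RS n g) : RS n fun t => f t - g t := by
  refine ⟨fun t ht => (hf.1 t ht).sub (hg.1 t ht), fun j => ?_⟩
  induction j generalizing f g with
  | zero => 
    simp only [Function.iterate_zero, id, map_sub]
    exact (hf.2 0).sub (hg.2 0)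
  | succ j ih =>
    refine (ih hf.D hg.D).congr fun p hp => ?_
    rw [Function.iterate_succ_apply, (hf.1 _ hp.1).D_sub (hg.1 _ hp.1)]

theorem RS.clm {n : ℕ} {f : ℝ → B} (hf : RS n f) (L : B →L[ℝ] B) (hL : ∀ h f, L (TrSp.tr h f) = TrSp.tr h (L f)) :
    RS n fun t => L (f t) := by
  refine ⟨fun t ht => (hf.1 t ht).clm L hL, fun j => ?_⟩
  refine (L.contDiff.comp_contDiffOn (hf.2 j)).congr fun p hp => ?_
  rw [Function.comp_apply, hL, (hf.1 _ hp.1).D_iter_clm L hL]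

theorem RS.cont {n : ℕ} {f : ℝ → B} (hf : RS n f) (j : ℕ) : ContinuousOn (fun t => GAPF.D^[j] (f t)) (Ici 0) := by
  have : ContinuousOn (fun t : ℝ => TrSp.tr 0 (GAPF.D^[j] (f t))) (Ici 0) :=
    (hf.2 j).continuousOn.comp (f := fun t : ℝ => (t, (0:ℝ))) (by fun_prop) (fun t ht => ⟨ht, mem_univ _⟩)
  simpa only [tr_zero] using this

theorem RS.of_cont {f : ℝ → B} (hf : ∀ t ∈ Ici (0:ℝ), Sm (f t))
    (hc : ∀ j, ContinuousOn (fun t => GAPF.D^[j] (f t)) (Ici 0)) : RS 0 f := by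
  refine ⟨hf, fun j => ?_⟩
  rw [Nat.cast_zero, contDiffOn_zero]
  exact tr_joint.comp_continuousOn (f := fun p : ℝ × ℝ => (p.2, GAPF.D^[j] (f p.1)))
    (continuousOn_snd.prodMk ((hc j).comp continuousOn_fst fun p hp => hp.1))

theorem iter_deriv {f g : ℝ → B} (hf : ∀ t ∈ Ici (0:ℝ), Sm (f t)) (hg : ∀ t ∈ Ici (0:ℝ), Sm (g t))
    (hgc : ∀ j, ContinuousOn (fun t => GAPF.D^[j] (g t)) (Ici 0))
    (hd : ∀ t ∈ Ici (0:ℝ), HasDerivWithinAt f (g t) (Ici 0) t) (j : ℕ) :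
    ∀ t ∈ Ici (0:ℝ), HasDerivWithinAt (fun t => GAPF.D^[j] (f t)) (GAPF.D^[j] (g t)) (Ici 0) t := by
  induction j generalizing f g with
  | zero => exact hd
  | succ j ih =>
    exact ih (fun t ht => (hf t ht).D) (fun t ht => (hg t ht).D) (fun j => hgc (j + 1))
      (comm_D hf hg (hgc 1) hd)

theorem RS.succ {n : ℕ} {f g : ℝ → B} (hf : RS n f) (hg : RS n g)
    (hd : ∀ t ∈ Ici (0:ℝ), HasDerivWithinAt f (g t) (Ici 0) t) : RS (n + 1) f := by
  refine ⟨hf.1, fun j => ?_⟩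
  have hu : UniqueDiffOn ℝ (Ici (0:ℝ) ×ˢ (univ : Set ℝ)) := (uniqueDiffOn_Ici 0).prod uniqueDiffOn_univ
  rw [Nat.cast_add, Nat.cast_one, contDiffOn_succ_iff_hasFDerivWithinAt_of_uniqueDiffOn hu]
  refine ⟨by simp, _, ?_, fun p hp => joint_deriv ((hf.1 _ hp.1).iter j)
    (iter_deriv hf.1 hg.1 hg.cont hd j p.1 hp.1)⟩
  refine ContDiffOn.add ?_ ?_
  · exact (ContinuousLinearMap.smulRightL ℝ (ℝ × ℝ) B (ContinuousLinearMap.fst ℝ ℝ ℝ)).contDiff.comp_contDiffOn (hg.2 j)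
  · refine (ContinuousLinearMap.smulRightL ℝ (ℝ × ℝ) B (ContinuousLinearMap.snd ℝ ℝ ℝ)).contDiff.comp_contDiffOn
      ((hf.2 (j + 1)).congr fun p hp => ?_)
    rw [Function.iterate_succ_apply']

end cd

theorem RS.mul {n : ℕ} {f g : ℝ → BR} (hf : RS n f) (hg : RS n g) : RS n fun t => f t * g t := by
  refine ⟨fun t ht => (hf.1 t ht).mul (hg.1 t ht), ?_⟩
  suffices H : ∀ j : ℕ, ∀ f g : ℝ → BR, RS n f → RS n g →
      ContDiffOn ℝ n (fun p : ℝ × ℝ => TrSp.tr p.2 (GAPF.D^[j] (f p.1 * g p.1))) (Ici 0 ×ˢ univ) from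
    fun j => H j f g hf hg
  intro j
  induction j with
  | zero =>
    intro f g hf hg
    simp only [Function.iterate_zero, id, tr_mul]
    exact (hf.2 0).mul (hg.2 0)
  | succ j ih =>
    intro f g hf hg
    have hi : ∀ j : ℕ, ∀ f g : BR, Sm f → Sm g → GAPF.D^[j] (f + g) = GAPF.D^[j] f + GAPF.D^[j] g := by
      intro j
      induction j with
      | zero => intros; rfl
      | succ j ih2 =>
        intro f g hf hg
        rw [Function.iterate_succ_apply, hf.D_add hg, ih2 _ _ hf.D hg.D]; rfl
    refine ((ih _ _ hf.D hg).add (ih _ _ hf hg.D)).congr fun p hp => ?_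
    have h1 := hf.1 _ hp.1
    have h2 := hg.1 _ hp.1
    rw [Function.iterate_succ_apply, h1.D_mul h2, hi, map_add]
    · exact h1.D.mul h2
    · exact h1.mul h2.D

theorem RS.rhs {n : ℕ} {k : ℝ → BR} (hk : RS n k) : RS n fun t => rhs (k t) := by
  have hA : RS n fun t => Aop (fq (k t)) := ((hk.mul hk).sub hk).clm GAPF.Aop fun h f => conv_tr _ _ _ _ _
  have ha : RS n fun t => acoef (k t) := hA.sub ((hA.mul hk).clm avg fun h f => conv_tr _ _ _ _ _)
  exact hk.D.D.add (ha.mul hk).D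

/-- global classical solution -/
structure Glob (k : ℝ → BR) : Prop where
  sm : ∀ t ∈ Ici (0:ℝ), Sm (k t)
  eq : ∀ t ∈ Ici (0:ℝ), HasDerivWithinAt k (rhs (k t)) (Ici 0) t
  av1 : ∀ t ∈ Ici (0:ℝ), avg (k t) = 1
  per : ∀ t ∈ Ici (0:ℝ), tr (-π) (k t) = k t
  reg : ∀ n, RS n k

theorem glob_of {k : ℝ → BR} (h : ∀ T, GSol T k) : Glob k := by
  have hm : ∀ t : ℝ, 0 ≤ t → t ∈ Icc 0 (t + 1) := fun t ht => ⟨ht, by linarith⟩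
  have hn : ∀ t : ℝ, 0 ≤ t → Icc 0 (t + 1) ∈ 𝓝[Ici 0] t := fun t ht => by
    have : Iio (t + 1) ∈ 𝓝 t := Iio_mem_nhds (by linarith)
    filter_upwards [mem_nhdsWithin_of_mem_nhds this, self_mem_nhdsWithin] with s h1 h2
    exact ⟨h2, le_of_lt h1⟩
  have sm : ∀ t ∈ Ici (0:ℝ), Sm (k t) := fun t ht => (h (t + 1)).sm t (hm t ht)
  have eq : ∀ t ∈ Ici (0:ℝ), HasDerivWithinAt k (rhs (k t)) (Ici 0) t := fun t ht =>
    ((h (t + 1)).eq t (hm t ht)).mono_of_mem_nhdsWithin (hn t ht)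
  refine ⟨sm, eq, fun t ht => (h (t + 1)).av1 t (hm t ht), fun t ht => (h (t + 1)).per t (hm t ht), fun n => ?_⟩
  induction n with
  | zero =>
    exact RS.of_cont sm fun j t ht => ((h (t + 1)).cont j t (hm t ht)).mono_of_mem_nhdsWithin (hn t ht)
  | succ n ih => exact ih.succ ih.rhs eq

theorem Glob.joint {k : ℝ → BR} (h : Glob k) :
    ContDiffOn ℝ ∞ (fun p : ℝ × ℝ => TrSp.tr p.2 (k p.1)) (Ici 0 ×ˢ univ) :=
  contDiffOn_infty.2 fun n => (h.reg n).2 0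

theorem Glob.joint_Z {k : ℝ → BR} (c : ℝ) (h : Glob k) :
    ContDiffOn ℝ ∞ (fun p : ℝ × ℝ => Zf c (k p.1) (p.2 : Cir)) (Ici 0 ×ˢ univ) := by
  have h1 : ContDiffOn ℝ ∞ (fun p : ℝ × ℝ => wf c (TrSp.tr p.2 (k p.1))) (Ici 0 ×ˢ univ) :=
    cI.contDiff.comp_contDiffOn (((Aop : BR →L[ℝ] BR).contDiff.comp_contDiffOn h.joint).add contDiffOn_const)
  have h2 : ContDiffOn ℝ ∞ (fun p : ℝ × ℝ => TrSp.tr p.2 e1) (Ici 0 ×ˢ univ) :=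
    (ContDiff.comp (g := fun x => TrSp.tr x e1) e1_sm contDiff_snd).contDiffOn
  have h3 := (pv 0 : BC →L[ℝ] ℂ).contDiff.comp_contDiffOn ((Jop : BC →L[ℝ] BC).contDiff.comp_contDiffOn
    (h2.mul (ex_contDiff.comp_contDiffOn h1)))
  refine h3.congr fun p hp => ?_
  have hw : wf c (TrSp.tr p.2 (k p.1)) = TrSp.tr p.2 (wf c (k p.1)) := by
    simp only [wf]
    rw [← cI_tr, map_add (TrSp.tr p.2), map_smul (TrSp.tr p.2), tr_one]
    congr 2; exact conv_tr _ _ _ _ _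
  simp only [Function.comp_apply, hw, ex_tr, ← tr_mul]
  have : Jop (TrSp.tr p.2 (e1 * ex (wf c (k p.1)))) = TrSp.tr p.2 (Zf c (k p.1)) := conv_tr _ _ _ _ _
  rw [this, pv_apply, trC_real, zero_add]

theorem Glob.cont_k {k : ℝ → BR} (h : Glob k) : ContDiffOn ℝ ∞ k (Ici 0) := by
  have := h.joint.comp (s := Ici (0:ℝ)) (f := fun t : ℝ => (t, (0:ℝ))) (by fun_prop) fun t ht => ⟨ht, mem_univ _⟩
  simpa [Function.comp_def, tr_zero] using this

theorem Glob.smooth_av {k : ℝ → BR} (c : ℝ) (h : Glob k) : ContDiffOn ℝ ∞ (fun t => av (pf c (k t))) (Ici 0) := by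
  have hw : ContDiffOn ℝ ∞ (fun t => wf c (k t)) (Ici 0) :=
    cI.contDiff.comp_contDiffOn (((Aop : BR →L[ℝ] BR).contDiff.comp_contDiffOn h.cont_k).add contDiffOn_const)
  have hT : ContDiffOn ℝ ∞ (fun t => Tf c (k t)) (Ici 0) := contDiffOn_const.mul (ex_contDiff.comp_contDiffOn hw)
  have hZ : ContDiffOn ℝ ∞ (fun t => Zf c (k t)) (Ici 0) := (Jop : BC →L[ℝ] BC).contDiff.comp_contDiffOn hT
  exact av.contDiff.comp_contDiffOn (cIm.contDiff.comp_contDiffOn ((cj.contDiff.comp_contDiffOn hZ).mul hT))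

end GAPF

namespace GAPF
open scoped ContDiff Topology
open TrSp TrMul TrPer

theorem inv_lemma {F F' : ℝ → ℝ} (hd : ∀ x, HasDerivAt F (F' x) x) {m : ℝ} (hm : 0 < m) (hF : ∀ x, m ≤ F' x) :
    ∃ τ : ℝ → ℝ, (∀ x, τ (F x) = x) ∧ (∀ t, F (τ t) = t) ∧ StrictMono τ ∧
      ∀ t, HasDerivAt τ (F' (τ t))⁻¹ t := by
  have hmono : StrictMono F := strictMono_of_deriv_pos fun x => by
    rw [(hd x).deriv]; exact hm.trans_le (hF x)
  have hcont : Continuous F := continuous_iff_continuousAt.2 fun x => (hd x).continuousAt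
  have hmono2 : Monotone fun x => F x - m * x := by
    refine monotone_of_deriv_nonneg (fun x => ((hd x).fun_sub ((hasDerivAt_id x).const_mul m)).differentiableAt) fun x => ?_
    have := ((hd x).fun_sub ((hasDerivAt_id x).const_mul m)).deriv
    simp only [id] at this
    rw [this]; linarith [hF x]
  have htop : Tendsto F atTop atTop := by
    refine tendsto_atTop_mono' _ ?_ (tendsto_atTop_add_const_left _ (F 0) (tendsto_id.const_mul_atTop hm))
    filter_upwards [eventually_ge_atTop 0] with x hx
    have := hmono2 hx
    simp at this ⊢; linarith
  have hbot : Tendsto F atBot atBot := by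
    refine tendsto_atBot_mono' _ ?_ (tendsto_atBot_add_const_left _ (F 0) (tendsto_id.const_mul_atBot hm))
    filter_upwards [eventually_le_atBot 0] with x hx
    have := hmono2 hx
    simp at this ⊢; linarith
  have hsurj : Function.Surjective F := hcont.surjective htop hbot
  let e := hmono.orderIsoOfSurjective F hsurj
  have he : ∀ x, e x = F x := fun x => rfl
  have h1 : ∀ x, e.symm (F x) = x := fun x => by rw [← he, e.symm_apply_apply]
  have h2 : ∀ t, F (e.symm t) = t := fun t => by rw [← he, e.apply_symm_apply]
  refine ⟨e.symm, h1, h2, e.symm.strictMono, fun t => ?_⟩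
  exact HasDerivAt.of_local_left_inverse e.symm.continuous.continuousAt (hd _) (hm.trans_le (hF _)).ne'
    (Eventually.of_forall h2)

theorem ode_smooth {τ G : ℝ → ℝ} {I : Set ℝ} (hI : UniqueDiffOn ℝ I) (hm : MapsTo τ I I)
    (hG : ContDiffOn ℝ ∞ G I) (hd : ∀ t ∈ I, HasDerivWithinAt τ (G (τ t)) I t) : ContDiffOn ℝ ∞ τ I := by
  refine contDiffOn_infty.2 fun n => ?_
  induction n with
  | zero => exact contDiffOn_zero.2 fun t ht => (hd t ht).continuousWithinAt
  | succ n ih =>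
    rw [Nat.cast_add, Nat.cast_one, contDiffOn_succ_iff_derivWithin hI]
    refine ⟨fun t ht => (hd t ht).differentiableWithinAt, by simp, ?_⟩
    refine ((hG.of_le (by exact_mod_cast le_top)).comp ih hm).congr fun t ht => ?_
    exact (hd t ht).derivWithin (hI t ht)

/-- identification of `ℂ` with the plane -/
def toP : ℂ →L[ℝ] ℝ × ℝ := Complex.reCLM.prod Complex.imCLM

theorem toP_apply (z : ℂ) : toP z = (z.re, z.im) := rfl

theorem vnorm_toP (z : ℂ) : vnorm (toP z) = ‖z‖ := by
  rw [Complex.norm_def, Complex.normSq_apply, toP_apply, vnorm]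
  congr 1; ring

/-- The initial data written in normalised arc length. -/
structure Init (X₀ : ℝ → ℝ × ℝ) (l c : ℝ) (s : ℝ → ℝ) (k0 : BR) : Prop where
  lpos : 0 < l
  ssm : ContDiff ℝ ∞ s
  spos : ∀ φ, 0 < deriv s φ
  sper : ∀ φ, s (φ + 2 * π) = s φ + 2 * π
  sm : Sm k0
  av1 : avg k0 = 1
  per : tr (-π) k0 = k0
  pos : ∀ x, 0 < pf c k0 x
  eq : ∀ φ, X₀ φ = toP (l • Zf c k0 (s φ : Cir))

section curve
variable {k : BR} {c l : ℝ} {s : ℝ → ℝ}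

theorem curve_deriv (hk : Sm k) (hπ : tr (-π) k = k) (hs : ContDiff ℝ ∞ s) (φ : ℝ) :
    HasDerivAt (fun φ => toP (l • Zf c k (s φ : Cir))) (toP ((l * deriv s φ) • Tf c k (s φ : Cir))) φ := by
  have h1 := (hk.Zf (c := c)).hasDerivAt_pt (s φ)
  rw [D_Zf hk hπ] at h1
  have h2 : HasDerivAt s (deriv s φ) φ := (hs.differentiable (by simp)).differentiableAt.hasDerivAt
  have h3 := (h1.scomp φ h2).const_smul l
  have h4 := toP.hasFDerivAt.comp_hasDerivAt φ h3
  rw [smul_smul] at h4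
  exact h4

theorem tan_deriv (hk : Sm k) (h1 : avg k = 1) (hs : ContDiff ℝ ∞ s) (φ : ℝ) :
    HasDerivAt (fun φ => toP ((l * deriv s φ) • Tf c k (s φ : Cir)))
      (toP ((l * deriv (deriv s) φ) • Tf c k (s φ : Cir) + (l * deriv s φ * deriv s φ * k (s φ : Cir)) •
        (Complex.I * Tf c k (s φ : Cir)))) φ := by
  have h2 := (hk.Tf (c := c)).hasDerivAt_pt (s φ)
  rw [D_Tf hk h1] at h2
  have h3 : HasDerivAt s (deriv s φ) φ := (hs.differentiable (by simp)).differentiableAt.hasDerivAt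
  have hs' : ContDiff ℝ ∞ (deriv s) := ((contDiff_infty_iff_deriv (𝕜 := ℝ)).1 hs).2
  have h4 : HasDerivAt (deriv s) (deriv (deriv s) φ) φ := (hs'.differentiable (by simp)).differentiableAt.hasDerivAt
  have h5 := (h4.const_mul l).fun_smul (h2.scomp φ h3)
  have h6 := toP.hasFDerivAt.comp_hasDerivAt φ h5
  refine HasDerivAt.congr_deriv h6 ?_
  congr 1
  rw [add_comm]
  congr 1
  rw [ContinuousMap.mul_apply, cI_apply, smul_smul]
  simp only [Complex.real_smul]
  push_cast; ring

theorem curve_facts (hk : Sm k) (h1 : avg k = 1) (hπ : tr (-π) k = k) (hs : ContDiff ℝ ∞ s) (hl : 0 < l)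
    (hsp : ∀ φ, 0 < deriv s φ) (hper : ∀ φ, s (φ + 2 * π) = s φ + 2 * π) {X : ℝ → ℝ × ℝ}
    (hX : ∀ φ, X φ = toP (l • Zf c k (s φ : Cir))) :
    IsSmoothClosedCurve X ∧ (∀ φ, unitTangent X φ = toP (Tf c k (s φ : Cir))) ∧
      (∀ φ, innerNormal X φ = toP (Complex.I * Tf c k (s φ : Cir))) ∧
      (∀ φ, curv X φ = k (s φ : Cir) / l) ∧ clen X = 2 * π * l := by
  obtain rfl : X = fun φ => toP (l • Zf c k (s φ : Cir)) := funext hX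
  have hd : deriv (fun φ => toP (l • Zf c k (s φ : Cir))) = fun φ => toP ((l * deriv s φ) • Tf c k (s φ : Cir)) :=
    funext fun φ => (curve_deriv hk hπ hs φ).deriv
  have hn : ∀ φ, vnorm (toP ((l * deriv s φ) • Tf c k (s φ : Cir))) = l * deriv s φ := fun φ => by
    rw [vnorm_toP, norm_smul, Tf_norm, mul_one, Real.norm_of_nonneg (mul_pos hl (hsp φ)).le]
  have hpos : ∀ φ, 0 < l * deriv s φ := fun φ => mul_pos hl (hsp φ)
  have hu : ∀ φ, unitTangent (fun φ => toP (l • Zf c k (s φ : Cir))) φ = toP (Tf c k (s φ : Cir)) := by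
    intro φ
    rw [unitTangent, hd]
    simp only []
    rw [hn, map_smul, smul_smul, inv_mul_cancel₀ (hpos φ).ne', one_smul]
  have hZ : ContDiff ℝ ∞ fun x : ℝ => Zf c k (x : Cir) := by
    have := (pv 0 : BC →L[ℝ] ℂ).contDiff.comp (hk.Zf (c := c))
    have e : (⇑(pv 0 : BC →L[ℝ] ℂ) ∘ fun h => TrSp.tr h (Zf c k)) = fun x : ℝ => Zf c k (x : Cir) := by
      ext1 x
      rw [Function.comp_apply, pv_apply, trC_real, zero_add]
    rwa [e] at this
  refine ⟨⟨?_, ?_, ?_⟩, hu, ?_, ?_, ?_⟩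
  · exact toP.contDiff.comp ((hZ.comp hs).const_smul l)
  · intro φ
    simp only [hper, pv_per]
  · intro φ h0
    rw [hd] at h0
    have := hn φ
    simp only [] at h0
    rw [h0] at this
    have h2 := hpos φ
    simp [vnorm] at this
    rcases this with h | h
    · exact hl.ne' h
    · exact (hsp φ).ne' h
  · intro φ
    rw [innerNormal, hu, toP_apply, toP_apply]; simp
  · intro φ
    rw [curv, hd, (tan_deriv hk h1 hs φ).deriv]
    simp only []
    rw [hn]
    have h3 : (Tf c k (s φ : Cir)).re ^ 2 + (Tf c k (s φ : Cir)).im ^ 2 = 1 := by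
      have := Complex.sq_norm (Tf c k (s φ : Cir))
      rw [Tf_norm, Complex.normSq_apply] at this
      linarith
    have h4 : vdet (toP ((l * deriv s φ) • Tf c k (s φ : Cir))) (toP ((l * deriv (deriv s) φ) • Tf c k (s φ : Cir) +
        (l * deriv s φ * deriv s φ * k (s φ : Cir)) • (Complex.I * Tf c k (s φ : Cir)))) =
        (l * deriv s φ) * (l * deriv s φ * deriv s φ * k (s φ : Cir)) := by
      simp only [toP_apply, vdet, Complex.smul_re, Complex.smul_im, Complex.add_re, Complex.add_im,
        Complex.I_mul_re, Complex.I_mul_im, smul_eq_mul]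
      linear_combination (l * deriv s φ) * (l * deriv s φ * deriv s φ * k (s φ : Cir)) * h3
    rw [h4]
    have := (hsp φ).ne'
    have := hl.ne'
    field_simp
  · rw [clen, hd]
    simp only [hn]
    rw [intervalIntegral.integral_const_mul, intervalIntegral.integral_deriv_eq_sub]
    · have := hper 0
      rw [zero_add] at this
      rw [this]; ring
    · exact fun x _ => (hs.differentiable (by simp)).differentiableAt
    · exact (hs.continuous_deriv (by simp)).intervalIntegrable _ _

end curve

theorem flow_of_init {X₀ : ℝ → ℝ × ℝ} {l c : ℝ} {s : ℝ → ℝ} {k0 : BR} (h : Init X₀ l c s k0) :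
    ∃ X : ℝ → ℝ → ℝ × ℝ, IsGAPFSolutionOn X X₀ (Set.Ici 0) := by
  obtain ⟨k, hk0, hG, δ, hδ, hp⟩ := global_sol c k0 h.sm h.av1 h.per h.pos
  have hg := glob_of hG
  set A : ℝ → ℝ := fun t => av (pf c (k t)) with hA
  have hAl : ∀ t ∈ Ici (0:ℝ), δ ≤ A t := by
    intro t ht
    have : 0 ≤ av (pf c (k t) - δ • (1 : BR)) := av_nonneg fun x => by
      have := hp t ht x
      simp; linarith
    rw [map_sub, map_smul, av_one] at this
    simp at this; exact this
  have hAu : ∀ t ∈ Ici (0:ℝ), A t ≤ π / 2 := by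
    intro t ht
    have : 0 ≤ av ((π / 2) • (1 : BR) - pf c (k t)) := av_nonneg fun x => by
      have := pf_le (c := c) (k t) x
      simp; linarith
    rw [map_sub, map_smul, av_one] at this
    simp at this; exact this
  have hAp : ∀ t ∈ Ici (0:ℝ), 0 < A t := fun t ht => hδ.trans_le (hAl t ht)
  have hA0 : 0 < A 0 := hAp 0 self_mem_Ici
  have hAs : ContDiffOn ℝ ∞ A (Ici 0) := hg.smooth_av c
  have hAd : ∀ t ∈ Ici (0:ℝ), HasDerivWithinAt A (2 * mu (k t) * A t) (Ici 0) t := fun t ht =>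
    av_pf_dt (hg.eq t ht) (hg.sm t ht) (hg.av1 t ht) (hg.per t ht)
  have hl := h.lpos
  set Lm : ℝ → ℝ := fun t => l * √(A 0 / A t) with hLm
  have hLp : ∀ t ∈ Ici (0:ℝ), 0 < Lm t := fun t ht => mul_pos hl (Real.sqrt_pos.2 (div_pos hA0 (hAp t ht)))
  have hLs : ContDiffOn ℝ ∞ Lm (Ici 0) :=
    contDiffOn_const.mul ((contDiffOn_const.div hAs fun t ht => (hAp t ht).ne').sqrt
      fun t ht => (div_pos hA0 (hAp t ht)).ne')
  have hL0 : Lm 0 = l := by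
    simp only [hLm]; rw [div_self hA0.ne', Real.sqrt_one, mul_one]
  have hLsq : ∀ t ∈ Ici (0:ℝ), Lm t * Lm t = l ^ 2 * A 0 / A t := fun t ht => by
    have := Real.mul_self_sqrt (div_pos hA0 (hAp t ht)).le
    simp only [hLm]
    calc _ = l ^ 2 * (√(A 0 / A t) * √(A 0 / A t)) := by ring
      _ = _ := by rw [this]; ring
  have hLd : ∀ t ∈ Ici (0:ℝ), HasDerivWithinAt Lm (-(mu (k t)) * Lm t) (Ici 0) t := by
    intro t ht
    have hne := (hAp t ht).ne'
    have h1 := (((hasDerivWithinAt_const t (Ici (0:ℝ)) (A 0)).fun_div (hAd t ht) hne).sqrt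
      (div_pos hA0 (hAp t ht)).ne').const_mul l
    refine HasDerivWithinAt.congr_deriv h1 ?_
    have h2 : √(A 0 / A t) ≠ 0 := (Real.sqrt_pos.2 (div_pos hA0 (hAp t ht))).ne'
    have h3 := Real.mul_self_sqrt (div_pos hA0 (hAp t ht)).le
    simp only [hLm]
    generalize √(A 0 / A t) = r at h2 h3
    have h4 : A 0 = r * r * A t := by rw [h3]; field_simp
    rw [h4]
    field_simp
    ring
  -- time change
  have hF'c : Continuous fun x : ℝ => Lm (max x 0) * Lm (max x 0) := by
    have : Continuous fun x : ℝ => Lm (max x 0) :=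
      hLs.continuousOn.comp_continuous (f := fun s : ℝ => max s 0) (by fun_prop) (fun s => le_max_right s 0)
    exact this.mul this
  have hF : ∀ x, HasDerivAt (fun x => ∫ y in (0:ℝ)..x, Lm (max y 0) * Lm (max y 0)) (Lm (max x 0) * Lm (max x 0)) x :=
    fun x => (hF'c.integral_hasStrictDerivAt 0 x).hasDerivAt
  have hm : 0 < l ^ 2 * A 0 / (π / 2) := by positivity
  obtain ⟨τ, hτF, hFτ, hτm, hτd⟩ := inv_lemma hF hm fun x => by
    have hx : max x 0 ∈ Ici (0:ℝ) := le_max_right x 0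
    rw [hLsq _ hx]
    exact div_le_div_of_nonneg_left (by positivity) (hAp _ hx) (hAu _ hx)
  have hτ0 : τ 0 = 0 := by
    have := hτF 0
    simpa using this
  have hτI : MapsTo τ (Ici 0) (Ici 0) := fun t ht => by
    have := hτm.monotone (show (0:ℝ) ≤ t from ht)
    rwa [hτ0] at this
  have hτd' : ∀ t ∈ Ici (0:ℝ), HasDerivWithinAt τ (Lm (τ t) * Lm (τ t))⁻¹ (Ici 0) t := fun t ht => by
    have := (hτd t).hasDerivWithinAt (s := Ici 0)
    rwa [max_eq_left (hτI ht)] at this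
  have hτs : ContDiffOn ℝ ∞ τ (Ici 0) :=
    ode_smooth (G := fun x => (Lm x * Lm x)⁻¹) (uniqueDiffOn_Ici 0) hτI
      ((hLs.mul hLs).inv fun t ht => (mul_pos (hLp t ht) (hLp t ht)).ne') hτd'
  -- the solution
  have hfacts := fun t (ht : t ∈ Ici (0:ℝ)) => curve_facts (c := c) (hg.sm _ (hτI ht)) (hg.av1 _ (hτI ht)) (hg.per _ (hτI ht))
    h.ssm (hLp _ (hτI ht)) h.spos h.sper (X := fun φ => toP (Lm (τ t) • Zf c (k (τ t)) (s φ : Cir))) fun φ => rfl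
  refine ⟨fun t φ => toP (Lm (τ t) • Zf c (k (τ t)) (s φ : Cir)), ⟨?_, ?_, ?_, ?_⟩⟩
  · intro φ
    rw [hτ0, hL0, hk0, h.eq]
  · exact fun t ht => (hfacts t ht).1
  · refine toP.contDiff.comp_contDiffOn (ContDiffOn.fun_smul ?_ ?_)
    · exact (hLs.comp hτs hτI).comp contDiffOn_fst fun p hp => hp.1
    · exact (hg.joint_Z c).comp (f := fun p : ℝ × ℝ => (τ p.1, s p.2))
        ((hτs.comp contDiffOn_fst fun p hp => hp.1).prodMk (h.ssm.comp_contDiffOn contDiffOn_snd))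
        fun p hp => ⟨hτI hp.1, mem_univ _⟩
  · refine ⟨fun t φ => acoef (k (τ t)) (s φ : Cir) / Lm (τ t), fun t ht φ => ?_⟩
    obtain ⟨-, hu, hn, hc, hcl⟩ := hfacts t ht
    rw [hu, hn, hc, hcl]
    have hI := hτI ht
    have h1 := Zf_dt (c := c) (hg.eq _ hI) (hg.sm _ hI) (hg.av1 _ hI) (hg.per _ hI)
    have h2 := (pv (s φ) : BC →L[ℝ] ℂ).hasFDerivAt.comp_hasDerivWithinAt (τ t) h1
    have h3 := (hLd _ hI).fun_smul h2
    have h4 := HasDerivWithinAt.scomp t h3 (hτd' t ht) hτI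
    have h5 := toP.hasFDerivAt.comp_hasDerivWithinAt t h4
    refine HasDerivWithinAt.congr_deriv h5 ?_
    rw [← map_smul toP, ← map_smul toP, ← map_add toP]
    congr 1
    simp only [Function.comp_apply, pv_apply]
    have hLne : (Lm (τ t) : ℂ) ≠ 0 := by exact_mod_cast (hLp _ hI).ne'
    have hπ' : (π : ℂ) ≠ 0 := by exact_mod_cast Real.pi_pos.ne'
    simp only [Yf, ContinuousMap.add_apply, ContinuousMap.mul_apply, ContinuousMap.smul_apply, cI_apply, cR_apply,
      Complex.real_smul, ContinuousMap.sub_apply, ContinuousMap.one_apply]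
    push_cast
    field_simp
    ring

end GAPF

namespace GAPF
open scoped ContDiff Topology
open TrSp TrMul TrPer

def kap (Y : ℝ → ℂ) (x : ℝ) : ℝ := ((starRingEnd ℂ) (deriv Y x) * deriv (deriv Y) x).im

section us
variable {Y : ℝ → ℂ}

theorem smd (hY : ContDiff ℝ ∞ Y) : ContDiff ℝ ∞ (deriv Y) := ((contDiff_infty_iff_deriv (𝕜 := ℝ)).1 hY).2

theorem hda {F : Type*} [NormedAddCommGroup F] [NormedSpace ℝ F] {Y : ℝ → F} (hY : ContDiff ℝ ∞ Y) (x : ℝ) :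
    HasDerivAt Y (deriv Y x) x := (hY.differentiable (by simp)).differentiableAt.hasDerivAt

theorem conj_hd {f : ℝ → ℂ} {f' : ℂ} {x : ℝ} (h : HasDerivAt f f' x) :
    HasDerivAt (fun x => (starRingEnd ℂ) (f x)) ((starRingEnd ℂ) f') x :=
  (Complex.conjCLE : ℂ →L[ℝ] ℂ).hasFDerivAt.comp_hasDerivAt x h

theorem kap_sm (hY : ContDiff ℝ ∞ Y) : ContDiff ℝ ∞ (kap Y) := by
  have h1 : ContDiff ℝ ∞ fun x => (starRingEnd ℂ) (deriv Y x) :=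
    (Complex.conjCLE : ℂ →L[ℝ] ℂ).contDiff.comp (smd hY)
  exact Complex.imCLM.contDiff.comp (h1.mul (smd (smd hY)))

theorem kap_eq (hY : ContDiff ℝ ∞ Y) (hn : ∀ x, ‖deriv Y x‖ = 1) (x : ℝ) :
    deriv (deriv Y) x = deriv Y x * (kap Y x * Complex.I) := by
  have h0 : ∀ x, (starRingEnd ℂ) (deriv Y x) * deriv Y x = 1 := fun x => by
    rw [mul_comm, Complex.mul_conj, Complex.normSq_eq_norm_sq, hn]; simp
  have h1 := (conj_hd (hda (smd hY) x)).fun_mul (hda (smd hY) x)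
  simp only [h0] at h1
  have h2 := h1.unique (hasDerivAt_const x (1:ℂ))
  have h3 := congrArg Complex.re h2
  have h4 : ((starRingEnd ℂ) (deriv Y x) * deriv (deriv Y) x).re = 0 := by
    simp at h3 ⊢; linarith
  have h5 : (starRingEnd ℂ) (deriv Y x) * deriv (deriv Y) x = kap Y x * Complex.I := by
    rw [kap, ← Complex.re_add_im ((starRingEnd ℂ) (deriv Y x) * deriv (deriv Y) x), h4]; simp
  calc deriv (deriv Y) x = ((starRingEnd ℂ) (deriv Y x) * deriv Y x) * deriv (deriv Y) x := by rw [h0, one_mul]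
    _ = deriv Y x * ((starRingEnd ℂ) (deriv Y x) * deriv (deriv Y) x) := by ring
    _ = _ := by rw [h5]

theorem lift_angle (hY : ContDiff ℝ ∞ Y) (hn : ∀ x, ‖deriv Y x‖ = 1) :
    ∃ ϑ : ℝ → ℝ, (∀ x, HasDerivAt ϑ (kap Y x) x) ∧ ∀ x, deriv Y x = Complex.exp (ϑ x * Complex.I) := by
  have hc := (kap_sm hY).continuous
  set ϑ : ℝ → ℝ := fun x => Complex.arg (deriv Y 0) + ∫ y in (0:ℝ)..x, kap Y y with hϑ
  have hd : ∀ x, HasDerivAt ϑ (kap Y x) x := fun x =>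
    (hc.integral_hasStrictDerivAt 0 x).hasDerivAt.const_add _
  refine ⟨ϑ, hd, fun x => ?_⟩
  have h1 : ∀ x, HasDerivAt (fun x => deriv Y x * Complex.exp (-(ϑ x * Complex.I))) 0 x := by
    intro x
    have h2 := ((hd x).ofReal_comp.mul_const Complex.I).fun_neg.cexp
    have h3 := (hda (smd hY) x).fun_mul h2
    refine HasDerivAt.congr_deriv h3 ?_
    rw [kap_eq hY hn]; ring
  have h2 := is_const_of_deriv_eq_zero (fun x => (h1 x).differentiableAt) (fun x => (h1 x).deriv) x 0
  have h3 : ϑ 0 = Complex.arg (deriv Y 0) := by simp [hϑ]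
  have h4 := Complex.norm_mul_exp_arg_mul_I (deriv Y 0)
  rw [hn] at h4
  simp only [h3] at h2
  have h5 : deriv Y 0 * Complex.exp (-(Complex.arg (deriv Y 0) * Complex.I)) = 1 := by
    rw [Complex.ofReal_one, one_mul] at h4
    have h6 := congrArg (fun z => z * Complex.exp (-(Complex.arg (deriv Y 0) * Complex.I))) h4
    rw [← h6, ← Complex.exp_add, add_neg_cancel, Complex.exp_zero]
  rw [h5] at h2
  calc deriv Y x = deriv Y x * Complex.exp (-(ϑ x * Complex.I)) * Complex.exp (ϑ x * Complex.I) := by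
        rw [mul_assoc, ← Complex.exp_add]; simp
    _ = _ := by rw [h2, one_mul]

theorem anti_deriv {F : Type*} [NormedAddCommGroup F] [NormedSpace ℝ F] {f : ℝ → F} {a : ℝ}
    (h : ∀ x, f (x + a) = - f x) : ∀ x, deriv f (x + a) = - deriv f x := by
  intro x
  rw [← deriv_comp_add_const]
  simp only [h]
  exact deriv.fun_neg

theorem kap_anti {a : ℝ} (h : ∀ x, Y (x + a) = - Y x) (x : ℝ) : kap Y (x + a) = kap Y x := by
  rw [kap, anti_deriv h, anti_deriv (anti_deriv h), map_neg, neg_mul_neg, kap]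

theorem per_min {f : ℝ → ℝ} (hc : Continuous f) (hp : Function.Periodic f (2 * π)) (h0 : ∀ x, 0 < f x) :
    ∃ m, 0 < m ∧ ∀ x, m ≤ f x := by
  obtain ⟨z, hz, hm⟩ := (isCompact_Icc (a := (0:ℝ)) (b := 2 * π)).exists_isMinOn
    (nonempty_Icc.2 two_pi_pos.le) hc.continuousOn
  refine ⟨f z, h0 z, fun x => ?_⟩
  obtain ⟨y, hy, hxy⟩ := hp.exists_mem_Ico₀ two_pi_pos x
  rw [hxy]; exact hm (Ico_subset_Icc_self hy)

theorem per_max {f : ℝ → ℝ} (hc : Continuous f) {M : ℝ} (hM : 0 < M) (hp : Function.Periodic f M) :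
    ∃ z, ∀ x, f x ≤ f z := by
  obtain ⟨z, hz, hm⟩ := (isCompact_Icc (a := (0:ℝ)) (b := M)).exists_isMaxOn
    (nonempty_Icc.2 hM.le) hc.continuousOn
  refine ⟨z, fun x => ?_⟩
  obtain ⟨y, hy, hxy⟩ := hp.exists_mem_Ico₀ hM x
  rw [hxy]; exact hm (Ico_subset_Icc_self hy)

theorem unit_sym (hY : ContDiff ℝ ∞ Y) (hper : Function.Periodic Y (2 * π)) (hn : ∀ x, ‖deriv Y x‖ = 1)
    (hp : ∀ x, 0 < ((starRingEnd ℂ) (Y x) * deriv Y x).im)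
    (hinj : ∀ x y, Y x = Y y → ∃ m : ℤ, x - y = m * (2 * π)) (hsym : ∀ x, ∃ y, Y y = - Y x)
    {ϑ : ℝ → ℝ} (hϑ : ∀ x, HasDerivAt ϑ (kap Y x) x) (hϑe : ∀ x, deriv Y x = Complex.exp (ϑ x * Complex.I)) :
    (∀ x, Y (x + π) = - Y x) ∧ ∫ x in (0:ℝ)..(2 * π), kap Y x = 2 * π := by
  have hPP : ∀ x, PP Y ϑ x = (starRingEnd ℂ) (Y x) * deriv Y x := fun x => by rw [PP, hϑe]
  have hZ : ∀ s, HasDerivAt Y (Complex.exp (ϑ s * Complex.I)) s := fun s => by rw [← hϑe]; exact hda hY s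
  have hp' : ∀ s, 0 < (PP Y ϑ s).im := fun s => by rw [hPP]; exact hp s
  have hYne : ∀ x, Y x ≠ 0 := fun x h0 => by have := hp x; rw [h0] at this; simp at this
  set Θ := bet Y ϑ with hΘ
  have hΘd : ∀ s, HasDerivAt Θ ((PP Y ϑ s).im / Complex.normSq (PP Y ϑ s)) s := bet_deriv hZ hϑ hp'
  have hpol : ∀ s, Y s = ‖Y s‖ * Complex.exp (Θ s * Complex.I) := polar_eq Y ϑ
  have hPPper : Function.Periodic (PP Y ϑ) (2 * π) := fun x => by
    rw [hPP, hPP, hper, per_deriv hper]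
  have hkper : Function.Periodic (kap Y) (2 * π) := fun x => by
    rw [kap, per_deriv hper, per_deriv (per_deriv hper), kap]
  have hkc := (kap_sm hY).continuous
  set M := ∫ x in (0:ℝ)..(2 * π), kap Y x with hM
  have hΘper : ∀ x, Θ (x + 2 * π) = Θ x + M := by
    intro x
    have h1 := intervalIntegral.integral_eq_sub_of_hasDerivAt (a := x) (b := x + 2 * π)
      (fun y _ => hϑ y) (hkc.intervalIntegrable _ _)
    have h2 := hkper.intervalIntegral_add_eq x 0
    rw [zero_add] at h2
    rw [hΘ, bet, bet, hPPper]
    rw [h2] at h1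
    linarith
  have hΘperz : ∀ (m : ℤ) x, Θ (x + m * (2 * π)) = Θ x + m * M := by
    have hnat : ∀ (m : ℕ) x, Θ (x + m * (2 * π)) = Θ x + m * M := by
      intro m
      induction m with
      | zero => intro x; simp
      | succ m ih =>
        intro x
        have : x + ((m + 1 : ℕ) : ℝ) * (2 * π) = (x + m * (2 * π)) + 2 * π := by push_cast; ring
        rw [this, hΘper, ih]; push_cast; ring
    intro m x
    obtain ⟨n, rfl | rfl⟩ := m.eq_nat_or_neg
    · simpa using hnat n x
    · have := hnat n (x + ((-(n:ℤ) : ℤ) : ℝ) * (2 * π))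
      have e : x + ((-(n:ℤ) : ℤ) : ℝ) * (2 * π) + n * (2 * π) = x := by push_cast; ring
      rw [e] at this
      rw [this]; push_cast; ring
  have hmono : StrictMono Θ := bet_mono hZ hϑ hp'
  have hMpos : 0 < M := by
    have := hmono (show (0:ℝ) < 0 + 2 * π by have := two_pi_pos; linarith)
    rw [hΘper] at this; linarith
  -- equality of directions
  have hdir : ∀ x y : ℝ, ∀ a b : ℝ, 0 < a → 0 < b →
      (a:ℂ) * Complex.exp (x * Complex.I) = b * Complex.exp (y * Complex.I) → ∃ m : ℤ, x = y + m * (2 * π) := by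
    intro x y a b ha hb h
    have h1 := congrArg norm h
    rw [norm_mul, norm_mul, Complex.norm_exp_ofReal_mul_I, Complex.norm_exp_ofReal_mul_I, Complex.norm_real,
      Complex.norm_real, Real.norm_of_nonneg ha.le, Real.norm_of_nonneg hb.le, mul_one, mul_one] at h1
    rw [h1] at h
    have h2 := mul_left_cancel₀ (by exact_mod_cast hb.ne') h
    obtain ⟨m, hm⟩ := Complex.exp_eq_exp_iff_exists_int.1 h2
    refine ⟨m, ?_⟩
    have := congrArg Complex.im hm
    simpa using this
  have hYn : ∀ x, 0 < ‖Y x‖ := fun x => norm_pos_iff.2 (hYne x)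
  obtain ⟨n, hMn⟩ : ∃ n : ℤ, M = n * (2 * π) := by
    have h1 := hpol (0 + 2 * π)
    have h2 := hpol 0
    rw [hper] at h1
    have h3 := h1.symm.trans h2
    obtain ⟨m, hm⟩ := hdir _ _ _ _ (hYn 0) (hYn 0) h3
    refine ⟨m, ?_⟩
    have h4 := hΘper 0
    linarith
  have hnpos : 0 < n := by
    have h1 : (0:ℝ) < n * (2 * π) := hMn ▸ hMpos
    have h2 : (0:ℝ) < n := pos_of_mul_pos_left h1 two_pi_pos.le
    exact_mod_cast h2
  -- inverse of the polar angle
  obtain ⟨m, hm, hmin⟩ := per_min (f := fun s => (PP Y ϑ s).im / Complex.normSq (PP Y ϑ s))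
    (by
      have h1 : Continuous (PP Y ϑ) := continuous_iff_continuousAt.2 fun s => (PP_deriv hZ hϑ s).continuousAt
      refine (Complex.continuous_im.comp h1).div (Complex.continuous_normSq.comp h1) fun s h0 => ?_
      have := bet_pos hZ hϑ hp' s
      have h0' : Complex.normSq (PP Y ϑ s) = 0 := h0
      rw [h0'] at this; simp at this)
    (fun s => by simp only [hPPper s]) (bet_pos hZ hϑ hp')
  obtain ⟨Ψ, hΨΘ, hΘΨ, hΨm, hΨd⟩ := inv_lemma hΘd hm hmin
  have hΨc : Continuous Ψ := continuous_iff_continuousAt.2 fun s => (hΨd s).continuousAt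
  have hΨper : ∀ θ, Ψ (θ + M) = Ψ θ + 2 * π := fun θ => by
    rw [← hΨΘ (Ψ θ + 2 * π)]
    congr 1
    have := hΘper (Ψ θ)
    rw [hΘΨ] at this
    exact this.symm
  have hn1 : M = 2 * π := by
    let ρ : ℝ → ℝ := fun θ => ‖Y (Ψ θ)‖
    have hρc : Continuous ρ := (hY.continuous.comp hΨc).norm
    have hρp : Function.Periodic ρ M := fun θ => by simp only [ρ, hΨper, hper (Ψ θ)]
    obtain ⟨z, hz⟩ := per_max hρc hMpos hρp
    have hfc : Continuous fun θ => ρ (θ + 2 * π) - ρ θ := by fun_prop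
    obtain ⟨θ, -, hθ⟩ := intermediate_value_uIcc (a := z) (b := z - 2 * π) hfc.continuousOn
      (show (0:ℝ) ∈ uIcc _ _ from by
        rw [mem_uIcc]; left
        constructor
        · linarith [hz (z + 2 * π)]
        · rw [sub_add_cancel]; linarith [hz (z - 2 * π)])
    have hθ' : ‖Y (Ψ (θ + 2 * π))‖ = ‖Y (Ψ θ)‖ := by
      have : ρ (θ + 2 * π) - ρ θ = 0 := hθ
      simp only [ρ] at this; linarith
    have hYY : Y (Ψ (θ + 2 * π)) = Y (Ψ θ) := by
      rw [hpol (Ψ (θ + 2 * π)), hpol (Ψ θ), hθ', hΘΨ, hΘΨ]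
      congr 1
      rw [Complex.exp_eq_exp_iff_exists_int]
      exact ⟨1, by push_cast; ring⟩
    obtain ⟨j, hj⟩ := hinj _ _ hYY
    have h1 := hΘperz j (Ψ θ)
    rw [← hj, add_sub_cancel, hΘΨ, hΘΨ, hMn] at h1
    have h2 : ((j * n : ℤ) : ℝ) * (2 * π) = 1 * (2 * π) := by push_cast; linarith
    have h3 := mul_right_cancel₀ two_pi_pos.ne' h2
    have h4 : j * n = 1 := by exact_mod_cast h3
    have h5 : n = 1 := by
      have := Int.eq_one_or_neg_one_of_mul_eq_one' h4
      omega
    rw [hMn, h5]; simp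
  refine ⟨?_, hn1⟩
  let g : ℝ → ℝ := fun x => Ψ (Θ x + π)
  have hgY : ∀ x, Y (g x) = - Y x := by
    intro x
    obtain ⟨y, hy⟩ := hsym x
    have h1 : (‖Y y‖ : ℂ) * Complex.exp (Θ y * Complex.I) = ‖Y x‖ * Complex.exp ((Θ x + π : ℝ) * Complex.I) := by
      rw [← hpol, hy]
      push_cast
      rw [add_mul, Complex.exp_add, Complex.exp_pi_mul_I, mul_neg_one, mul_neg, ← hpol]
    obtain ⟨j, hj⟩ := hdir _ _ _ _ (hYn y) (hYn x) h1
    have h2 := hΘperz (-j) y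
    rw [hn1, hj] at h2
    have h3 : Θ (y + ((-j : ℤ) : ℝ) * (2 * π)) = Θ x + π := by rw [h2]; push_cast; ring
    have h4 : g x = y + ((-j : ℤ) : ℝ) * (2 * π) := by
      simp only [g]; rw [← h3, hΨΘ]
    rw [h4, ← hy]
    exact hper.int_mul (-j) y
  have hgd : ∀ x, ∃ a, 0 < a ∧ HasDerivAt g a x := by
    intro x
    refine ⟨_, ?_, (hΨd (Θ x + π)).comp x ((hΘd x).add_const π)⟩
    exact mul_pos (inv_pos.2 (bet_pos hZ hϑ hp' _)) (bet_pos hZ hϑ hp' _)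
  have hg1 : ∀ x, HasDerivAt g 1 x := by
    intro x
    obtain ⟨a, ha, hd⟩ := hgd x
    have h1 := (hda hY (g x)).scomp x hd
    have h2 : (Y ∘ g) = fun x => - Y x := funext hgY
    rw [h2] at h1
    have h3 := h1.unique (hda hY x).fun_neg
    have h4 := congrArg norm h3
    rw [norm_smul, norm_neg, hn, hn, mul_one, Real.norm_of_nonneg ha.le] at h4
    rwa [h4] at hd
  have hgx : ∀ x, g x = x + g 0 := by
    intro x
    have hd : ∀ x, HasDerivAt (fun x => g x - x) 0 x := fun x => by
      simpa using (hg1 x).fun_sub (hasDerivAt_id x)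
    have := is_const_of_deriv_eq_zero (fun x => (hd x).differentiableAt) (fun x => (hd x).deriv) x 0
    simp only [sub_zero] at this; linarith
  have hgg : g (g 0) = 0 + 2 * π := by
    simp only [g]
    rw [hΘΨ, add_assoc, ← two_mul, ← hn1, hΨper, hΨΘ, hn1]
  have hg0 : g 0 = π := by
    rw [hgx (g 0)] at hgg; linarith
  intro x
  rw [← hgY, hgx, hg0]

theorem unit_speed (hY : ContDiff ℝ ∞ Y) (hper : Function.Periodic Y (2 * π)) (hn : ∀ x, ‖deriv Y x‖ = 1)
    (hp : ∀ x, 0 < ((starRingEnd ℂ) (Y x) * deriv Y x).im)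
    (hinj : ∀ x y, Y x = Y y → ∃ m : ℤ, x - y = m * (2 * π)) (hsym : ∀ x, ∃ y, Y y = - Y x) :
    ∃ (c : ℝ) (k0 : BR), Sm k0 ∧ avg k0 = 1 ∧ tr (-π) k0 = k0 ∧ (∀ x, 0 < pf c k0 x) ∧
      ∀ x : ℝ, Zf c k0 (x : Cir) = Y x := by
  obtain ⟨ϑ, hϑ, hϑe⟩ := lift_angle hY hn
  obtain ⟨hπ, hM⟩ := unit_sym hY hper hn hp hinj hsym hϑ hϑe
  have hkper : Function.Periodic (kap Y) (2 * π) := fun x => by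
    rw [kap, per_deriv hper, per_deriv (per_deriv hper), kap]
  set k0 : BR := lft (kap Y) hkper (kap_sm hY).continuous with hk0
  have hk0a : ∀ x : ℝ, k0 (x : Cir) = kap Y x := fun x => rfl
  have hsm : Sm k0 := lft_sm _ _ (kap_sm hY)
  have hav : avg k0 = 1 := by
    rw [avg_eq, av_eq]
    simp only [hk0a]
    rw [hM]
    have : 1 / (2 * π) * (2 * π) = 1 := by have := two_pi_pos.ne'; field_simp
    rw [this, one_smul]
  have hkπ : tr (-π) k0 = k0 := by
    apply extR
    intro x
    rw [trC_real, hk0a, hk0a, ← kap_anti hπ, neg_add_cancel_right]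
  set c := ϑ 0 - tht 0 k0 0 with hc
  have hth : ∀ x, tht c k0 x = ϑ x := by
    intro x
    have hd : ∀ x, HasDerivAt (fun x => tht c k0 x - ϑ x) 0 x := fun x => by
      have := (tht_deriv (c := c) hsm hav x).fun_sub (hϑ x)
      rw [hk0a, sub_self] at this
      exact this
    have := is_const_of_deriv_eq_zero (fun x => (hd x).differentiableAt) (fun x => (hd x).deriv) x 0
    have h0 : tht c k0 0 = ϑ 0 := by simp only [hc, tht]; ring
    rw [h0] at this; linarith
  have hZY : ∀ x : ℝ, Zf c k0 (x : Cir) = Y x := by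
    have hd : ∀ x, HasDerivAt (fun x : ℝ => Zf c k0 (x : Cir) - Y x) 0 x := fun x => by
      have := (Zf_deriv (c := c) hsm hkπ x).fun_sub (hda hY x)
      rw [hϑe, hth, sub_self] at this
      exact this
    have hcst := fun x y => is_const_of_deriv_eq_zero (fun x => (hd x).differentiableAt) (fun x => (hd x).deriv) x y
    intro x
    have h1 := hcst (x + π) x
    rw [Zf_pi hkπ, hπ] at h1
    have h2 : (2:ℂ) * (Zf c k0 (x : Cir) - Y x) = 0 := by linear_combination -h1
    have h3 := (mul_eq_zero.1 h2).resolve_left two_ne_zero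
    exact sub_eq_zero.1 h3
  refine ⟨c, k0, hsm, hav, hkπ, fun x => ?_, hZY⟩
  induction x using QuotientAddGroup.induction_on with
  | H x =>
    have h1 : Pf c k0 (x : Cir) = (starRingEnd ℂ) (Y x) * deriv Y x := by
      rw [← PP_eq, PP, hth, hϑe]; simp only [hZY]
    have := hp x
    rw [← h1] at this
    exact this

end us
end GAPF

namespace GAPF
open scoped ContDiff Topology
open TrSp TrMul TrPer

def ofP : (ℝ × ℝ) →L[ℝ] ℂ :=
  Complex.ofRealCLM.comp (ContinuousLinearMap.fst ℝ ℝ ℝ) +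
    (Complex.I • Complex.ofRealCLM).comp (ContinuousLinearMap.snd ℝ ℝ ℝ)

theorem ofP_apply (v : ℝ × ℝ) : ofP v = ⟨v.1, v.2⟩ := by
  apply Complex.ext <;> simp [ofP]

theorem toP_ofP (v : ℝ × ℝ) : toP (ofP v) = v := by
  rw [toP_apply, ofP_apply]

theorem norm_ofP (v : ℝ × ℝ) : ‖ofP v‖ = vnorm v := by
  rw [← vnorm_toP, toP_ofP]

theorem int_shift {s : ℝ → ℝ} (h : ∀ φ, s (φ + 2 * π) = s φ + 2 * π) (m : ℤ) (x : ℝ) :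
    s (x + m * (2 * π)) = s x + m * (2 * π) := by
  have hp : Function.Periodic (fun x => s x - x) (2 * π) := fun x => by
    simp only [h]; ring
  have h1 : s (x + m * (2 * π)) - (x + m * (2 * π)) = s x - x := hp.int_mul m x
  linarith

theorem init_of (X₀ : ℝ → ℝ × ℝ)
    (hX₀ : IsSmoothClosedCurve X₀) (hemb : IsEmbeddedCurve X₀)
    (hstar₀ : StarShapedWrt X₀ 0) (hsym₀ : CentroSymmetricWrt X₀ 0) :
    ∃ l c s k0, Init X₀ l c s k0 := by
  have hπ := two_pi_pos
  have hX : ContDiff ℝ ∞ X₀ := hX₀.smooth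
  set W : ℝ → ℂ := fun φ => ofP (X₀ φ) with hW
  have hWs : ContDiff ℝ ∞ W := ofP.contDiff.comp hX
  have hWd : ∀ φ, deriv W φ = ofP (deriv X₀ φ) := fun φ =>
    (ofP.hasFDerivAt.comp_hasDerivAt φ (hda hX φ)).deriv
  have hWper : Function.Periodic W (2 * π) := fun φ => by simp only [hW, hX₀.periodic φ]
  have hWne : ∀ φ, deriv W φ ≠ 0 := fun φ h0 => hX₀.regular φ (by
    rw [← toP_ofP (deriv X₀ φ), ← hWd, h0, map_zero])
  set v : ℝ → ℝ := fun φ => ‖deriv W φ‖ with hv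
  have hvs : ContDiff ℝ ∞ v := (smd hWs).norm ℝ hWne
  have hvp : ∀ φ, 0 < v φ := fun φ => norm_pos_iff.2 (hWne φ)
  have hvper : Function.Periodic v (2 * π) := fun φ => by simp only [hv, per_deriv hWper φ]
  have hvc := hvs.continuous
  set L := ∫ y in (0:ℝ)..(2 * π), v y with hL
  have hLpos : 0 < L := intervalIntegral.intervalIntegral_pos_of_pos (hvc.intervalIntegrable _ _) hvp hπ
  set l := L / (2 * π) with hl
  have hlpos : 0 < l := div_pos hLpos hπ
  set s : ℝ → ℝ := fun φ => l⁻¹ * ∫ y in (0:ℝ)..φ, v y with hs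
  have hsd : ∀ φ, HasDerivAt s (l⁻¹ * v φ) φ := fun φ =>
    (hvc.integral_hasStrictDerivAt 0 φ).hasDerivAt.const_mul _
  have hsd' : deriv s = fun φ => l⁻¹ * v φ := funext fun φ => (hsd φ).deriv
  have hs's : ContDiff ℝ ∞ (fun φ => l⁻¹ * v φ) := contDiff_const.mul hvs
  have hss : ContDiff ℝ ∞ s := by
    rw [contDiff_infty_iff_deriv]
    exact ⟨fun φ => (hsd φ).differentiableAt, hsd' ▸ hs's⟩
  have hsp : ∀ φ, 0 < l⁻¹ * v φ := fun φ => mul_pos (inv_pos.2 hlpos) (hvp φ)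
  have hsper : ∀ φ, s (φ + 2 * π) = s φ + 2 * π := fun φ => by
    have h1 := hvper.intervalIntegral_add_eq φ 0
    rw [zero_add] at h1
    have h2 := intervalIntegral.integral_add_adjacent_intervals (hvc.intervalIntegrable 0 φ)
      (hvc.intervalIntegrable φ (φ + 2 * π)) (μ := volume)
    simp only [hs]
    rw [← h2, h1, ← hL, mul_add, hl]
    congr 1
    field_simp
  obtain ⟨m, hm, hmin⟩ := per_min hs's.continuous (fun φ => by simp only [hvper φ]) hsp
  obtain ⟨σ, hσs, hsσ, -, hσd⟩ := inv_lemma hsd hm hmin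
  have hσsm : ContDiff ℝ ∞ σ := by
    rw [← contDiffOn_univ]
    refine ode_smooth (G := fun x => (l⁻¹ * v x)⁻¹) uniqueDiffOn_univ (mapsTo_univ _ _) ?_
      fun t _ => (hσd t).hasDerivWithinAt
    exact (hs's.inv fun x => (hsp x).ne').contDiffOn
  have hσper : ∀ x, σ (x + 2 * π) = σ x + 2 * π := fun x => by
    rw [← hσs (σ x + 2 * π), hsper, hsσ]
  set Y : ℝ → ℂ := fun x => l⁻¹ • W (σ x) with hY
  have hYs : ContDiff ℝ ∞ Y := (hWs.comp hσsm).const_smul l⁻¹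
  have hYd : ∀ x, HasDerivAt Y ((v (σ x))⁻¹ • deriv W (σ x)) x := fun x => by
    have h1 := ((hda hWs (σ x)).scomp x (hσd x)).fun_const_smul l⁻¹
    refine HasDerivAt.congr_deriv h1 ?_
    rw [smul_smul]
    congr 1
    have := hvp (σ x)
    field_simp
  have hYd' : ∀ x, deriv Y x = (v (σ x))⁻¹ • deriv W (σ x) := fun x => (hYd x).deriv
  have hYper : Function.Periodic Y (2 * π) := fun x => by simp only [hY, hσper, hWper (σ x)]
  have hWinj : ∀ a b, W a = W b → ∃ m : ℤ, a - b = m * (2 * π) := by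
    intro a b hab
    have hXab : X₀ a = X₀ b := by rw [← toP_ofP (X₀ a), ← toP_ofP (X₀ b)]; exact congrArg toP hab
    have ha := toIcoMod_mem_Ico' hπ a
    have hb := toIcoMod_mem_Ico' hπ b
    have h1 : X₀ (toIcoMod hπ 0 a) = X₀ (toIcoMod hπ 0 b) := by
      have h5 : ∀ a, X₀ (toIcoMod hπ 0 a) = X₀ a := fun a => hX₀.periodic.sub_zsmul_eq _
      rw [h5, h5, hXab]
    have h2 := hemb ha hb h1
    refine ⟨toIcoDiv hπ 0 a - toIcoDiv hπ 0 b, ?_⟩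
    have h3 := toIcoMod_add_toIcoDiv_zsmul hπ 0 a
    have h4 := toIcoMod_add_toIcoDiv_zsmul hπ 0 b
    rw [zsmul_eq_mul] at h3 h4
    push_cast
    linarith
  obtain ⟨c, k0, hk1, hk2, hk3, hk4, hk5⟩ := unit_speed hYs hYper
    (fun x => by
      rw [hYd', norm_smul, norm_inv, Real.norm_of_nonneg (hvp _).le]
      exact inv_mul_cancel₀ (hvp _).ne')
    (fun x => by
      have h1 := hstar₀ (σ x)
      have h2 : unitTangent X₀ (σ x) = (v (σ x))⁻¹ • deriv X₀ (σ x) := by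
        rw [unitTangent, ← norm_ofP, ← hWd]
      rw [h2, sub_zero, vdet] at h1
      have h3 : ((starRingEnd ℂ) (Y x) * deriv Y x).im = l⁻¹ * ((X₀ (σ x)).1 * ((v (σ x))⁻¹ • deriv X₀ (σ x)).2
          - (X₀ (σ x)).2 * ((v (σ x))⁻¹ • deriv X₀ (σ x)).1) := by
        rw [hYd', hWd]
        simp only [hY, hW, ofP_apply]
        simp
        ring
      rw [h3]
      exact mul_pos (inv_pos.2 hlpos) h1)
    (fun x y hxy => by
      have h1 : W (σ x) = W (σ y) := smul_right_injective ℂ (inv_pos.2 hlpos).ne' hxy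
      obtain ⟨j, hj⟩ := hWinj _ _ h1
      refine ⟨j, ?_⟩
      have h2 := int_shift hsper j (σ y)
      rw [← hj, add_sub_cancel, hsσ, hsσ] at h2
      linarith)
    (fun x => by
      have h1 : -X₀ (σ x) ∈ range X₀ := by
        rw [← hsym₀]
        exact ⟨X₀ (σ x), mem_range_self _, by simp⟩
      obtain ⟨y, hy⟩ := h1
      refine ⟨s y, ?_⟩
      simp only [hY, hW, hσs, hy, map_neg, smul_neg])
  refine ⟨l, c, s, k0, hlpos, hss, fun φ => ?_, hsper, hk1, hk2, hk3, hk4, fun φ => ?_⟩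
  · rw [hsd']; exact hsp φ
  · rw [hk5]
    simp only [hY, hσs]
    rw [smul_inv_smul₀ hlpos.ne']
    exact (toP_ofP _).symm

end GAPF

/-- Gage's area-preserving flow with a smooth, embedded, star-shaped, centrosymmetric
initial curve exists globally on `[0, ∞)`. -/
theorem gapf_global_existence
    (X₀ : ℝ → ℝ × ℝ)
    (hX₀ : IsSmoothClosedCurve X₀) (hemb : IsEmbeddedCurve X₀)
    (hstar₀ : StarShapedWrt X₀ 0) (hsym₀ : CentroSymmetricWrt X₀ 0) :
    ∃ X : ℝ → ℝ → ℝ × ℝ, IsGAPFSolutionOn X X₀ (Set.Ici 0) := by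
  obtain ⟨l, c, s, k0, h⟩ := GAPF.init_of X₀ hX₀ hemb hstar₀ hsym₀
  exact GAPF.flow_of_init h
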